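/- Let X be a Polish space, p ≥ 1, μ ∈ P(X), ν ∈ P_p(ℝ^d), and let C : X × P_p(ℝ^d) → [0,∞] be lower semicontinuous, convex in its second argument, and decreasing in the increasing convex order in its second argument. Assume condition (B): C(x,ρ) ≤ a(x) + ∫ b dρ for some μ-integrable a : X → ℝ and ν-integrable b : ℝ^d → ℝ; and condition (C): for every increasing sequence (Y_k) of Borel sets with ⋃_k Y_k = ℝ^d, C(x,ρ) ≥ limsup_k C(x, ρ(· ∩ Y_k)/ρ(Y_k)). Then inf_{π ∈ Π(μ,ν)} ∫_X C(x, π_x) dμ(x) = sup { ∫_X ψ^C dμ − ∫ ψ dν : (ψ^C, ψ) ∈ Φ_C(μ,ν), ψ convex and coordinatewise increasing }, and this supremum is attained by some ν-integrable increasing convex function ψ : ℝ^d → (−∞,∞]. -/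

import Mathlib

open MeasureTheory Set Filter Topology
open scoped ENNReal

noncomputable section

/-- `ℝ^d`, modelled as Euclidean space. -/
abbrev Rd (d : ℕ) : Type := EuclideanSpace ℝ (Fin d)

/-- A Borel measure on `ℝ^d` has finite `p`-th moment. -/
def HasMomentP (p : ℝ) {d : ℕ} (ρ : Measure (Rd d)) : Prop :=
  ∫⁻ y, ENNReal.ofReal (‖y‖ ^ p) ∂ρ ≠ ⊤

/-- `P_p(ℝ^d)`: Borel probability measures on `ℝ^d` with finite `p`-th moment. -/
abbrev Pp (p : ℝ) (d : ℕ) : Type :=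
  {ρ : Measure (Rd d) // IsProbabilityMeasure ρ ∧ HasMomentP p ρ}

/-- Continuous test functions of growth of order at most `p`. -/
def GrowthP (p : ℝ) {d : ℕ} (f : Rd d → ℝ) : Prop :=
  Continuous f ∧ ∃ K : ℝ, ∀ y, |f y| ≤ K * (1 + ‖y‖ ^ p)

/-- The `p`-weak topology on `P_p(ℝ^d)`: the initial topology induced by integration
against continuous functions of growth of order at most `p`. -/
instance PpTopology (p : ℝ) (d : ℕ) : TopologicalSpace (Pp p d) :=
  ⨅ f : {f : Rd d → ℝ // GrowthP p f},
    TopologicalSpace.induced (fun ρ : Pp p d => ∫ y, f.1 y ∂ρ.1) inferInstance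

instance PpMeasurableSpace (p : ℝ) (d : ℕ) : MeasurableSpace (Pp p d) := borel _

/-- `C_{b,p}(ℝ^d)`: continuous functions bounded from below by a constant and bounded
above by `K (1 + |y - y₀|^p)` for some `K > 0`, `y₀`. -/
def Cbp (p : ℝ) {d : ℕ} (ψ : Rd d → ℝ) : Prop :=
  Continuous ψ ∧ (∃ c : ℝ, ∀ y, c ≤ ψ y) ∧
    ∃ K : ℝ, 0 < K ∧ ∃ y₀ : Rd d, ∀ y, ψ y ≤ K * (1 + ‖y - y₀‖ ^ p)

open scoped Classical in
/-- The nonnegative part of an extended real, as an extended nonnegative real. -/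
def erealToENN (x : EReal) : ℝ≥0∞ := if x = ⊤ then ⊤ else ENNReal.ofReal x.toReal

/-- Canonical extended integral of an `EReal`-valued function: the lower integral of the
positive part minus the lower integral of the negative part. -/
def eInt {α : Type*} [MeasurableSpace α] (μ : Measure α) (f : α → EReal) : EReal :=
  ((∫⁻ x, erealToENN (f x) ∂μ : ℝ≥0∞) : EReal) -
    ((∫⁻ x, erealToENN (-(f x)) ∂μ : ℝ≥0∞) : EReal)

/-- The convex order on measures on `ℝ^d`: `ρ₁ ≼_c ρ₂` iff `∫ f dρ₁ ≤ ∫ f dρ₂` for every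
convex function `f : ℝ^d → ℝ` (integrals taken in the extended sense). -/
def ConvexOrder {d : ℕ} (ρ₁ ρ₂ : Measure (Rd d)) : Prop :=
  ∀ f : Rd d → ℝ, ConvexOn ℝ univ f →
    eInt ρ₁ (fun y => (f y : EReal)) ≤ eInt ρ₂ (fun y => (f y : EReal))

/-- Coordinatewise increasing functions on `ℝ^d`. -/
def CoordMono {d : ℕ} (f : Rd d → ℝ) : Prop :=
  ∀ y z : Rd d, (∀ i, y i ≤ z i) → f y ≤ f z

/-- The increasing convex order on measures on `ℝ^d`. -/
def IcxOrder {d : ℕ} (ρ₁ ρ₂ : Measure (Rd d)) : Prop :=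
  ∀ f : Rd d → ℝ, ConvexOn ℝ univ f → CoordMono f →
    eInt ρ₁ (fun y => (f y : EReal)) ≤ eInt ρ₂ (fun y => (f y : EReal))

/-- `π` is a coupling of `μ` and `ν`. -/
def IsCoupling {X Y : Type*} [MeasurableSpace X] [MeasurableSpace Y]
    (π : Measure (X × Y)) (μ : Measure X) (ν : Measure Y) : Prop :=
  IsProbabilityMeasure π ∧ π.map Prod.fst = μ ∧ π.map Prod.snd = ν

open scoped Classical in
/-- Disintegration of a measure on a product space with respect to its first marginal. -/
def disint {X : Type*} [MeasurableSpace X] {Y : Type*} [MeasurableSpace Y]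
    [StandardBorelSpace Y] [Nonempty Y] (π : Measure (X × Y)) :
    ProbabilityTheory.Kernel X Y :=
  if h : IsFiniteMeasure π then (haveI := h; π.condKernel) else 0

/-- The primal weak optimal transport value `inf_{π ∈ Π(μ,ν)} ∫ C(x, π_x) dμ(x)`. -/
def primal {X : Type*} [MeasurableSpace X] {d : ℕ}
    (μ : Measure X) (ν : Measure (Rd d)) (C : X → Measure (Rd d) → ℝ≥0∞) : ℝ≥0∞ :=
  ⨅ π : {π : Measure (X × Rd d) // IsCoupling π μ ν}, ∫⁻ x, C x (disint π.1 x) ∂μ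

/-- The `C`-conjugate `ψ^C (x) = inf_{ρ ∈ P_p} ρ(ψ) + C(x, ρ)`. -/
def conj (p : ℝ) {X : Type*} [MeasurableSpace X] {d : ℕ}
    (C : X → Measure (Rd d) → ℝ≥0∞) (ψ : Rd d → ℝ) (x : X) : EReal :=
  ⨅ ρ : Pp p d, ((∫ y, ψ y ∂ρ.1 : ℝ) : EReal) + ((C x ρ.1 : ℝ≥0∞) : EReal)

/-- The dual value `μ(ψ^C) - ν(ψ)`. -/
def dualVal (p : ℝ) {X : Type*} [MeasurableSpace X] {d : ℕ}
    (μ : Measure X) (ν : Measure (Rd d)) (C : X → Measure (Rd d) → ℝ≥0∞)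
    (ψ : Rd d → ℝ) : EReal :=
  eInt μ (conj p C ψ) - ((∫ y, ψ y ∂ν : ℝ) : EReal)

end

noncomputable section

/-- `ψ ∈ L¹(ρ)`: a `(-∞,∞]`-valued Borel function that is `ρ`-integrable. -/
def MemL1 {α : Type*} [MeasurableSpace α] (ρ : Measure α) (ψ : α → EReal) : Prop :=
  Measurable ψ ∧ (∀ y, ψ y ≠ ⊥) ∧
    (∫⁻ y, erealToENN (ψ y) + erealToENN (-(ψ y)) ∂ρ) ≠ ⊤

/-- The `C`-conjugate for possibly non-regular potentials:
`ψ^C(x) = inf { ρ(ψ) + C(x,ρ) : ρ ∈ P_p(ℝ^d), ψ ∈ L¹(ρ) }`, with `inf ∅ = ⊤`. -/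
def conjL1 (p : ℝ) {X : Type*} [MeasurableSpace X] {d : ℕ}
    (C : X → Measure (Rd d) → ℝ≥0∞) (ψ : Rd d → EReal) (x : X) : EReal :=
  ⨅ ρ : {ρ : Pp p d // MemL1 ρ.1 ψ}, eInt ρ.1.1 ψ + ((C x ρ.1.1 : ℝ≥0∞) : EReal)

/-- The set `Φ_C(μ,ν)` of admissible dual pairs. -/
def InPhi (p : ℝ) {X : Type*} [MeasurableSpace X] {d : ℕ}
    (μ : Measure X) (ν : Measure (Rd d)) (C : X → Measure (Rd d) → ℝ≥0∞)
    (φ : X → EReal) (ψ : Rd d → EReal) : Prop :=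
  MemL1 μ (fun x => -φ x) ∧ MemL1 ν ψ ∧
    ∀ x : X, ∀ ρ : Pp p d, MemL1 ρ.1 ψ →
      φ x - eInt ρ.1 ψ ≤ ((C x ρ.1 : ℝ≥0∞) : EReal)

/-- Convexity for `(-∞,∞]`-valued functions on `ℝ^d`. -/
def EConvex {d : ℕ} (ψ : Rd d → EReal) : Prop :=
  ∀ y z : Rd d, ∀ t : ℝ, 0 ≤ t → t ≤ 1 →
    ψ (t • y + (1 - t) • z) ≤ (t : EReal) * ψ y + ((1 - t : ℝ) : EReal) * ψ z

/-- Coordinatewise monotonicity for `(-∞,∞]`-valued functions on `ℝ^d`. -/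
def ECoordMono {d : ℕ} (ψ : Rd d → EReal) : Prop :=
  ∀ y z : Rd d, (∀ i, y i ≤ z i) → ψ y ≤ ψ z

/-- Condition (B): the cost is bounded above by `a(x) + ρ(b)` with `a ∈ L¹(μ)`, `b ∈ L¹(ν)`. -/
def CondB (p : ℝ) {X : Type*} [MeasurableSpace X] {d : ℕ}
    (μ : Measure X) (ν : Measure (Rd d)) (C : X → Measure (Rd d) → ℝ≥0∞) : Prop :=
  ∃ a : X → ℝ, Integrable a μ ∧ ∃ b : Rd d → ℝ, Integrable b ν ∧
    ∀ x : X, ∀ ρ : Pp p d,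
      ((C x ρ.1 : ℝ≥0∞) : EReal) ≤ (a x : EReal) + eInt ρ.1 (fun y => (b y : EReal))

/-- Condition (C): upper semicontinuity of the cost along restrictions to an exhausting
increasing sequence of Borel sets. -/
def CondC (p : ℝ) {X : Type*} [MeasurableSpace X] {d : ℕ}
    (C : X → Measure (Rd d) → ℝ≥0∞) : Prop :=
  ∀ x : X, ∀ ρ : Pp p d, ∀ Y : ℕ → Set (Rd d),
    (∀ k, MeasurableSet (Y k)) → Monotone Y → (⋃ k, Y k) = Set.univ →
    Filter.limsup (fun k => C x ((ρ.1 (Y k))⁻¹ • ρ.1.restrict (Y k))) Filter.atTop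
      ≤ C x ρ.1

end

theorem erealToENN_eq_toENNReal : erealToENN = EReal.toENNReal := by
  ext x
  simp [erealToENN, EReal.toENNReal]

theorem measurable_erealToENN : Measurable erealToENN := by
  rw [erealToENN_eq_toENNReal]
  exact measurable_ereal_toENNReal

@[simp]
theorem erealToENN_coe (x : ℝ) : erealToENN (x : EReal) = ENNReal.ofReal x := by
  simp [erealToENN]

@[simp]
theorem erealToENN_neg_coe (x : ℝ) : erealToENN (-(x : EReal)) = ENNReal.ofReal (-x) := by
  rw [← EReal.coe_neg, erealToENN_coe]

section ExtendedIntegral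

variable {α : Type*} [MeasurableSpace α] {ρ : Measure α}

theorem eInt_coe_of_integrable {f : α → ℝ} (hf : Integrable f ρ) :
    eInt ρ (fun y => (f y : EReal)) = ((∫ y, f y ∂ρ : ℝ) : EReal) := by
  have h1 : ∫⁻ y, ENNReal.ofReal (f y) ∂ρ ≠ ⊤ := hf.lintegral_lt_top.ne
  have h2 : ∫⁻ y, ENNReal.ofReal (-f y) ∂ρ ≠ ⊤ := hf.neg.lintegral_lt_top.ne
  rw [integral_eq_lintegral_pos_part_sub_lintegral_neg_part hf, EReal.coe_sub]
  simp only [eInt, erealToENN_coe, erealToENN_neg_coe]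
  rw [← EReal.coe_ennreal_toReal h1, ← EReal.coe_ennreal_toReal h2]

theorem eInt_congr_ae {f g : α → EReal} (h : f =ᵐ[ρ] g) : eInt ρ f = eInt ρ g := by
  unfold eInt
  rw [lintegral_congr_ae (h.mono fun x hx => by simp only [hx] :
      (fun x => erealToENN (f x)) =ᵐ[ρ] fun x => erealToENN (g x)),
    lintegral_congr_ae (h.mono fun x hx => by simp only [hx] :
      (fun x => erealToENN (-(f x))) =ᵐ[ρ] fun x => erealToENN (-(g x)))]

theorem eInt_eq_integral {f : α → EReal} (ht : ∀ᵐ y ∂ρ, f y ≠ ⊤) (hb : ∀ᵐ y ∂ρ, f y ≠ ⊥)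
    (hf : Integrable (fun y => (f y).toReal) ρ) :
    eInt ρ f = ((∫ y, (f y).toReal ∂ρ : ℝ) : EReal) := by
  rw [← eInt_coe_of_integrable hf]
  refine eInt_congr_ae ?_
  filter_upwards [ht, hb] with y h1 h2
  exact (EReal.coe_toReal h1 h2).symm

theorem MemL1.ae_ne_top {ψ : α → EReal} (h : MemL1 ρ ψ) : ∀ᵐ y ∂ρ, ψ y ≠ ⊤ := by
  have hm : Measurable fun y => erealToENN (ψ y) + erealToENN (-(ψ y)) :=
    (measurable_erealToENN.comp h.1).add (measurable_erealToENN.comp h.1.neg)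
  filter_upwards [ae_lt_top hm h.2.2] with y hy hy'
  simp [hy', erealToENN] at hy

theorem ofReal_norm_toReal {x : EReal} (ht : x ≠ ⊤) (hb : x ≠ ⊥) :
    ENNReal.ofReal ‖x.toReal‖ = erealToENN x + erealToENN (-x) := by
  lift x to ℝ using ⟨ht, hb⟩
  rcases le_total 0 x with h | h
  · simp [abs_of_nonneg h, ENNReal.ofReal_of_nonpos (neg_nonpos.2 h)]
  · simp [abs_of_nonpos h, ENNReal.ofReal_of_nonpos h]

theorem lintegral_norm_toReal {ψ : α → EReal} (ht : ∀ᵐ y ∂ρ, ψ y ≠ ⊤) (hb : ∀ y, ψ y ≠ ⊥) :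
    ∫⁻ y, ENNReal.ofReal ‖(ψ y).toReal‖ ∂ρ
      = ∫⁻ y, erealToENN (ψ y) + erealToENN (-(ψ y)) ∂ρ :=
  lintegral_congr_ae (ht.mono fun y hy => ofReal_norm_toReal hy (hb y))

theorem MemL1.integrable {ψ : α → EReal} (h : MemL1 ρ ψ) :
    Integrable (fun y => (ψ y).toReal) ρ := by
  refine ⟨h.1.ereal_toReal.aestronglyMeasurable, ?_⟩
  rw [hasFiniteIntegral_iff_norm, lintegral_norm_toReal h.ae_ne_top h.2.1]
  exact h.2.2.lt_top

theorem memL1_of_integrable {ψ : α → EReal} (hm : Measurable ψ) (hb : ∀ y, ψ y ≠ ⊥)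
    (ht : ∀ᵐ y ∂ρ, ψ y ≠ ⊤) (hi : Integrable (fun y => (ψ y).toReal) ρ) : MemL1 ρ ψ := by
  refine ⟨hm, hb, ?_⟩
  rw [← lintegral_norm_toReal ht hb]
  exact ((hasFiniteIntegral_iff_norm _).1 hi.2).ne

theorem MemL1.eInt_eq {ψ : α → EReal} (h : MemL1 ρ ψ) :
    eInt ρ ψ = ((∫ y, (ψ y).toReal ∂ρ : ℝ) : EReal) :=
  eInt_eq_integral h.ae_ne_top (ae_of_all _ h.2.1) h.integrable

end ExtendedIntegral

section Weight

variable {d : ℕ} {p : ℝ}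

theorem continuous_norm_rpow (hp : 1 ≤ p) : Continuous fun y : Rd d => ‖y‖ ^ p :=
  continuous_norm.rpow_const fun _ => Or.inr (by linarith)

theorem integrable_norm_rpow (hp : 1 ≤ p) {ρ : Measure (Rd d)} (h : HasMomentP p ρ) :
    Integrable (fun y : Rd d => ‖y‖ ^ p) ρ := by
  refine ⟨(continuous_norm_rpow hp).aestronglyMeasurable, ?_⟩
  rw [hasFiniteIntegral_iff_norm]
  refine lt_of_le_of_lt (le_of_eq (lintegral_congr fun y => ?_)) (lt_top_iff_ne_top.2 h)
  rw [Real.norm_of_nonneg (by positivity)]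

theorem integrable_growth (hp : 1 ≤ p) {ρ : Measure (Rd d)} [IsFiniteMeasure ρ]
    (h : HasMomentP p ρ) : Integrable (fun y : Rd d => 1 + ‖y‖ ^ p) ρ :=
  (integrable_const 1).add (integrable_norm_rpow hp h)

/-- The smooth step going from `0` to `1` between the radii `r` and `r + 1`. -/
noncomputable def radialStep {E : Type*} [NormedAddCommGroup E] (r : ℝ) (y : E) : ℝ := min 1 (max (‖y‖ - r) 0)

section RadialStep

variable {E : Type*} [NormedAddCommGroup E]

theorem continuous_radialStep (r : ℝ) : Continuous (radialStep (E := E) r) := by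
  unfold radialStep; fun_prop

theorem radialStep_nonneg (r : ℝ) (y : E) : 0 ≤ radialStep r y := by
  unfold radialStep; positivity

theorem radialStep_le_one (r : ℝ) (y : E) : radialStep r y ≤ 1 := min_le_left _ _

theorem radialStep_of_le {r : ℝ} {y : E} (h : ‖y‖ ≤ r) : radialStep r y = 0 := by
  unfold radialStep; rw [max_eq_right (by linarith)]; simp

theorem radialStep_of_ge {r : ℝ} {y : E} (h : r + 1 ≤ ‖y‖) : radialStep r y = 1 := by
  unfold radialStep; exact min_eq_left (le_max_of_le_left (by linarith))

end RadialStep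

theorem exists_tail_lt (hp : 1 ≤ p) {ν : Measure (Rd d)} [IsFiniteMeasure ν]
    (hν : HasMomentP p ν) (k : ℕ) :
    ∃ r : ℝ, (k : ℝ) ≤ r ∧
      ∫⁻ y, ENNReal.ofReal ((1 + ‖y‖ ^ p) * radialStep r y) ∂ν ≤ (2⁻¹ : ℝ≥0∞) ^ k := by
  have hlim : Tendsto
      (fun n : ℕ => ∫⁻ y, ENNReal.ofReal ((1 + ‖y‖ ^ p) * radialStep (n : ℝ) y) ∂ν) atTop
      (𝓝 (∫⁻ _, 0 ∂ν)) := by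
    refine tendsto_lintegral_of_dominated_convergence
      (fun y => ENNReal.ofReal (1 + ‖y‖ ^ p)) (fun n => ?_) (fun n => ?_) ?_ ?_
    · exact (((continuous_const.add (continuous_norm_rpow hp)).mul
        (continuous_radialStep _)).measurable).ennreal_ofReal
    · refine ae_of_all _ fun y => ENNReal.ofReal_le_ofReal ?_
      exact mul_le_of_le_one_right (by positivity) (radialStep_le_one _ _)
    · exact (integrable_growth hp hν).lintegral_lt_top.ne
    · refine ae_of_all _ fun y => tendsto_const_nhds.congr' ?_
      obtain ⟨m, hm⟩ := exists_nat_ge ‖y‖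
      filter_upwards [eventually_ge_atTop m] with n hn
      rw [radialStep_of_le (hm.trans (by exact_mod_cast hn))]; simp
  rw [lintegral_zero] at hlim
  have hpos : (0 : ℝ≥0∞) < (2⁻¹ : ℝ≥0∞) ^ k := ENNReal.pow_pos (by simp) k
  obtain ⟨n, hn1, hn2⟩ := ((hlim.eventually_le_const hpos).and (eventually_ge_atTop k)).exists
  exact ⟨n, by exact_mod_cast hn2, hn1⟩

/-- A continuous integrable weight dominating every multiple of `1 + ‖y‖ ^ p` at infinity. -/
theorem exists_weight (hp : 1 ≤ p) {ν : Measure (Rd d)} [IsFiniteMeasure ν]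
    (hν : HasMomentP p ν) :
    ∃ w : Rd d → ℝ, Continuous w ∧ (∀ y, 0 ≤ w y) ∧ Integrable w ν ∧
      ∀ N : ℝ, ∃ R : ℝ, ∀ y, R ≤ ‖y‖ → N * (1 + ‖y‖ ^ p) ≤ w y := by
  choose r hrk hr using exists_tail_lt (d := d) hp hν
  have hloc : LocallyFinite fun k => Function.support (radialStep (E := Rd d) (r k)) := by
    intro y
    refine ⟨Metric.ball y 1, Metric.ball_mem_nhds y one_pos, ?_⟩
    obtain ⟨m, hm⟩ := exists_nat_ge (‖y‖ + 1)
    refine (Set.finite_lt_nat m).subset fun k hk => ?_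
    obtain ⟨z, hz1, hz2⟩ := hk
    by_contra hcon
    have h1 : (m : ℝ) ≤ k := by exact_mod_cast not_lt.1 hcon
    have h2 : ‖z‖ ≤ ‖y‖ + 1 := by
      have := norm_sub_norm_le z y
      have h3 := mem_ball_iff_norm.1 hz2
      linarith
    exact hz1 (radialStep_of_le (by linarith [hrk k]))
  have hfin : ∀ y : Rd d, (Function.support fun k => radialStep (r k) y).Finite :=
    fun y => hloc.point_finite y
  have hcont : Continuous fun y : Rd d => (1 + ‖y‖ ^ p) * ∑ᶠ k, radialStep (r k) y :=
    (continuous_const.add (continuous_norm_rpow hp)).mul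
      (continuous_finsum (fun k => continuous_radialStep _) hloc)
  have hnn : ∀ y : Rd d, 0 ≤ (1 + ‖y‖ ^ p) * ∑ᶠ k, radialStep (r k) y := fun y =>
    mul_nonneg (by positivity) (finsum_nonneg fun k => radialStep_nonneg _ _)
  refine ⟨_, hcont, hnn, ⟨hcont.aestronglyMeasurable, ?_⟩, fun N => ?_⟩
  · rw [hasFiniteIntegral_iff_norm]
    have key : ∀ y : Rd d, ENNReal.ofReal ‖(1 + ‖y‖ ^ p) * ∑ᶠ k, radialStep (r k) y‖
        = ∑' k, ENNReal.ofReal ((1 + ‖y‖ ^ p) * radialStep (r k) y) := fun y => by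
      have hs : Summable fun k => radialStep (r k) y := summable_of_hasFiniteSupport (hfin y)
      rw [Real.norm_of_nonneg (hnn y), ← tsum_eq_finsum (L := .unconditional ℕ) (hfin y), ← tsum_mul_left,
        ENNReal.ofReal_tsum_of_nonneg
          (fun k => mul_nonneg (by positivity) (radialStep_nonneg _ _)) (hs.mul_left _)]
    simp_rw [key]
    have hmeas : ∀ k, AEMeasurable
        (fun y : Rd d => ENNReal.ofReal ((1 + ‖y‖ ^ p) * radialStep (r k) y)) ν := fun k =>
      (((continuous_const.add (continuous_norm_rpow hp)).mul
        (continuous_radialStep _)).measurable).ennreal_ofReal.aemeasurable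
    rw [lintegral_tsum hmeas]
    refine lt_of_le_of_lt (ENNReal.tsum_le_tsum hr) ?_
    rw [ENNReal.tsum_geometric]
    simp
  · obtain ⟨m, hm⟩ := exists_nat_ge N
    refine ⟨(∑ k ∈ Finset.range m, |r k|) + 1, fun y hy => ?_⟩
    rw [mul_comm N]
    refine mul_le_mul_of_nonneg_left (hm.trans ?_) (by positivity)
    rw [← tsum_eq_finsum (L := .unconditional ℕ) (hfin y)]
    have hs : Summable fun k => radialStep (r k) y := summable_of_hasFiniteSupport (hfin y)
    refine le_trans (le_of_eq ?_)
      (hs.sum_le_tsum (Finset.range m) fun k _ => radialStep_nonneg _ _)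
    rw [Finset.sum_congr rfl fun k hk => radialStep_of_ge (r := r k) (y := y) ?_]
    · simp
    · have := Finset.single_le_sum (f := fun k => |r k|) (fun i _ => abs_nonneg _) hk
      linarith [le_abs_self (r k)]

end Weight

section Compactness

variable {d : ℕ} {p : ℝ}

theorem GrowthP.integrable (hp : 1 ≤ p) {f : Rd d → ℝ} (hf : GrowthP p f) (ρ : Pp p d) :
    Integrable f ρ.1 := by
  have := ρ.2.1
  obtain ⟨hc, K, hK⟩ := hf
  refine ((integrable_growth hp ρ.2.2).const_mul K).mono' hc.aestronglyMeasurable ?_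
  exact ae_of_all _ fun y => hK y

theorem growthP_of_bounded {f : Rd d → ℝ} (hf : Continuous f) {M : ℝ} (hM : ∀ y, |f y| ≤ M) :
    GrowthP p f := by
  refine ⟨hf, M, fun y => (hM y).trans ?_⟩
  have h0 : 0 ≤ M := (abs_nonneg _).trans (hM y)
  have : 0 ≤ ‖y‖ ^ p := by positivity
  nlinarith

theorem continuous_integral_pp {f : Rd d → ℝ} (hf : GrowthP p f) :
    Continuous fun ρ : Pp p d => ∫ y, f y ∂ρ.1 :=
  continuous_iInf_dom (i := (⟨f, hf⟩ : {f : Rd d → ℝ // GrowthP p f})) continuous_induced_dom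

theorem le_nhds_pp_iff {F : Filter (Pp p d)} {ρ : Pp p d} :
    F ≤ 𝓝 ρ ↔ ∀ f : Rd d → ℝ, GrowthP p f →
      Tendsto (fun ρ' : Pp p d => ∫ y, f y ∂ρ'.1) F (𝓝 (∫ y, f y ∂ρ.1)) := by
  rw [PpTopology, nhds_iInf, le_iInf_iff]
  simp only [nhds_induced, ← tendsto_iff_comap, Subtype.forall]

/-- A continuous nonnegative weight dominating every multiple of `1 + ‖y‖ ^ p` at infinity. -/
structure IsWeight (p : ℝ) {d : ℕ} (w : Rd d → ℝ) : Prop where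
  cont : Continuous w
  nonneg : ∀ y, 0 ≤ w y
  growth : ∀ N : ℝ, ∃ R : ℝ, ∀ y, R ≤ ‖y‖ → N * (1 + ‖y‖ ^ p) ≤ w y

theorem lintegral_ofReal_eq_iSup {f : Rd d → ℝ} (hf : Continuous f) (h0 : ∀ y, 0 ≤ f y)
    (ρ : Measure (Rd d)) [IsFiniteMeasure ρ] :
    ∫⁻ y, ENNReal.ofReal (f y) ∂ρ
      = ⨆ m : ℕ, ENNReal.ofReal (∫ y, min (f y) m ∂ρ) := by
  have hint : ∀ m : ℕ, Integrable (fun y => min (f y) m) ρ := fun m =>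
    Integrable.of_bound (hf.min continuous_const).aestronglyMeasurable m
      (ae_of_all _ fun y => by
        rw [Real.norm_of_nonneg (le_min (h0 y) (Nat.cast_nonneg m))]; exact min_le_right _ _)
  have h1 : ∀ y, ENNReal.ofReal (f y) = ⨆ m : ℕ, ENNReal.ofReal (min (f y) m) := by
    intro y
    refine le_antisymm ?_ (iSup_le fun m => ENNReal.ofReal_le_ofReal (min_le_left _ _))
    obtain ⟨m, hm⟩ := exists_nat_ge (f y)
    exact le_iSup_of_le m (by rw [min_eq_left hm])
  simp_rw [h1]
  rw [lintegral_iSup (fun m => (hf.min continuous_const).measurable.ennreal_ofReal)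
    (fun m n hmn y => ENNReal.ofReal_le_ofReal (min_le_min_left _ (by exact_mod_cast hmn)))]
  refine iSup_congr fun m => ?_
  rw [ofReal_integral_eq_lintegral_ofReal (hint m)
    (ae_of_all _ fun y => le_min (h0 y) (Nat.cast_nonneg m))]

theorem lowerSemicontinuous_lintegral_pp {f : Rd d → ℝ} (hf : Continuous f)
    (h0 : ∀ y, 0 ≤ f y) :
    LowerSemicontinuous fun ρ : Pp p d => ∫⁻ y, ENNReal.ofReal (f y) ∂ρ.1 := by
  have h : (fun ρ : Pp p d => ∫⁻ y, ENNReal.ofReal (f y) ∂ρ.1)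
      = fun ρ : Pp p d => ⨆ m : ℕ, ENNReal.ofReal (∫ y, min (f y) m ∂ρ.1) := by
    ext ρ
    have := ρ.2.1
    exact lintegral_ofReal_eq_iSup hf h0 ρ.1
  rw [h]
  refine lowerSemicontinuous_iSup fun m => (ENNReal.continuous_ofReal.comp
    (continuous_integral_pp (growthP_of_bounded (M := m) (hf.min continuous_const)
      fun y => ?_))).lowerSemicontinuous
  rw [abs_of_nonneg (le_min (h0 y) (Nat.cast_nonneg m))]
  exact min_le_right _ _

theorem isTight_weight {w : Rd d → ℝ} (hw : IsWeight p w) {R : ℝ≥0∞} (hR : R ≠ ⊤) :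
    IsTightMeasureSet {((P : ProbabilityMeasure (Rd d)) : Measure (Rd d)) |
      P ∈ {P : ProbabilityMeasure (Rd d) | ∫⁻ y, ENNReal.ofReal (w y) ∂P ≤ R}} := by
  rw [isTightMeasureSet_iff_exists_isCompact_measure_compl_le]
  intro ε hε
  obtain ⟨N, hN⟩ : ∃ N : ℕ, R / ε ≤ N :=
    (ENNReal.exists_nat_gt (ENNReal.div_lt_top hR hε.ne').ne).imp fun _ h => h.le
  obtain ⟨r, hr⟩ := hw.growth (N + 1)
  refine ⟨Metric.closedBall 0 r, isCompact_closedBall 0 r, ?_⟩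
  rintro _ ⟨P, hP, rfl⟩
  have hpos : ((N : ℝ≥0∞) + 1) ≠ 0 := by positivity
  have htop : ((N : ℝ≥0∞) + 1) ≠ ⊤ := by simp
  have h1 : ((N : ℝ≥0∞) + 1) * (P : Measure (Rd d)) (Metric.closedBall 0 r)ᶜ ≤ R := by
    refine le_trans ?_ hP
    refine le_trans ?_ (mul_meas_ge_le_lintegral hw.cont.measurable.ennreal_ofReal
      ((N : ℝ≥0∞) + 1))
    gcongr
    intro y hy
    have hy' : r ≤ ‖y‖ := by
      have : ¬ ‖y‖ ≤ r := by simpa using hy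
      linarith
    have h2 : ((N : ℝ≥0∞) + 1) = ENNReal.ofReal (N + 1) := by
      rw [ENNReal.ofReal_add (by positivity) zero_le_one]; simp
    simp only [mem_ofPred_eq, h2]
    refine ENNReal.ofReal_le_ofReal (le_trans ?_ (hr y hy'))
    have : 0 ≤ ‖y‖ ^ p := by positivity
    have : (0 : ℝ) ≤ N := by positivity
    nlinarith
  have h3 : R ≤ (N + 1) * ε := by
    rw [← ENNReal.div_le_iff_le_mul (Or.inl hε.ne') (Or.inr hpos)]
    exact hN.trans le_self_add
  rw [← ENNReal.mul_le_mul_iff_right hpos htop]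
  exact h1.trans h3

/-- Integrals of `p`-growth functions are uniformly approximated by bounded truncations on
sublevel sets of a weight. -/
theorem exists_truncation (hp : 1 ≤ p) {w : Rd d → ℝ} (hw : IsWeight p w)
    {f : Rd d → ℝ} (hf : GrowthP p f) {R : ℝ≥0∞} (hR : R ≠ ⊤) {ε : ℝ} (hε : 0 < ε) :
    ∃ g : BoundedContinuousFunction (Rd d) ℝ, ∀ ρ : Pp p d,
      ∫⁻ y, ENNReal.ofReal (w y) ∂ρ.1 ≤ R → |∫ y, f y ∂ρ.1 - ∫ y, g y ∂ρ.1| ≤ ε := by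
  obtain ⟨hc, K, hK⟩ := hf
  have hK0 : 0 ≤ K := by
    have h := (abs_nonneg _).trans (hK 0)
    have h2 : (0 : ℝ) < 1 + ‖(0 : Rd d)‖ ^ p := by positivity
    exact nonneg_of_mul_nonneg_left h h2
  set R' := R.toReal with hR'
  have hR0 : 0 ≤ R' := ENNReal.toReal_nonneg
  obtain ⟨r, hr⟩ := hw.growth (K * (R' + 1) / ε)
  set M := K * (1 + |r| ^ p) with hM
  have hM0 : 0 ≤ M := by positivity
  set g : BoundedContinuousFunction (Rd d) ℝ :=
    BoundedContinuousFunction.ofNormedAddCommGroup (fun y => max (-M) (min M (f y)))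
      (by fun_prop) M (fun y => by
        rw [Real.norm_eq_abs, abs_le]
        exact ⟨le_max_left _ _, max_le (by linarith) (min_le_left _ _)⟩) with hg
  refine ⟨g, fun ρ hρ => ?_⟩
  have := ρ.2.1
  have hgi : Integrable g ρ.1 := g.integrable _
  have hfi : Integrable f ρ.1 := GrowthP.integrable hp ⟨hc, K, hK⟩ ρ
  have hwi : Integrable w ρ.1 := by
    refine ⟨hw.cont.aestronglyMeasurable, ?_⟩
    rw [hasFiniteIntegral_iff_norm]
    refine lt_of_le_of_lt ?_ (lt_top_iff_ne_top.2 hR)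
    refine le_trans (le_of_eq (lintegral_congr fun y => ?_)) hρ
    rw [Real.norm_of_nonneg (hw.nonneg y)]
  have hwR : ∫ y, w y ∂ρ.1 ≤ R' := by
    rw [integral_eq_lintegral_of_nonneg_ae (ae_of_all _ hw.nonneg)
      hw.cont.aestronglyMeasurable]
    exact ENNReal.toReal_mono hR hρ
  have hpt : ∀ y, |f y - g y| ≤ ε / (R' + 1) * w y := by
    intro y
    have hgy : g y = max (-M) (min M (f y)) := rfl
    rcases le_or_gt ‖y‖ r with hy | hy
    · have h1 : |f y| ≤ M := by
        refine (hK y).trans (mul_le_mul_of_nonneg_left ?_ hK0)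
        gcongr
        exact hy.trans (le_abs_self r)
      rw [hgy, min_eq_right (abs_le.1 h1).2, max_eq_right (abs_le.1 h1).1, sub_self, abs_zero]
      have := hw.nonneg y
      positivity
    · have h1 : |f y - g y| ≤ |f y| := by
        rw [hgy]
        rcases abs_cases (f y) with ⟨h, h'⟩ | ⟨h, h'⟩
        · rw [max_eq_right (le_min (by linarith) (by linarith)), h, abs_le]
          constructor
          · linarith [min_le_right M (f y)]
          · linarith [le_min hM0 h']
        · rw [min_eq_right (by linarith), h, abs_le]
          constructor
          · linarith [max_le (show -M ≤ 0 by linarith) h'.le]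
          · linarith [le_max_right (-M) (f y)]
      refine h1.trans ((hK y).trans ?_)
      have h2 := hr y hy.le
      have h3 : K * (1 + ‖y‖ ^ p) = ε / (R' + 1) * (K * (R' + 1) / ε * (1 + ‖y‖ ^ p)) := by
        field_simp
      rw [h3]
      gcongr
  rw [← integral_sub hfi hgi]
  calc |∫ y, (f y - g y) ∂ρ.1| ≤ ∫ y, |f y - g y| ∂ρ.1 := abs_integral_le_integral_abs
    _ ≤ ∫ y, ε / (R' + 1) * w y ∂ρ.1 :=
        integral_mono (hfi.sub hgi).abs (hwi.const_mul _) hpt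
    _ = ε / (R' + 1) * ∫ y, w y ∂ρ.1 := integral_const_mul _ _
    _ ≤ ε / (R' + 1) * (R' + 1) := by gcongr; linarith
    _ = ε := by field_simp

theorem isCompact_weight_sublevel (hp : 1 ≤ p) {w : Rd d → ℝ} (hw : IsWeight p w)
    {R : ℝ≥0∞} (hR : R ≠ ⊤) :
    IsCompact {ρ : Pp p d | ∫⁻ y, ENNReal.ofReal (w y) ∂ρ.1 ≤ R} := by
  rw [isCompact_iff_ultrafilter_le_nhds]
  intro F hF
  rw [le_principal_iff] at hF
  let i : Pp p d → ProbabilityMeasure (Rd d) := fun ρ => ⟨ρ.1, ρ.2.1⟩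
  have hcomp := isCompact_closure_of_isTightMeasureSet (isTight_weight hw hR)
  rw [isCompact_iff_ultrafilter_le_nhds] at hcomp
  obtain ⟨P, -, hP⟩ := hcomp (F.map i) (by
    rw [le_principal_iff]
    exact mem_of_superset hF fun ρ hρ => subset_closure hρ)
  have hP' : Tendsto i F (𝓝 P) := hP
  rw [ProbabilityMeasure.tendsto_iff_forall_integral_tendsto] at hP'
  have hPR : ∫⁻ y, ENNReal.ofReal (w y) ∂(P : Measure (Rd d)) ≤ R := by
    rw [lintegral_ofReal_eq_iSup hw.cont hw.nonneg]
    refine iSup_le fun m => ?_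
    let g : BoundedContinuousFunction (Rd d) ℝ :=
      BoundedContinuousFunction.ofNormedAddCommGroup (fun y => min (w y) m)
        (hw.cont.min continuous_const) m (fun y => by
          rw [Real.norm_of_nonneg (le_min (hw.nonneg y) (Nat.cast_nonneg m))]
          exact min_le_right _ _)
    refine le_of_tendsto ((ENNReal.continuous_ofReal.tendsto _).comp (hP' g)) ?_
    filter_upwards [hF] with ρ hρ
    have := ρ.2.1
    have h1 := lintegral_ofReal_eq_iSup hw.cont hw.nonneg ρ.1
    exact (le_iSup (fun m : ℕ => ENNReal.ofReal (∫ y, min (w y) m ∂ρ.1)) m).trans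
      (h1.symm.le.trans hρ)
  have hmom : HasMomentP p (P : Measure (Rd d)) := by
    obtain ⟨r, hr⟩ := hw.growth 1
    refine ne_top_of_le_ne_top (b := ENNReal.ofReal (|r| ^ p) + R) (by finiteness) ?_
    calc ∫⁻ y, ENNReal.ofReal (‖y‖ ^ p) ∂(P : Measure (Rd d))
        ≤ ∫⁻ y, (ENNReal.ofReal (|r| ^ p) + ENNReal.ofReal (w y)) ∂(P : Measure (Rd d)) := by
          refine lintegral_mono fun y => ?_
          rcases le_or_gt r ‖y‖ with h | h
          · refine le_add_left (ENNReal.ofReal_le_ofReal ?_)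
            linarith [hr y h]
          · refine le_add_right (ENNReal.ofReal_le_ofReal ?_)
            exact Real.rpow_le_rpow (norm_nonneg _) (h.le.trans (le_abs_self r)) (by linarith)
      _ ≤ ENNReal.ofReal (|r| ^ p) + R := by
          rw [lintegral_add_left measurable_const]
          simp only [lintegral_const, measure_univ, mul_one]
          gcongr
  refine ⟨⟨P, inferInstance, hmom⟩, hPR, ?_⟩
  rw [le_nhds_pp_iff]
  intro f hf
  rw [Metric.tendsto_nhds]
  intro ε hε
  obtain ⟨g, hg⟩ := exists_truncation hp hw hf hR (show 0 < ε / 3 by positivity)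
  filter_upwards [hF, Metric.tendsto_nhds.1 (hP' g) (ε / 3) (by positivity)] with ρ hρ h2
  have h1 := hg ρ hρ
  have h3 := hg ⟨P, inferInstance, hmom⟩ hPR
  rw [Real.dist_eq] at h2 ⊢
  simp only [i, ProbabilityMeasure.coe_mk] at h2
  have e1 := abs_le.1 h1
  have e2 := abs_lt.1 h2
  have e3 := abs_le.1 h3
  rw [abs_lt]
  simp only at e3
  constructor <;> linarith [e1.1, e1.2, e2.1, e2.2, e3.1, e3.2]

end Compactness

theorem lowerSemicontinuous_iInf_compact {X Z β : Type*} [TopologicalSpace X]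
    [TopologicalSpace Z] [CompleteLinearOrder β] [DenselyOrdered β] {H : X × Z → β}
    (hH : LowerSemicontinuous H) {K : Set Z} (hK : IsCompact K) :
    LowerSemicontinuous fun x => ⨅ z ∈ K, H (x, z) := by
  intro x₀ c hc
  obtain ⟨c', h1, h2⟩ := exists_between hc
  have h := hK.eventually_forall_of_forall_eventually (x₀ := x₀) (P := fun x z => c' < H (x, z))
    fun z hz => hH (x₀, z) c' (h2.trans_le (iInf₂_le z hz))
  filter_upwards [h] with x hx
  exact h1.trans_le (le_iInf₂ fun z hz => (hx z hz).le)

section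

variable {d : ℕ} {p : ℝ}

theorem isCompact_supported (hp : 1 ≤ p) {w : Rd d → ℝ} (hw : IsWeight p w)
    {K : Set (Rd d)} (hK : IsCompact K) : IsCompact {ρ : Pp p d | ρ.1 Kᶜ = 0} := by
  rcases K.eq_empty_or_nonempty with rfl | hne
  · convert isCompact_empty
    ext ρ
    have := ρ.2.1
    simp [IsProbabilityMeasure.ne_zero]
  obtain ⟨M, hM⟩ := hK.bddAbove_image hw.cont.continuousOn
  refine (isCompact_weight_sublevel hp hw (R := ENNReal.ofReal M)
    ENNReal.ofReal_ne_top).of_isClosed_subset ?_ ?_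
  · have h : {ρ : Pp p d | ρ.1 Kᶜ = 0}
        = {ρ : Pp p d | ∫ y, min (Metric.infDist y K) 1 ∂ρ.1 = 0} := by
      ext ρ
      have := ρ.2.1
      have h0 : ∀ y, 0 ≤ min (Metric.infDist y K) 1 := fun y =>
        le_min Metric.infDist_nonneg zero_le_one
      have hi : Integrable (fun y => min (Metric.infDist y K) 1) ρ.1 :=
        Integrable.of_bound (by fun_prop) 1 (ae_of_all _ fun y => by
          rw [Real.norm_of_nonneg (h0 y)]; exact min_le_right _ _)
      rw [mem_ofPred_eq, mem_ofPred_eq, integral_eq_zero_iff_of_nonneg h0 hi, Filter.EventuallyEq,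
        ae_iff]
      congr! 2
      ext y
      simp only [mem_compl_iff, Pi.zero_apply, mem_ofPred_eq]
      rw [hK.isClosed.mem_iff_infDist_zero hne]
      rcases (Metric.infDist_nonneg (x := y) (s := K)).eq_or_lt with h | h
      · simp [← h]
      · have : 0 < min (Metric.infDist y K) 1 := lt_min h one_pos
        exact ⟨fun _ => this.ne', fun _ => h.ne'⟩
    rw [h]
    refine isClosed_eq (continuous_integral_pp (growthP_of_bounded (M := 1) (by fun_prop)
      fun y => ?_)) continuous_const
    rw [abs_of_nonneg (le_min Metric.infDist_nonneg zero_le_one)]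
    exact min_le_right _ _
  · intro ρ hρ
    have := ρ.2.1
    have hae : ∀ᵐ y ∂ρ.1, y ∈ K := by rw [ae_iff]; exact hρ
    calc ∫⁻ y, ENNReal.ofReal (w y) ∂ρ.1 ≤ ∫⁻ _, ENNReal.ofReal M ∂ρ.1 :=
          lintegral_mono_ae (hae.mono fun y hy =>
            ENNReal.ofReal_le_ofReal (hM (mem_image_of_mem _ hy)))
      _ = ENNReal.ofReal M := by simp

/-- The cost penalised by a weight. -/
noncomputable def weightedCost {X : Type*} (C : X → Measure (Rd d) → ℝ≥0∞) (w : Rd d → ℝ) (x : X)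
    (ρ : Measure (Rd d)) : ℝ≥0∞ :=
  C x ρ + ∫⁻ y, ENNReal.ofReal (w y) ∂ρ

theorem lowerSemicontinuous_weightedCost {X : Type*} [TopologicalSpace X]
    {C : X → Measure (Rd d) → ℝ≥0∞}
    (hlsc : LowerSemicontinuous fun q : X × Pp p d => C q.1 q.2.1) {w : Rd d → ℝ}
    (hw : IsWeight p w) :
    LowerSemicontinuous fun q : X × Pp p d => weightedCost C w q.1 q.2.1 :=
  hlsc.add ((lowerSemicontinuous_lintegral_pp hw.cont hw.nonneg).comp continuous_snd)

theorem weightedCost_convex {X : Type*} {C : X → Measure (Rd d) → ℝ≥0∞} {w : Rd d → ℝ}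
    (hconv : ∀ x : X, ∀ ρ₁ ρ₂ : Pp p d, ∀ t : ℝ≥0∞, t ≤ 1 →
      C x (t • ρ₁.1 + (1 - t) • ρ₂.1) ≤ t * C x ρ₁.1 + (1 - t) * C x ρ₂.1)
    (x : X) (ρ₁ ρ₂ : Pp p d) (t : ℝ≥0∞) (ht : t ≤ 1) :
    weightedCost C w x (t • ρ₁.1 + (1 - t) • ρ₂.1)
      ≤ t * weightedCost C w x ρ₁.1 + (1 - t) * weightedCost C w x ρ₂.1 := by
  unfold weightedCost
  rw [lintegral_add_measure, lintegral_smul_measure, lintegral_smul_measure]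
  refine (add_le_add_left (hconv x ρ₁ ρ₂ t ht) _).trans (le_of_eq ?_)
  simp only [smul_eq_mul, mul_add]
  ring

end

section DualRepresentation

variable {d : ℕ} {p : ℝ}

/-- A countable family of continuous functions bounded by `1` separates finite measures. -/
theorem exists_separating_seq (d : ℕ) :
    ∃ e : ℕ → Rd d → ℝ, (∀ k, Continuous (e k)) ∧ (∀ k y, |e k y| ≤ 1) ∧
      ∀ ρ₁ ρ₂ : Measure (Rd d), IsFiniteMeasure ρ₁ → IsFiniteMeasure ρ₂ →
        (∀ k, ∫ y, e k y ∂ρ₁ = ∫ y, e k y ∂ρ₂) → ρ₁ = ρ₂ := by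
  obtain ⟨s, hs⟩ := exists_surjective_nat (ℕ × Bool)
  let v : ℕ → Rd d := TopologicalSpace.denseSeq (Rd d)
  let e' : ℕ × Bool → Rd d → ℝ := fun k y =>
    bif k.2 then Real.cos (inner ℝ y (v k.1)) else Real.sin (inner ℝ y (v k.1))
  have hcont : ∀ k, Continuous (e' k) := by
    rintro ⟨k, _ | _⟩ <;> simp only [e', cond_true, cond_false] <;> fun_prop
  have hle : ∀ k y, |e' k y| ≤ 1 := by
    rintro ⟨k, _ | _⟩ y
    · exact Real.abs_sin_le_one _
    · exact Real.abs_cos_le_one _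
  refine ⟨fun n => e' (s n), fun n => hcont _, fun n y => hle _ _, fun ρ₁ ρ₂ h₁ h₂ h => ?_⟩
  · have h' : ∀ k, ∫ y, e' k y ∂ρ₁ = ∫ y, e' k y ∂ρ₂ := fun k => by
      obtain ⟨n, rfl⟩ := hs k; exact h n
    refine Measure.ext_of_charFun ?_
    refine DenseRange.equalizer (f := v) (TopologicalSpace.denseRange_denseSeq _)
      continuous_charFun continuous_charFun ?_
    ext k
    have key : ∀ ρ : Measure (Rd d), IsFiniteMeasure ρ → charFun ρ (v k)
        = ((∫ y, e' (k, true) y ∂ρ : ℝ) : ℂ) + ((∫ y, e' (k, false) y ∂ρ : ℝ) : ℂ) * Complex.I := by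
      intro ρ hρ
      have hi : Integrable (fun y : Rd d => Complex.exp ((inner ℝ y (v k) : ℝ) * Complex.I)) ρ :=
        Integrable.of_bound (by fun_prop) 1 (ae_of_all _ fun y => by
          rw [Complex.norm_exp_ofReal_mul_I])
      rw [charFun_apply, ← integral_re_add_im hi]
      simp [e', Complex.exp_ofReal_mul_I_re, Complex.exp_ofReal_mul_I_im]
    simp only [Function.comp]
    rw [key ρ₁ h₁, key ρ₂ h₂, h' (k, true), h' (k, false)]

/-- Convex combination of two elements of `P_p`. -/
noncomputable def ppMix (ρ₁ ρ₂ : Pp p d) (a b : ℝ) (ha : 0 ≤ a) (hb : 0 ≤ b) (hab : a + b = 1) :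
    Pp p d :=
  ⟨ENNReal.ofReal a • ρ₁.1 + ENNReal.ofReal b • ρ₂.1, by
    have := ρ₁.2.1
    have := ρ₂.2.1
    refine ⟨⟨?_⟩, ?_⟩
    · simp [← ENNReal.ofReal_add ha hb, hab]
    · have h1 := ρ₁.2.2
      have h2 := ρ₂.2.2
      unfold HasMomentP at *
      rw [lintegral_add_measure, lintegral_smul_measure, lintegral_smul_measure]
      exact ENNReal.add_ne_top.2 ⟨ENNReal.mul_ne_top (by simp) h1, ENNReal.mul_ne_top (by simp) h2⟩⟩

theorem integral_ppMix (ρ₁ ρ₂ : Pp p d) {a b : ℝ} (ha : 0 ≤ a) (hb : 0 ≤ b) (hab : a + b = 1)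
    {f : Rd d → ℝ} (h1 : Integrable f ρ₁.1) (h2 : Integrable f ρ₂.1) :
    ∫ y, f y ∂(ppMix ρ₁ ρ₂ a b ha hb hab).1 = a * ∫ y, f y ∂ρ₁.1 + b * ∫ y, f y ∂ρ₂.1 := by
  simp only [ppMix]
  rw [integral_add_measure (h1.smul_measure (by simp)) (h2.smul_measure (by simp)),
    integral_smul_measure, integral_smul_measure]
  simp [ENNReal.toReal_ofReal, ha, hb]

theorem isClosed_epigraph_image {n : ℕ} {c : Pp p d → ℝ≥0∞} (hc : LowerSemicontinuous c)
    (hcomp : ∀ R : ℝ, IsCompact {ρ | c ρ ≤ ENNReal.ofReal R}) (T : Pp p d → Fin n → ℝ)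
    (hT : Continuous T) :
    IsClosed {q : (Fin n → ℝ) × ℝ | 0 ≤ q.2 ∧ ∃ ρ, c ρ ≤ ENNReal.ofReal q.2 ∧ q.1 = T ρ} := by
  rw [isClosed_iff_ultrafilter]
  intro x u hu hA
  have h0 : ∀ᶠ q : (Fin n → ℝ) × ℝ in u, 0 ≤ q.2 := mem_of_superset hA fun q hq => hq.1
  have hsnd : Tendsto (fun q : (Fin n → ℝ) × ℝ => q.2) u (𝓝 x.2) :=
    (continuous_snd.tendsto x).mono_left hu
  have hfst : Tendsto (fun q : (Fin n → ℝ) × ℝ => q.1) u (𝓝 x.1) :=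
    (continuous_fst.tendsto x).mono_left hu
  have hne : Nonempty (Pp p d) := by
    obtain ⟨q, -, ρ, -⟩ := u.nonempty_of_mem hA
    exact ⟨ρ⟩
  have hex : ∀ q : (Fin n → ℝ) × ℝ, ∃ ρ : Pp p d,
      (0 ≤ q.2 ∧ ∃ ρ, c ρ ≤ ENNReal.ofReal q.2 ∧ q.1 = T ρ) →
        c ρ ≤ ENNReal.ofReal q.2 ∧ q.1 = T ρ := fun q => by
    by_cases h : 0 ≤ q.2 ∧ ∃ ρ, c ρ ≤ ENNReal.ofReal q.2 ∧ q.1 = T ρ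
    · obtain ⟨ρ, hρ⟩ := h.2
      exact ⟨ρ, fun _ => hρ⟩
    · exact ⟨hne.some, fun h' => absurd h' h⟩
  choose r hr using hex
  have hr' : ∀ᶠ q in u, c (r q) ≤ ENNReal.ofReal q.2 ∧ q.1 = T (r q) :=
    mem_of_superset hA fun q hq => hr q hq
  have hmem : ∀ᶠ q in u, c (r q) ≤ ENNReal.ofReal (x.2 + 1) := by
    filter_upwards [hr', hsnd.eventually_le_const (show x.2 < x.2 + 1 by linarith)] with q h1 h2
    exact h1.1.trans (ENNReal.ofReal_le_ofReal h2)
  obtain ⟨ρ, -, hρ⟩ := isCompact_iff_ultrafilter_le_nhds.1 (hcomp (x.2 + 1)) (u.map r)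
    (le_principal_iff.2 (mem_map.2 hmem))
  have hρ' : Tendsto r u (𝓝 ρ) := hρ
  refine ⟨ge_of_tendsto hsnd h0, ρ, ?_, ?_⟩
  · by_contra hcon
    obtain ⟨c', h1, h2⟩ := exists_between (not_le.1 hcon)
    have e1 : ∀ᶠ q in u, c' < c (r q) := hρ'.eventually (hc ρ c' h2)
    have e2 : ∀ᶠ q : (Fin n → ℝ) × ℝ in u, ENNReal.ofReal q.2 < c' :=
      ((ENNReal.continuous_ofReal.tendsto _).comp hsnd).eventually_lt_const h1
    obtain ⟨q, h3, h4, h5⟩ := (e1.and (e2.and hr')).exists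
    exact absurd (h3.trans_le h5.1) (not_lt.2 h4.le)
  · refine tendsto_nhds_unique hfst (((hT.tendsto ρ).comp hρ').congr' ?_)
    filter_upwards [hr'] with q hq
    exact hq.2.symm

/-- Convex functionals on `P_p` with compact sublevel sets are suprema of affine functionals taken
from a countable family. -/
theorem exists_affine_minorant {c : Pp p d → ℝ≥0∞} (hc : LowerSemicontinuous c)
    (hcomp : ∀ R : ℝ, IsCompact {ρ | c ρ ≤ ENNReal.ofReal R})
    (hconv : ∀ ρ₁ ρ₂ : Pp p d, ∀ a b (ha : 0 ≤ a) (hb : 0 ≤ b) (hab : a + b = 1),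
      c (ppMix ρ₁ ρ₂ a b ha hb hab) ≤ ENNReal.ofReal a * c ρ₁ + ENNReal.ofReal b * c ρ₂)
    {e : ℕ → Rd d → ℝ} (he : ∀ k, Continuous (e k)) (he1 : ∀ k y, |e k y| ≤ 1)
    (hsep : ∀ ρ₁ ρ₂ : Measure (Rd d), IsFiniteMeasure ρ₁ → IsFiniteMeasure ρ₂ →
        (∀ k, ∫ y, e k y ∂ρ₁ = ∫ y, e k y ∂ρ₂) → ρ₁ = ρ₂)
    (ρ₀ : Pp p d) {r : ℝ} (hr0 : 0 ≤ r) (hr : ENNReal.ofReal r < c ρ₀) :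
    ∃ n : ℕ, ∃ q : Fin n → ℚ, ∀ ρ : Pp p d,
      ENNReal.ofReal (r + ∑ i, (q i : ℝ) * (∫ y, e i y ∂ρ₀.1 - ∫ y, e i y ∂ρ.1)) ≤ c ρ := by
  have hei : ∀ k (ρ : Pp p d), Integrable (e k) ρ.1 := fun k ρ => by
    have := ρ.2.1
    exact Integrable.of_bound (he k).aestronglyMeasurable 1 (ae_of_all _ (he1 k))
  have hec : ∀ k, Continuous fun ρ : Pp p d => ∫ y, e k y ∂ρ.1 := fun k =>
    continuous_integral_pp (growthP_of_bounded (he k) (he1 k))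
  have heb : ∀ k (ρ : Pp p d), |∫ y, e k y ∂ρ.1| ≤ 1 := fun k ρ => by
    have := ρ.2.1
    simpa using norm_integral_le_of_norm_le_const (μ := ρ.1) (f := e k) (C := 1) (ae_of_all _ (he1 k))
  obtain ⟨r', hrr', hr'⟩ : ∃ r' : ℝ, r < r' ∧ ENNReal.ofReal r' < c ρ₀ := by
    obtain ⟨z, h1, h2⟩ := exists_between hr
    have hz : z ≠ ⊤ := h2.ne_top
    refine ⟨z.toReal, ?_, by rwa [ENNReal.ofReal_toReal hz]⟩
    rw [← ENNReal.toReal_ofReal hr0]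
    exact ENNReal.toReal_strict_mono hz h1
  -- finitely many test functions separate `ρ₀` from the sublevel set
  obtain ⟨n, hn⟩ : ∃ n : ℕ, ∀ ρ, c ρ ≤ ENNReal.ofReal r' →
      ¬ ∀ i : Fin n, ∫ y, e i y ∂ρ.1 = ∫ y, e i y ∂ρ₀.1 := by
    obtain ⟨u, hu⟩ := (hcomp r').elim_finite_subfamily_closed
      (fun k : ℕ => {ρ : Pp p d | ∫ y, e k y ∂ρ.1 = ∫ y, e k y ∂ρ₀.1})
      (fun k => isClosed_eq (hec k) continuous_const) (by
        rw [eq_empty_iff_forall_notMem]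
        rintro ρ ⟨h1, h2⟩
        rw [mem_iInter] at h2
        have : ρ = ρ₀ := Subtype.ext (hsep _ _ (by have := ρ.2.1; infer_instance)
          (by have := ρ₀.2.1; infer_instance) h2)
        rw [this] at h1
        exact absurd hr' (not_lt.2 h1))
    obtain ⟨n, hn⟩ := u.exists_nat_subset_range
    refine ⟨n, fun ρ hρ h => ?_⟩
    rw [eq_empty_iff_forall_notMem] at hu
    refine hu ρ ⟨hρ, mem_iInter₂.2 fun k hk => ?_⟩
    exact h ⟨k, Finset.mem_range.1 (hn hk)⟩
  set T : Pp p d → Fin n → ℝ := fun ρ i => ∫ y, e i y ∂ρ.1 with hTdef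
  have hT : Continuous T := continuous_pi fun i => hec i
  set A := {q : (Fin n → ℝ) × ℝ | 0 ≤ q.2 ∧ ∃ ρ, c ρ ≤ ENNReal.ofReal q.2 ∧ q.1 = T ρ} with hA
  have hAclosed : IsClosed A := isClosed_epigraph_image hc hcomp T hT
  have hAconv : Convex ℝ A := by
    rintro ⟨u₁, s₁⟩ ⟨h1, ρ₁, h2, h3⟩ ⟨u₂, s₂⟩ ⟨h4, ρ₂, h5, h6⟩ a b ha hb hab
    simp only at h1 h2 h3 h4 h5 h6
    refine ⟨by simp only [Prod.smul_mk, Prod.mk_add_mk, smul_eq_mul]; positivity,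
      ppMix ρ₁ ρ₂ a b ha hb hab, ?_, ?_⟩
    · refine (hconv ρ₁ ρ₂ a b ha hb hab).trans ?_
      simp only [Prod.smul_mk, Prod.mk_add_mk, smul_eq_mul]
      rw [ENNReal.ofReal_add (by positivity) (by positivity), ENNReal.ofReal_mul ha,
        ENNReal.ofReal_mul hb]
      gcongr
    · ext i
      simp only [hTdef, integral_ppMix ρ₁ ρ₂ ha hb hab (hei i ρ₁) (hei i ρ₂), h3, h6]
      simp
  have hnot : (T ρ₀, r') ∉ A := by
    rintro ⟨-, ρ, h1, h2⟩
    exact hn ρ h1 fun i => (congrFun h2 i).symm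
  obtain ⟨l, z, hl1, hl2⟩ := geometric_hahn_banach_point_closed hAconv hAclosed hnot
  set β := l (0, 1) with hβ
  set α : Fin n → ℝ := fun i => l (Pi.single i 1, 0) with hα
  have hl : ∀ u s, l (u, s) = ∑ i, u i * α i + s * β := by
    intro u s
    have h1 : ((u, s) : (Fin n → ℝ) × ℝ)
        = ∑ i, u i • ((Pi.single i 1, 0) : (Fin n → ℝ) × ℝ) + s • (0, 1) := by
      refine Prod.ext ?_ ?_
      · ext j
        simp [Prod.fst_sum, Finset.sum_apply, Pi.single_apply]
      · simp [Prod.snd_sum]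
    rw [h1, map_add, map_sum]
    simp only [map_smul, smul_eq_mul, α, β]
  by_cases hfin : ∀ ρ, c ρ = ⊤
  · exact ⟨0, Fin.elim0, fun ρ => by rw [hfin ρ]; exact le_top⟩
  push Not at hfin
  have hbase : ∀ ρ, c ρ ≠ ⊤ → ∀ s, (c ρ).toReal ≤ s → z < ∑ i, T ρ i * α i + s * β := by
    intro ρ hρ s hs
    rw [← hl]
    refine hl2 _ ⟨ENNReal.toReal_nonneg.trans hs, ρ, ?_, rfl⟩
    exact ENNReal.le_ofReal_iff_toReal_le hρ (ENNReal.toReal_nonneg.trans hs) |>.2 hs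
  have hβ0 : 0 ≤ β := by
    by_contra hneg
    push Not at hneg
    obtain ⟨ρ, hρ⟩ := hfin
    set S := ∑ i, T ρ i * α i
    have h1 := hbase ρ hρ (max (c ρ).toReal ((z - S) / β)) (le_max_left _ _)
    have h2 : max (c ρ).toReal ((z - S) / β) * β ≤ (z - S) / β * β :=
      mul_le_mul_of_nonpos_right (le_max_right _ _) hneg.le
    rw [div_mul_cancel₀ _ hneg.ne] at h2
    linarith
  rw [hl] at hl1
  set δ := z - (∑ i, T ρ₀ i * α i + r' * β) with hδ
  have hδ0 : 0 < δ := by linarith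
  have hr'0 : 0 < r' := hr0.trans_lt hrr'
  set β' := β + δ / r' with hβ'
  have hβ'0 : 0 < β' := by positivity
  have hmain : ∀ ρ, c ρ ≠ ⊤ → r' + ∑ i, (α i / β') * (T ρ₀ i - T ρ i) ≤ (c ρ).toReal := by
    intro ρ hρ
    have h1 := hbase ρ hρ _ le_rfl
    have h2 : ∑ i, (α i / β') * (T ρ₀ i - T ρ i)
        = (∑ i, T ρ₀ i * α i - ∑ i, T ρ i * α i) / β' := by
      rw [← Finset.sum_sub_distrib, Finset.sum_div]
      exact Finset.sum_congr rfl fun i _ => by ring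
    rw [h2, ← sub_nonneg]
    have h3 : (c ρ).toReal - (r' + (∑ i, T ρ₀ i * α i - ∑ i, T ρ i * α i) / β')
        = ((c ρ).toReal * β' - r' * β' - (∑ i, T ρ₀ i * α i - ∑ i, T ρ i * α i)) / β' := by
      field_simp; ring
    rw [h3]
    refine div_nonneg ?_ hβ'0.le
    have h4 : r' * β' = r' * β + δ := by rw [hβ']; field_simp
    have h5 : (c ρ).toReal * β ≤ (c ρ).toReal * β' :=
      mul_le_mul_of_nonneg_left (by rw [hβ']; linarith [show 0 < δ / r' by positivity])
        ENNReal.toReal_nonneg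
    rw [h4]
    linarith
  set η := (r' - r) / (2 * (n + 1)) with hη
  have hη0 : 0 < η := div_pos (by linarith) (by positivity)
  have hq : ∀ i, ∃ q : ℚ, |(q : ℝ) - α i / β'| ≤ η := fun i => by
    obtain ⟨q, h1, h2⟩ := exists_rat_btwn (show α i / β' < α i / β' + η by linarith)
    exact ⟨q, by rw [abs_le]; constructor <;> linarith⟩
  choose q hq using hq
  refine ⟨n, q, fun ρ => ?_⟩
  by_cases hρ : c ρ = ⊤
  · rw [hρ]; exact le_top
  refine ENNReal.ofReal_le_of_le_toReal ((hmain ρ hρ).trans' ?_)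
  have h1 : ∑ i, ((q i : ℝ) - α i / β') * (T ρ₀ i - T ρ i) ≤ ∑ _i : Fin n, η * 2 := by
    refine Finset.sum_le_sum fun i _ => (le_abs_self _).trans ?_
    rw [abs_mul]
    refine mul_le_mul (hq i) ?_ (abs_nonneg _) hη0.le
    have h2 := abs_le.1 (heb i ρ₀)
    have h3 := abs_le.1 (heb i ρ)
    rw [abs_le]
    constructor <;> simp only [T] <;> linarith [h2.1, h2.2, h3.1, h3.2]
  have h2 : ∑ _i : Fin n, η * 2 ≤ r' - r := by
    rw [Finset.sum_const, Finset.card_univ, Fintype.card_fin, nsmul_eq_mul, hη]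
    have : (n : ℝ) * ((r' - r) / (2 * (n + 1)) * 2) = (r' - r) * (n / (n + 1)) := by field_simp
    rw [this]
    exact mul_le_of_le_one_right (by linarith) ((div_le_one (by positivity)).2 (by linarith))
  simp_rw [sub_mul] at h1
  rw [Finset.sum_sub_distrib] at h1
  linarith

end DualRepresentation

section DualFamily

variable {d : ℕ} {p : ℝ} {X : Type*} {C : X → Measure (Rd d) → ℝ≥0∞} {w : Rd d → ℝ}

theorem weightedCost_ppMix
    (hconv : ∀ x : X, ∀ ρ₁ ρ₂ : Pp p d, ∀ t : ℝ≥0∞, t ≤ 1 →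
      C x (t • ρ₁.1 + (1 - t) • ρ₂.1) ≤ t * C x ρ₁.1 + (1 - t) * C x ρ₂.1)
    (x : X) (ρ₁ ρ₂ : Pp p d) (a b : ℝ) (ha : 0 ≤ a) (hb : 0 ≤ b) (hab : a + b = 1) :
    weightedCost C w x (ppMix ρ₁ ρ₂ a b ha hb hab).1
      ≤ ENNReal.ofReal a * weightedCost C w x ρ₁.1
        + ENNReal.ofReal b * weightedCost C w x ρ₂.1 := by
  have h1 : ENNReal.ofReal b = 1 - ENNReal.ofReal a := by
    rw [← ENNReal.ofReal_one, ← ENNReal.ofReal_sub _ ha, ← hab, add_sub_cancel_left]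
  have h2 := weightedCost_convex (w := w) hconv x ρ₁ ρ₂ (ENNReal.ofReal a)
    (by rw [← ENNReal.ofReal_one]; exact ENNReal.ofReal_le_ofReal (by linarith))
  rw [← h1] at h2
  exact h2

variable [TopologicalSpace X]

theorem lowerSemicontinuous_weightedCost_right
    (hlsc : LowerSemicontinuous fun q : X × Pp p d => C q.1 q.2.1) (hw : IsWeight p w) (x : X) :
    LowerSemicontinuous fun ρ : Pp p d => weightedCost C w x ρ.1 :=
  (lowerSemicontinuous_weightedCost hlsc hw).comp (by fun_prop : Continuous fun ρ => (x, ρ))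

theorem isCompact_weightedCost_sublevel (hp : 1 ≤ p)
    (hlsc : LowerSemicontinuous fun q : X × Pp p d => C q.1 q.2.1) (hw : IsWeight p w) (x : X)
    (R : ℝ) : IsCompact {ρ : Pp p d | weightedCost C w x ρ.1 ≤ ENNReal.ofReal R} := by
  refine (isCompact_weight_sublevel hp hw (R := ENNReal.ofReal R)
    ENNReal.ofReal_ne_top).of_isClosed_subset
    ((lowerSemicontinuous_weightedCost_right hlsc hw x).isClosed_preimage _) fun ρ hρ => ?_
  exact le_trans (le_add_self : _ ≤ weightedCost C w x ρ.1) hρ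

variable [MeasurableSpace X] [BorelSpace X]

/-- The weighted cost is the supremum of countably many affine functionals whose intercepts are
bounded and measurable. -/
theorem exists_dual_family (hp : 1 ≤ p)
    (hlsc : LowerSemicontinuous fun q : X × Pp p d => C q.1 q.2.1)
    (hconv : ∀ x : X, ∀ ρ₁ ρ₂ : Pp p d, ∀ t : ℝ≥0∞, t ≤ 1 →
      C x (t • ρ₁.1 + (1 - t) • ρ₂.1) ≤ t * C x ρ₁.1 + (1 - t) * C x ρ₂.1)
    (hw : IsWeight p w) :
    ∃ (φ : ℕ → X → ℝ) (ψ : ℕ → Rd d → ℝ), (∀ n, Measurable (φ n)) ∧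
      (∀ n, ∃ M, ∀ x, |φ n x| ≤ M) ∧ (∀ n, Continuous (ψ n)) ∧ (∀ n, ∃ M, ∀ y, |ψ n y| ≤ M) ∧
      (∀ n x (ρ : Pp p d),
        ENNReal.ofReal (φ n x - ∫ y, ψ n y ∂ρ.1) ≤ weightedCost C w x ρ.1) ∧
      ∀ x (ρ : Pp p d),
        weightedCost C w x ρ.1 ≤ ⨆ n, ENNReal.ofReal (φ n x - ∫ y, ψ n y ∂ρ.1) := by
  obtain ⟨e, he, he1, hsep⟩ := exists_separating_seq d
  obtain ⟨s, hs⟩ := exists_surjective_nat ((Σ n : ℕ, (Fin n → ℚ)) × ℕ)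
  let g : (Σ n : ℕ, (Fin n → ℚ)) → Rd d → ℝ := fun j y => ∑ i, (j.2 i : ℝ) * e i y
  let M : (Σ n : ℕ, (Fin n → ℚ)) → ℝ := fun j => ∑ i, |(j.2 i : ℝ)|
  have hgc : ∀ j, Continuous (g j) := fun j =>
    continuous_finsetSum _ fun i _ => continuous_const.mul (he i)
  have hgM : ∀ j y, |g j y| ≤ M j := fun j y =>
    (Finset.abs_sum_le_sum_abs _ _).trans (Finset.sum_le_sum fun i _ => by
      rw [abs_mul]; exact mul_le_of_le_one_right (abs_nonneg _) (he1 _ _))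
  have hei : ∀ k (ρ : Pp p d), Integrable (e k) ρ.1 := fun k ρ => by
    have := ρ.2.1
    exact Integrable.of_bound (he k).aestronglyMeasurable 1 (ae_of_all _ (he1 k))
  have hgint : ∀ j (ρ : Pp p d), |∫ y, g j y ∂ρ.1| ≤ M j := fun j ρ => by
    have := ρ.2.1
    simpa using norm_integral_le_of_norm_le_const (μ := ρ.1) (f := g j) (C := M j)
      (ae_of_all _ (hgM j))
  have hgsum : ∀ j (ρ : Pp p d), ∫ y, g j y ∂ρ.1 = ∑ i, (j.2 i : ℝ) * ∫ y, e i y ∂ρ.1 :=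
    fun j ρ => by
      simp only [g]
      rw [integral_finsetSum Finset.univ (f := fun i y => (j.2 i : ℝ) * e i y)
        fun i _ => (hei i ρ).const_mul _]
      simp_rw [integral_const_mul]
  let h : ((Σ n : ℕ, (Fin n → ℚ)) × ℕ) → X → ℝ≥0∞ := fun k x =>
    min (⨅ ρ ∈ {ρ : Pp p d | ∫⁻ y, ENNReal.ofReal (w y) ∂ρ.1 ≤ (k.2 : ℝ≥0∞)},
      (weightedCost C w x ρ.1 + ENNReal.ofReal (∫ y, g k.1 y ∂ρ.1 + M k.1))) k.2
  have hhm : ∀ k, Measurable (h k) := fun k => by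
    refine (LowerSemicontinuous.measurable ?_).min measurable_const
    refine lowerSemicontinuous_iInf_compact (H := fun q : X × Pp p d =>
      weightedCost C w q.1 q.2.1 + ENNReal.ofReal (∫ y, g k.1 y ∂q.2.1 + M k.1)) ?_
      (isCompact_weight_sublevel hp hw (by simp))
    refine (lowerSemicontinuous_weightedCost hlsc hw).add (Continuous.lowerSemicontinuous ?_)
    exact ENNReal.continuous_ofReal.comp
      (((continuous_integral_pp (growthP_of_bounded (hgc k.1) (hgM k.1))).comp
        continuous_snd).add continuous_const)
  have hhN : ∀ k x, h k x ≤ k.2 := fun k x => min_le_right _ _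
  have hht : ∀ k x, h k x ≠ ⊤ := fun k x => ne_top_of_le_ne_top (by simp) (hhN k x)
  have hhle : ∀ k x (ρ : Pp p d),
      h k x ≤ weightedCost C w x ρ.1 + ENNReal.ofReal (∫ y, g k.1 y ∂ρ.1 + M k.1) := by
    intro k x ρ
    by_cases hρ : ∫⁻ y, ENNReal.ofReal (w y) ∂ρ.1 ≤ (k.2 : ℝ≥0∞)
    · exact (min_le_left _ _).trans (iInf₂_le ρ hρ)
    · refine (hhN k x).trans ((not_le.1 hρ).le.trans ?_)
      exact le_add_right le_add_self
  refine ⟨fun n x => (h (s n) x).toReal - M (s n).1, fun n => g (s n).1,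
    fun n => (hhm _).ennreal_toReal.sub_const _, fun n => ⟨(s n).2 + M (s n).1, fun x => ?_⟩,
    fun n => hgc _, fun n => ⟨_, hgM _⟩, fun n x ρ => ?_, fun x ρ₀ => ?_⟩
  · have h1 : (h (s n) x).toReal ≤ (s n).2 := by
      simpa using ENNReal.toReal_mono (by simp) (hhN (s n) x)
    have h2 : 0 ≤ M (s n).1 := Finset.sum_nonneg fun i _ => abs_nonneg _
    have h3 : 0 ≤ (h (s n) x).toReal := ENNReal.toReal_nonneg
    rw [abs_le]
    constructor <;> linarith
  · by_cases hct : weightedCost C w x ρ.1 = ⊤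
    · rw [hct]; exact le_top
    refine ENNReal.ofReal_le_of_le_toReal ?_
    have h1 := ENNReal.toReal_mono (by finiteness) (hhle (s n) x ρ)
    have h2 := abs_le.1 (hgint (s n).1 ρ)
    rw [ENNReal.toReal_add hct (by simp), ENNReal.toReal_ofReal (by linarith)] at h1
    linarith
  · refine le_of_forall_lt fun z hz => ?_
    obtain ⟨z', hz1, hz2⟩ := exists_between hz
    have hz't : z' ≠ ⊤ := hz2.ne_top
    have hz'r : ENNReal.ofReal z'.toReal = z' := ENNReal.ofReal_toReal hz't
    obtain ⟨n, q, hq⟩ := exists_affine_minorant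
      (lowerSemicontinuous_weightedCost_right hlsc hw x)
      (isCompact_weightedCost_sublevel hp hlsc hw x) (weightedCost_ppMix hconv x) he he1 hsep ρ₀
      ENNReal.toReal_nonneg (hz'r.trans_lt hz2)
    set j : Σ n : ℕ, (Fin n → ℚ) := ⟨n, q⟩ with hj
    obtain ⟨N, hN⟩ := exists_nat_ge (z'.toReal + ∫ y, g j y ∂ρ₀.1 + M j)
    obtain ⟨m, hm⟩ := hs (j, N)
    refine hz1.trans_le (le_iSup_of_le m ?_)
    simp only [hm]
    rw [← hz'r]
    refine ENNReal.ofReal_le_ofReal ?_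
    have key : ENNReal.ofReal (z'.toReal + ∫ y, g j y ∂ρ₀.1 + M j) ≤ h (j, N) x := by
      refine le_min (le_iInf₂ fun ρ _ => ?_) ?_
      · refine le_trans ?_ (add_le_add_left (hq ρ) _)
        refine le_trans (ENNReal.ofReal_le_ofReal (le_of_eq ?_)) ENNReal.ofReal_add_le
        rw [hgsum, hgsum]
        simp_rw [mul_sub]
        rw [Finset.sum_sub_distrib]
        ring
      · rw [← ENNReal.ofReal_natCast]
        exact ENNReal.ofReal_le_ofReal hN
    have h1 := (ENNReal.ofReal_le_iff_le_toReal (hht _ _)).1 key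
    linarith

end DualFamily

section DualFunctional

/-- Bounded measurable real functions. -/
def IsBddMeas {α : Type*} [MeasurableSpace α] (F : α → ℝ) : Prop :=
  Measurable F ∧ ∃ M : ℝ, ∀ z, |F z| ≤ M

/-- Bounded continuous real functions. -/
def IsBddCont {α : Type*} [TopologicalSpace α] (F : α → ℝ) : Prop :=
  Continuous F ∧ ∃ M : ℝ, ∀ z, |F z| ≤ M

section Bdd

variable {α β : Type*}

theorem isBddMeas_const [MeasurableSpace α] (r : ℝ) : IsBddMeas fun _ : α => r :=
  ⟨measurable_const, |r|, fun _ => le_rfl⟩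

theorem isBddCont_const [TopologicalSpace α] (r : ℝ) : IsBddCont fun _ : α => r :=
  ⟨continuous_const, |r|, fun _ => le_rfl⟩

theorem IsBddMeas.add [MeasurableSpace α] {F G : α → ℝ} (hF : IsBddMeas F) (hG : IsBddMeas G) :
    IsBddMeas (F + G) := by
  obtain ⟨hF, M, hM⟩ := hF
  obtain ⟨hG, N, hN⟩ := hG
  exact ⟨hF.add hG, M + N, fun z => (abs_add_le _ _).trans (add_le_add (hM z) (hN z))⟩

theorem IsBddMeas.smul [MeasurableSpace α] {F : α → ℝ} (r : ℝ) (hF : IsBddMeas F) :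
    IsBddMeas (r • F) := by
  obtain ⟨hF, M, hM⟩ := hF
  refine ⟨hF.const_smul r, |r| * M, fun z => ?_⟩
  rw [Pi.smul_apply, smul_eq_mul, abs_mul]
  exact mul_le_mul_of_nonneg_left (hM z) (abs_nonneg r)

theorem IsBddMeas.sub [MeasurableSpace α] {F G : α → ℝ} (hF : IsBddMeas F) (hG : IsBddMeas G) :
    IsBddMeas (F - G) := by
  obtain ⟨hF, M, hM⟩ := hF
  obtain ⟨hG, N, hN⟩ := hG
  exact ⟨hF.sub hG, M + N, fun z => (abs_sub _ _).trans (add_le_add (hM z) (hN z))⟩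

theorem IsBddMeas.mul [MeasurableSpace α] {F G : α → ℝ} (hF : IsBddMeas F) (hG : IsBddMeas G) :
    IsBddMeas (F * G) := by
  obtain ⟨hF, M, hM⟩ := hF
  obtain ⟨hG, N, hN⟩ := hG
  refine ⟨hF.mul hG, M * N, fun z => ?_⟩
  rw [Pi.mul_apply, abs_mul]
  exact mul_le_mul (hM z) (hN z) (abs_nonneg _) ((abs_nonneg _).trans (hM z))

theorem IsBddMeas.comp [MeasurableSpace α] [MeasurableSpace β] {F : α → ℝ} (hF : IsBddMeas F)
    {g : β → α} (hg : Measurable g) : IsBddMeas fun z => F (g z) :=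
  ⟨hF.1.comp hg, hF.2.imp fun _ hM _ => hM _⟩

theorem IsBddMeas.integrable [MeasurableSpace α] {F : α → ℝ} (hF : IsBddMeas F) (ρ : Measure α)
    [IsFiniteMeasure ρ] : Integrable F ρ := by
  obtain ⟨hF, M, hM⟩ := hF
  exact Integrable.of_bound hF.aestronglyMeasurable M (ae_of_all _ hM)

theorem IsBddCont.isBddMeas [TopologicalSpace α] [MeasurableSpace α] [OpensMeasurableSpace α]
    {F : α → ℝ} (hF : IsBddCont F) : IsBddMeas F :=
  ⟨hF.1.measurable, hF.2⟩

theorem IsBddCont.add [TopologicalSpace α] {F G : α → ℝ} (hF : IsBddCont F) (hG : IsBddCont G) :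
    IsBddCont (F + G) := by
  obtain ⟨hF, M, hM⟩ := hF
  obtain ⟨hG, N, hN⟩ := hG
  exact ⟨hF.add hG, M + N, fun z => (abs_add_le _ _).trans (add_le_add (hM z) (hN z))⟩

theorem IsBddCont.smul [TopologicalSpace α] {F : α → ℝ} (r : ℝ) (hF : IsBddCont F) :
    IsBddCont (r • F) := by
  obtain ⟨hF, M, hM⟩ := hF
  refine ⟨hF.const_smul r, |r| * M, fun z => ?_⟩
  rw [Pi.smul_apply, smul_eq_mul, abs_mul]
  exact mul_le_mul_of_nonneg_left (hM z) (abs_nonneg r)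

end Bdd

variable {X : Type*} [MeasurableSpace X] {d : ℕ} {p : ℝ}

/-- Regular dual pairs for a cost `c`. -/
structure IsDualPair (c : X → Pp p d → ℝ≥0∞) (φ : X → ℝ) (ψ : Rd d → ℝ) : Prop where
  left : IsBddMeas φ
  right : IsBddCont ψ
  le : ∀ x ρ, ENNReal.ofReal (φ x - ∫ y, ψ y ∂ρ.1) ≤ c x ρ

/-- The space of bounded measurable functions. -/
def bddMeasSpace (α : Type*) [MeasurableSpace α] : Submodule ℝ (α → ℝ) where
  carrier := {F | IsBddMeas F}
  add_mem' hF hG := hF.add hG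
  zero_mem' := isBddMeas_const 0
  smul_mem' r _ hF := hF.smul r

/-- Separable functions inside the bounded measurable functions on a product. -/
def splitSpace (X : Type*) [MeasurableSpace X] (d : ℕ) :
    Submodule ℝ (bddMeasSpace (X × Rd d)) where
  carrier := {F | ∃ φ ψ, IsBddMeas φ ∧ IsBddCont ψ ∧ F.1 = fun z => φ z.1 + ψ z.2}
  add_mem' := by
    rintro F G ⟨φ, ψ, h1, h2, h3⟩ ⟨φ', ψ', h1', h2', h3'⟩
    refine ⟨_, _, h1.add h1', h2.add h2', ?_⟩
    rw [Submodule.coe_add, h3, h3']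
    ext z
    simp only [Pi.add_apply]
    ring
  zero_mem' := ⟨0, 0, isBddMeas_const 0, isBddCont_const 0, by ext z; simp⟩
  smul_mem' := by
    rintro r F ⟨φ, ψ, h1, h2, h3⟩
    refine ⟨_, _, h1.smul r, h2.smul r, ?_⟩
    rw [Submodule.coe_smul, h3]
    ext z
    simp [mul_add]

theorem IsBddMeas.section_right {F : X × Rd d → ℝ} (hF : IsBddMeas F) (x : X) :
    IsBddMeas fun y => F (x, y) := hF.comp measurable_prodMk_left

/-- The cone generated by the functions dominating the cost from the side of the value `D`. -/
def dualCone (c : X → Pp p d → ℝ≥0∞) (D : ℝ) : PointedCone ℝ (bddMeasSpace (X × Rd d)) where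
  carrier := {F | ∃ t : ℝ, 0 ≤ t ∧ ∀ x (ρ : Pp p d),
    ENNReal.ofReal (t * D - ∫ y, F.1 (x, y) ∂ρ.1) ≤ ENNReal.ofReal t * c x ρ}
  add_mem' := by
    rintro F G ⟨t, ht, hF⟩ ⟨u, hu, hG⟩
    refine ⟨t + u, add_nonneg ht hu, fun x ρ => ?_⟩
    have := ρ.2.1
    have h : (t + u) * D - ∫ y, (F + G).1 (x, y) ∂ρ.1
        = (t * D - ∫ y, F.1 (x, y) ∂ρ.1) + (u * D - ∫ y, G.1 (x, y) ∂ρ.1) := by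
      have h1 : ∫ y, (F + G).1 (x, y) ∂ρ.1 = ∫ y, F.1 (x, y) ∂ρ.1 + ∫ y, G.1 (x, y) ∂ρ.1 :=
        integral_add ((F.2.section_right x).integrable _) ((G.2.section_right x).integrable _)
      rw [h1]; ring
    rw [h, ENNReal.ofReal_add ht hu, add_mul]
    exact ENNReal.ofReal_add_le.trans (add_le_add (hF x ρ) (hG x ρ))
  zero_mem' := ⟨0, le_rfl, fun x ρ => by simp⟩
  smul_mem' := by
    rintro r F ⟨t, ht, hF⟩
    refine ⟨r * t, mul_nonneg r.2 ht, fun x ρ => ?_⟩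
    have h : (r * t : ℝ) * D - ∫ y, (r • F).1 (x, y) ∂ρ.1
        = r * (t * D - ∫ y, F.1 (x, y) ∂ρ.1) := by
      have h1 : ∫ y, (r • F).1 (x, y) ∂ρ.1 = r * ∫ y, F.1 (x, y) ∂ρ.1 :=
        integral_const_mul (r : ℝ) _
      rw [h1]; ring
    rw [h, ENNReal.ofReal_mul r.2, ENNReal.ofReal_mul r.2, mul_assoc]
    exact mul_le_mul_right (hF x ρ) _

/-- A dominated extension of the product integral on separable functions. -/
theorem exists_dual_functional (μ : Measure X) [IsProbabilityMeasure μ] (ν : Pp p d)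
    {c : X → Pp p d → ℝ≥0∞} {D : ℝ}
    (hD : ∀ φ ψ, IsDualPair c φ ψ → ∫ x, φ x ∂μ - ∫ y, ψ y ∂ν.1 ≤ D) :
    ∃ L : (X × Rd d → ℝ) →ₗ[ℝ] ℝ,
      (∀ F, IsBddMeas F → (∀ z, 0 ≤ F z) → 0 ≤ L F) ∧
      (∀ φ, IsBddMeas φ → L (fun z => φ z.1) = ∫ x, φ x ∂μ) ∧
      (∀ ψ, IsBddCont ψ → L (fun z => ψ z.2) = ∫ y, ψ y ∂ν.1) ∧
      ∀ F, IsBddMeas F → (∀ x (ρ : Pp p d), ENNReal.ofReal (∫ y, F (x, y) ∂ρ.1) ≤ c x ρ) →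
        L F ≤ D := by
  have := ν.2.1
  let I : bddMeasSpace (X × Rd d) →ₗ[ℝ] ℝ :=
    { toFun := fun F => ∫ z, F.1 z ∂(μ.prod ν.1)
      map_add' := fun F G => integral_add (F.2.integrable _) (G.2.integrable _)
      map_smul' := fun r F => integral_const_mul r _ }
  have hI : ∀ φ ψ, IsBddMeas φ → IsBddCont ψ →
      ∫ z, (φ z.1 + ψ z.2) ∂(μ.prod ν.1) = ∫ x, φ x ∂μ + ∫ y, ψ y ∂ν.1 := by
    intro φ ψ hφ hψ
    rw [integral_add ((hφ.comp measurable_fst).integrable _)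
      ((hψ.isBddMeas.comp measurable_snd).integrable _), integral_fun_fst, integral_fun_snd]
    simp
  have hnn : ∀ x : (I.toPMap (splitSpace X d)).domain,
      (x : bddMeasSpace (X × Rd d)) ∈ dualCone c D → 0 ≤ I.toPMap (splitSpace X d) x := by
    rintro ⟨F, φ, ψ, hφ, hψ, hF⟩ ⟨t, ht, hc⟩
    change 0 ≤ ∫ z, F.1 z ∂(μ.prod ν.1)
    simp only [hF] at hc
    rw [hF, hI φ ψ hφ hψ]
    have hint : ∀ x (ρ : Pp p d), ∫ y, (φ x + ψ y) ∂ρ.1 = φ x + ∫ y, ψ y ∂ρ.1 := by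
      intro x ρ
      have := ρ.2.1
      rw [integral_add (integrable_const _) (hψ.isBddMeas.integrable _)]
      simp
    simp only [hint] at hc
    rcases ht.eq_or_lt with rfl | ht
    · have h0 : ∀ x, 0 ≤ φ x + ∫ y, ψ y ∂ν.1 := by
        intro x
        have h1 := hc x ν
        simp only [zero_mul, zero_sub, ENNReal.ofReal_zero, nonpos_iff_eq_zero,
          ENNReal.ofReal_eq_zero] at h1
        linarith
      have h2 : 0 ≤ ∫ x, (φ x + ∫ y, ψ y ∂ν.1) ∂μ := integral_nonneg h0
      rw [integral_add (hφ.integrable _) (integrable_const _)] at h2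
      simpa using h2
    · have hpair : IsDualPair c ((fun _ : X => D) - t⁻¹ • φ) (t⁻¹ • ψ) := by
        refine ⟨(isBddMeas_const D).sub (hφ.smul _), hψ.smul _, fun x ρ => ?_⟩
        have h1 : ∫ y, (t⁻¹ • ψ) y ∂ρ.1 = t⁻¹ * ∫ y, ψ y ∂ρ.1 := integral_const_mul _ _
        have h2 : ((fun _ : X => D) - t⁻¹ • φ) x - ∫ y, (t⁻¹ • ψ) y ∂ρ.1
            = t⁻¹ * (t * D - (φ x + ∫ y, ψ y ∂ρ.1)) := by
          rw [h1]; simp only [Pi.sub_apply, Pi.smul_apply, smul_eq_mul]; field_simp; ring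
        rw [h2, ENNReal.ofReal_mul (by positivity)]
        calc _ ≤ ENNReal.ofReal t⁻¹ * (ENNReal.ofReal t * c x ρ) := mul_le_mul_right (hc x ρ) _
          _ = c x ρ := by
            rw [← mul_assoc, ← ENNReal.ofReal_mul (by positivity), inv_mul_cancel₀ ht.ne']
            simp
      have h3 := hD _ _ hpair
      have h4 : ∫ y, (t⁻¹ • ψ) y ∂ν.1 = t⁻¹ * ∫ y, ψ y ∂ν.1 := integral_const_mul _ _
      have h5 : ∫ x, ((fun _ : X => D) - t⁻¹ • φ) x ∂μ = D - t⁻¹ * ∫ x, φ x ∂μ := by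
        have h6 : ∫ x, (D - t⁻¹ * φ x) ∂μ = D - t⁻¹ * ∫ x, φ x ∂μ := by
          rw [integral_sub (integrable_const _) ((hφ.integrable _).const_mul _),
            integral_const_mul]
          simp
        exact h6
      rw [h4, h5] at h3
      have h7 : 0 ≤ t⁻¹ * (∫ x, φ x ∂μ + ∫ y, ψ y ∂ν.1) := by linarith
      exact nonneg_of_mul_nonneg_right h7 (by positivity)
  have hdense : ∀ F, ∃ x : (I.toPMap (splitSpace X d)).domain,
      (x : bddMeasSpace (X × Rd d)) + F ∈ dualCone c D := by
    intro F
    obtain ⟨M, hM⟩ := F.2.2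
    refine ⟨⟨⟨fun _ => M, isBddMeas_const M⟩, fun _ => M, fun _ => 0, isBddMeas_const M,
      isBddCont_const 0, by simp⟩, 0, le_rfl, fun x ρ => ?_⟩
    have h : 0 ≤ ∫ y, (M + F.1 (x, y)) ∂ρ.1 :=
      integral_nonneg fun y => by
        have := neg_le_of_abs_le (hM (x, y))
        show 0 ≤ M + F.1 (x, y)
        linarith
    rw [zero_mul, ENNReal.ofReal_of_nonpos]
    · simp
    · rw [zero_sub]
      exact neg_nonpos.2 h
  obtain ⟨g, hg1, hg2⟩ := riesz_extension (dualCone c D) (I.toPMap (splitSpace X d)) hnn hdense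
  obtain ⟨L, hL⟩ := g.exists_extend
  have hLg : ∀ F (hF : IsBddMeas F), L F = g ⟨F, hF⟩ := fun F hF =>
    LinearMap.congr_fun hL ⟨F, hF⟩
  have hsplit : ∀ φ ψ, IsBddMeas φ → IsBddCont ψ →
      L (fun z => φ z.1 + ψ z.2) = ∫ x, φ x ∂μ + ∫ y, ψ y ∂ν.1 := by
    intro φ ψ hφ hψ
    have hF : IsBddMeas fun z : X × Rd d => φ z.1 + ψ z.2 :=
      (hφ.comp measurable_fst).add (hψ.isBddMeas.comp measurable_snd)
    rw [hLg _ hF, ← hI φ ψ hφ hψ]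
    exact hg1 ⟨⟨_, hF⟩, φ, ψ, hφ, hψ, rfl⟩
  refine ⟨L, fun F hF h0 => ?_, fun φ hφ => ?_, fun ψ hψ => ?_, fun F hF hc => ?_⟩
  · rw [hLg F hF]
    refine hg2 _ ⟨0, le_rfl, fun x ρ => ?_⟩
    rw [zero_mul, ENNReal.ofReal_of_nonpos]
    · simp
    · rw [zero_sub]
      exact neg_nonpos.2 (integral_nonneg fun y => h0 _)
  · simpa using hsplit φ 0 hφ (isBddCont_const 0)
  · simpa using hsplit 0 ψ (isBddMeas_const 0) hψ
  · have h1 : 0 ≤ L ((fun _ : X × Rd d => D) - F) := by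
      have hF' : IsBddMeas ((fun _ : X × Rd d => D) - F) := (isBddMeas_const D).sub hF
      rw [hLg _ hF']
      refine hg2 _ ⟨1, zero_le_one, fun x ρ => ?_⟩
      have := ρ.2.1
      have h2 : ∫ y, ((fun _ : X × Rd d => D) - F) (x, y) ∂ρ.1 = D - ∫ y, F (x, y) ∂ρ.1 := by
        have h3 : ∫ y, (D - F (x, y)) ∂ρ.1 = D - ∫ y, F (x, y) ∂ρ.1 := by
          rw [integral_sub (integrable_const _) ((hF.section_right x).integrable _)]
          simp
        exact h3
      rw [h2]
      simpa using hc x ρ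
    have h2 : L (fun _ => D) = D := by
      simpa using hsplit (fun _ => D) 0 (isBddMeas_const D) (isBddCont_const 0)
    rw [map_sub, h2] at h1
    linarith

end DualFunctional

section Representation

theorem isBddCont_radialStep {E : Type*} [NormedAddCommGroup E] (r : ℝ) :
    IsBddCont (radialStep (E := E) r) :=
  ⟨continuous_radialStep r, 1, fun z => by
    rw [abs_of_nonneg (radialStep_nonneg r z)]; exact radialStep_le_one r z⟩

theorem IsBddCont.mul {α : Type*} [TopologicalSpace α] {F G : α → ℝ} (hF : IsBddCont F)
    (hG : IsBddCont G) : IsBddCont (F * G) := by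
  obtain ⟨hF, M, hM⟩ := hF
  obtain ⟨hG, N, hN⟩ := hG
  refine ⟨hF.mul hG, M * N, fun z => ?_⟩
  rw [Pi.mul_apply, abs_mul]
  exact mul_le_mul (hM z) (hN z) (abs_nonneg _) ((abs_nonneg _).trans (hM z))

theorem IsBddCont.comp {α β : Type*} [TopologicalSpace α] [TopologicalSpace β] {F : α → ℝ}
    (hF : IsBddCont F) {g : β → α} (hg : Continuous g) : IsBddCont fun z => F (g z) :=
  ⟨hF.1.comp hg, hF.2.imp fun _ hM _ => hM _⟩

theorem tendsto_integral_radialStep {E α : Type*} [NormedAddCommGroup E] [MeasurableSpace E]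
    [OpensMeasurableSpace E] [MeasurableSpace α] (μ : Measure α) [IsFiniteMeasure μ] {e : α → E}
    (he : Measurable e) :
    Tendsto (fun n : ℕ => ∫ x, radialStep (n : ℝ) (e x) ∂μ) atTop (𝓝 0) := by
  have h : Tendsto (fun n : ℕ => ∫ x, radialStep (n : ℝ) (e x) ∂μ) atTop (𝓝 (∫ _, 0 ∂μ)) := by
    refine tendsto_integral_of_dominated_convergence (fun _ => 1)
      (fun n => ((continuous_radialStep _).measurable.comp he).aestronglyMeasurable)
      (integrable_const _) (fun n => ae_of_all _ fun x => ?_) (ae_of_all _ fun x => ?_)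
    · rw [Real.norm_of_nonneg (radialStep_nonneg _ _)]; exact radialStep_le_one _ _
    · obtain ⟨m, hm⟩ := exists_nat_ge ‖e x‖
      refine tendsto_const_nhds.congr' ?_
      filter_upwards [eventually_ge_atTop m] with n hn
      exact (radialStep_of_le (hm.trans (by exact_mod_cast hn))).symm
  simpa using h

/-- A tight normalised positive functional on bounded continuous functions is a probability
measure. -/
theorem exists_measure_of_tight_functional {E : Type*} [NormedAddCommGroup E] [ProperSpace E]
    [MeasurableSpace E] [BorelSpace E] (Λ : (E → ℝ) →ₗ[ℝ] ℝ)
    (hpos : ∀ k, IsBddCont k → (∀ z, 0 ≤ k z) → 0 ≤ Λ k) (hone : Λ (fun _ => 1) = 1)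
    (htight : Tendsto (fun n : ℕ => Λ (radialStep (n : ℝ))) atTop (𝓝 0)) :
    ∃ m : Measure E, IsProbabilityMeasure m ∧ ∀ k, IsBddCont k → Λ k = ∫ z, k z ∂m := by
  have hcc : ∀ f : CompactlySupportedContinuousMap E ℝ, IsBddCont f := fun f =>
    ⟨f.continuous, f.continuous.bounded_above_of_compact_support f.hasCompactSupport⟩
  let Λc : CompactlySupportedContinuousMap E ℝ →ₗ[ℝ] ℝ :=
    { toFun := fun f => Λ f
      map_add' := fun f g => Λ.map_add f g
      map_smul' := fun r f => Λ.map_smul r f }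
  let m := RealRMK.rieszMeasure (PositiveLinearMap.mk₀ Λc fun f hf => hpos f (hcc f) hf)
  have hm : ∀ f : CompactlySupportedContinuousMap E ℝ, ∫ z, f z ∂m = Λ f := fun f =>
    RealRMK.integral_rieszMeasure _ f
  have hcut : ∀ k, IsBddCont k → ∀ n : ℕ,
      Λ (k * (1 - radialStep (n : ℝ))) = ∫ z, k z * (1 - radialStep (n : ℝ) z) ∂m := by
    intro k hk n
    have hc : Continuous fun z : E => k z * (1 - radialStep (n : ℝ) z) :=
      hk.1.mul (continuous_const.sub (continuous_radialStep _))
    have hs : HasCompactSupport fun z : E => k z * (1 - radialStep (n : ℝ) z) := by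
      refine HasCompactSupport.intro (isCompact_closedBall (0 : E) (n + 1)) fun z hz => ?_
      rw [mem_closedBall_zero_iff, not_le] at hz
      rw [radialStep_of_ge hz.le]; simp
    exact (hm ⟨⟨_, hc⟩, hs⟩).symm
  have hlim : ∀ k, IsBddCont k →
      Tendsto (fun n : ℕ => Λ (k * (1 - radialStep (n : ℝ)))) atTop (𝓝 (Λ k)) := by
    intro k hk
    obtain ⟨M, hM⟩ := hk.2
    have hsq : ∀ n : ℕ, ‖Λ (k * (1 - radialStep (n : ℝ))) - Λ k‖ ≤ M * Λ (radialStep (n : ℝ)) := by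
      intro n
      have h1 : Λ (k * (1 - radialStep (n : ℝ))) - Λ k = - Λ (k * radialStep (n : ℝ)) := by
        rw [mul_sub, mul_one, map_sub]; ring
      have hb := hk.mul (isBddCont_radialStep (E := E) (n : ℝ))
      have hr := (isBddCont_radialStep (E := E) (n : ℝ)).smul M
      have h2 := hpos _ (hr.add hb) fun z => by
        have := mul_le_mul_of_nonneg_right (neg_le_of_abs_le (hM z)) (radialStep_nonneg (n : ℝ) z)
        simp only [Pi.add_apply, Pi.smul_apply, Pi.mul_apply, smul_eq_mul]
        linarith
      have h3 := hpos _ (hr.add (hb.smul (-1))) fun z => by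
        have := mul_le_mul_of_nonneg_right (le_of_abs_le (hM z)) (radialStep_nonneg (n : ℝ) z)
        simp only [Pi.add_apply, Pi.smul_apply, Pi.mul_apply, smul_eq_mul]
        linarith
      simp only [map_add, map_smul, smul_eq_mul] at h2 h3
      rw [h1, norm_neg, Real.norm_eq_abs, abs_le]
      constructor <;> linarith
    have h0 := squeeze_zero_norm hsq (by simpa using htight.const_mul M)
    simpa using h0.add_const (Λ k)
  have hone' : ∀ n : ℕ, ∫⁻ z, ENNReal.ofReal (1 - radialStep (n : ℝ) z) ∂m ≤ 1 := by
    intro n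
    have h1 := hcut (fun _ => 1) (isBddCont_const 1) n
    simp only [one_mul] at h1
    have h2 : Λ (1 - radialStep (n : ℝ)) ≤ 1 := by
      rw [map_sub]
      have := hpos _ (isBddCont_radialStep (E := E) (n : ℝ)) (radialStep_nonneg _)
      have h3 : Λ 1 = 1 := hone
      linarith
    have h3 : ((fun _ : E => (1 : ℝ)) * (1 - radialStep (n : ℝ))) = 1 - radialStep (n : ℝ) := by
      ext z; simp
    rw [h3] at h1
    have hc : Continuous fun z : E => 1 - radialStep (n : ℝ) z :=
      continuous_const.sub (continuous_radialStep _)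
    have hs : HasCompactSupport fun z : E => 1 - radialStep (n : ℝ) z := by
      refine HasCompactSupport.intro (isCompact_closedBall (0 : E) (n + 1)) fun z hz => ?_
      rw [mem_closedBall_zero_iff, not_le] at hz
      rw [radialStep_of_ge hz.le]; simp
    rw [← ofReal_integral_eq_lintegral_ofReal (hc.integrable_of_hasCompactSupport hs)
      (ae_of_all _ fun z => sub_nonneg.2 (radialStep_le_one _ _)), ← h1]
    exact ENNReal.ofReal_le_one.2 h2
  have hfin : IsFiniteMeasure m := by
    refine ⟨lt_of_le_of_lt ?_ ENNReal.one_lt_top⟩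
    have h1 : m univ = ∫⁻ z, ⨆ n : ℕ, ENNReal.ofReal (1 - radialStep (n : ℝ) z) ∂m := by
      rw [← lintegral_one]
      refine lintegral_congr fun z => le_antisymm ?_ (iSup_le fun n => ?_)
      · obtain ⟨n, hn⟩ := exists_nat_ge ‖z‖
        refine le_iSup_of_le n ?_
        rw [radialStep_of_le hn]; simp
      · exact ENNReal.ofReal_le_one.2 (by linarith [radialStep_nonneg (n : ℝ) z])
    rw [h1, lintegral_iSup]
    · exact iSup_le hone'
    · exact fun n => (measurable_const.sub (continuous_radialStep _).measurable).ennreal_ofReal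
    · intro n n' hn z
      refine ENNReal.ofReal_le_ofReal (sub_le_sub_left ?_ _)
      have : (n : ℝ) ≤ n' := by exact_mod_cast hn
      exact min_le_min_left _ (max_le_max_right _ (by linarith))
  have hrep : ∀ k, IsBddCont k → Λ k = ∫ z, k z ∂m := by
    intro k hk
    obtain ⟨M, hM⟩ := hk.2
    refine tendsto_nhds_unique (hlim k hk) ?_
    simp only [hcut k hk]
    refine tendsto_integral_of_dominated_convergence (fun _ => M)
      (fun n => (hk.1.mul (continuous_const.sub (continuous_radialStep _))).aestronglyMeasurable)
      (integrable_const _) (fun n => ae_of_all _ fun z => ?_) (ae_of_all _ fun z => ?_)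
    · rw [norm_mul, Real.norm_eq_abs, Real.norm_of_nonneg (sub_nonneg.2 (radialStep_le_one _ _))]
      exact (mul_le_of_le_one_right (abs_nonneg _)
        (by linarith [radialStep_nonneg (n : ℝ) z])).trans (hM z)
    · obtain ⟨j, hj⟩ := exists_nat_ge ‖z‖
      refine tendsto_const_nhds.congr' ?_
      filter_upwards [eventually_ge_atTop j] with n hn
      rw [radialStep_of_le (hj.trans (by exact_mod_cast hn))]; simp
  refine ⟨m, ⟨?_⟩, hrep⟩
  have h1 := hrep _ (isBddCont_const 1)
  rw [hone] at h1
  simp only [integral_const, smul_eq_mul, mul_one] at h1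
  rw [← ofReal_measureReal, ← h1, ENNReal.ofReal_one]

end Representation

section Coupling

/-- A positive functional with prescribed marginals is integration against a coupling, at least
on products of a measurable and a continuous function. -/
theorem exists_coupling_of_functional {X : Type*} [MeasurableSpace X] [StandardBorelSpace X]
    {d : ℕ} (μ : Measure X) [IsProbabilityMeasure μ] (ν : Measure (Rd d)) [IsProbabilityMeasure ν]
    (L : (X × Rd d → ℝ) →ₗ[ℝ] ℝ) (hpos : ∀ F, IsBddMeas F → (∀ z, 0 ≤ F z) → 0 ≤ L F)
    (hfst : ∀ φ, IsBddMeas φ → L (fun z => φ z.1) = ∫ x, φ x ∂μ)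
    (hsnd : ∀ ψ, IsBddCont ψ → L (fun z => ψ z.2) = ∫ y, ψ y ∂ν) :
    ∃ π : Measure (X × Rd d), IsCoupling π μ ν ∧ ∀ h g, IsBddMeas h → IsBddCont g →
      L (fun z => h z.1 * g z.2) = ∫ z, h z.1 * g z.2 ∂π := by
  have hXne : Nonempty X := nonempty_of_isProbabilityMeasure μ
  have hemb := measurableEmbedding_embeddingReal X
  set e : X → ℝ := embeddingReal X with he_def
  have he : Measurable e := hemb.measurable
  let Λ : (ℝ × Rd d → ℝ) →ₗ[ℝ] ℝ :=
    { toFun := fun k => L fun z => k (e z.1, z.2)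
      map_add' := fun k k' => L.map_add (fun z => k (e z.1, z.2)) fun z => k' (e z.1, z.2)
      map_smul' := fun r k => L.map_smul r fun z => k (e z.1, z.2) }
  have hmeas : Measurable fun z : X × Rd d => (e z.1, z.2) :=
    (he.comp measurable_fst).prodMk measurable_snd
  have hLmono : ∀ F G, IsBddMeas F → IsBddMeas G → (∀ z, F z ≤ G z) → L F ≤ L G := by
    intro F G hF hG hFG
    have := hpos _ (hG.sub hF) fun z => sub_nonneg.2 (hFG z)
    rw [map_sub] at this
    linarith
  have hΛpos : ∀ k, IsBddCont k → (∀ z, 0 ≤ k z) → 0 ≤ Λ k := fun k hk h0 =>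
    hpos _ (hk.isBddMeas.comp hmeas) fun z => h0 _
  have hΛone : Λ (fun _ => 1) = 1 := by
    have h1 : L (fun _ => 1) = 1 := by simpa using hfst (fun _ => 1) (isBddMeas_const 1)
    exact h1
  have htight : Tendsto (fun n : ℕ => Λ (radialStep (n : ℝ))) atTop (𝓝 0) := by
    have h1 := (tendsto_integral_radialStep μ he).add
      (tendsto_integral_radialStep ν (measurable_id (α := Rd d)))
    rw [add_zero] at h1
    refine squeeze_zero (fun n => hΛpos _ (isBddCont_radialStep _) (radialStep_nonneg _))
      (fun n => ?_) h1
    have hb1 : IsBddMeas fun x => radialStep (n : ℝ) (e x) :=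
      (isBddCont_radialStep (E := ℝ) (n : ℝ)).isBddMeas.comp he
    have hb2 := isBddCont_radialStep (E := Rd d) (n : ℝ)
    rw [← hfst _ hb1]
    simp only [id]
    rw [← hsnd _ hb2, ← map_add]
    refine hLmono _ _ ((isBddCont_radialStep _).isBddMeas.comp hmeas)
      ((hb1.comp measurable_fst).add (hb2.isBddMeas.comp measurable_snd)) fun z => ?_
    have h3 := radialStep_nonneg (n : ℝ) (e z.1)
    have h4 := radialStep_nonneg (n : ℝ) z.2
    rcases le_total ‖e z.1‖ ‖z.2‖ with h | h
    · have : radialStep (n : ℝ) (e z.1, z.2) = radialStep (n : ℝ) z.2 := by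
        simp only [radialStep, Prod.norm_mk, max_eq_right h]
      simp only [Pi.add_apply]
      rw [this]; linarith
    · have : radialStep (n : ℝ) (e z.1, z.2) = radialStep (n : ℝ) (e z.1) := by
        simp only [radialStep, Prod.norm_mk, max_eq_left h]
      simp only [Pi.add_apply]
      rw [this]; linarith
  obtain ⟨m, hm, hrep⟩ := exists_measure_of_tight_functional Λ hΛpos hΛone htight
  have hmfst : m.map Prod.fst = μ.map e := by
    have := Measure.isProbabilityMeasure_map (μ := m) measurable_fst.aemeasurable
    have := Measure.isProbabilityMeasure_map (μ := μ) he.aemeasurable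
    refine ext_of_forall_integral_eq_of_IsFiniteMeasure fun f => ?_
    have hf : IsBddCont f := ⟨f.continuous, ‖f‖, f.norm_coe_le_norm⟩
    rw [integral_map measurable_fst.aemeasurable f.continuous.aestronglyMeasurable,
      integral_map he.aemeasurable f.continuous.aestronglyMeasurable,
      ← hrep _ (hf.comp continuous_fst)]
    exact hfst _ (hf.isBddMeas.comp he)
  have hmsnd : m.map Prod.snd = ν := by
    have := Measure.isProbabilityMeasure_map (μ := m) measurable_snd.aemeasurable
    refine ext_of_forall_integral_eq_of_IsFiniteMeasure fun f => ?_
    have hf : IsBddCont f := ⟨f.continuous, ‖f‖, f.norm_coe_le_norm⟩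
    rw [integral_map measurable_snd.aemeasurable f.continuous.aestronglyMeasurable,
      ← hrep _ (hf.comp continuous_snd)]
    exact hsnd _ hf
  have hprod : ∀ h g, IsBddMeas h → IsBddCont g →
      L (fun z => h (e z.1) * g z.2) = ∫ z, h z.1 * g z.2 ∂m := by
    intro h g hh hg
    obtain ⟨M, hM⟩ := hg.2
    have hM0 : 0 ≤ M := (abs_nonneg _).trans (hM 0)
    have := Measure.isProbabilityMeasure_map (μ := μ) he.aemeasurable
    refine eq_of_abs_sub_nonpos (le_of_forall_pos_le_add fun ε hε => ?_)
    obtain ⟨f, hf, -⟩ := (hh.integrable (μ.map e)).exists_boundedContinuous_integral_sub_le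
      (ε := ε / (2 * (M + 1))) (by positivity)
    have hfb : IsBddCont f := ⟨f.continuous, ‖f‖, f.norm_coe_le_norm⟩
    have hdiff : IsBddMeas fun s => |h s - f s| :=
      ⟨(hh.1.sub hfb.1.measurable).norm, by
        obtain ⟨N, hN⟩ := (hh.sub hfb.isBddMeas).2
        exact ⟨N, fun s => by rw [abs_abs]; exact hN s⟩⟩
    have hff : L (fun z => f (e z.1) * g z.2) = ∫ z, f z.1 * g z.2 ∂m :=
      hrep _ ((hfb.comp continuous_fst).mul (hg.comp continuous_snd))
    have hg2 : IsBddMeas fun z : X × Rd d => g z.2 := hg.isBddMeas.comp measurable_snd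
    have hA : |L (fun z => h (e z.1) * g z.2) - L (fun z => f (e z.1) * g z.2)|
        ≤ M * ∫ s, |h s - f s| ∂(μ.map e) := by
      have hb1 : IsBddMeas fun z : X × Rd d => |h (e z.1) - f (e z.1)| :=
        hdiff.comp (he.comp measurable_fst)
      have hb2 : IsBddMeas ((fun z : X × Rd d => h (e z.1) * g z.2)
          - fun z => f (e z.1) * g z.2) :=
        ((hh.comp (he.comp measurable_fst)).mul hg2).sub
          ((hfb.isBddMeas.comp (he.comp measurable_fst)).mul hg2)
      have hval : L (M • fun z => |h (e z.1) - f (e z.1)|) = M * ∫ s, |h s - f s| ∂(μ.map e) := by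
        rw [map_smul, hfst _ (hdiff.comp he), integral_map he.aemeasurable
          hdiff.1.aestronglyMeasurable, smul_eq_mul]
      have hkey : ∀ z : X × Rd d, |h (e z.1) * g z.2 - f (e z.1) * g z.2|
          ≤ M * |h (e z.1) - f (e z.1)| := fun z => by
        rw [← sub_mul, abs_mul, mul_comm]
        exact mul_le_mul_of_nonneg_right (hM _) (abs_nonneg _)
      rw [← map_sub, ← hval, abs_le]
      constructor
      · have h1 := hLmono _ _ ((hb1.smul M).smul (-1)) hb2 fun z => by
          have := neg_le_of_abs_le (hkey z)
          simpa using this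
        rw [map_smul] at h1
        simpa using h1
      · exact hLmono _ _ hb2 (hb1.smul M) fun z => le_of_abs_le (hkey z)
    have hg3 : IsBddMeas fun z : ℝ × Rd d => g z.2 := hg.isBddMeas.comp measurable_snd
    have hi1 := ((hh.comp measurable_fst).mul hg3).integrable m
    have hi2 := ((hfb.isBddMeas.comp measurable_fst).mul hg3).integrable m
    have hBd : |∫ z, f z.1 * g z.2 ∂m - ∫ z, h z.1 * g z.2 ∂m|
        ≤ M * ∫ s, |h s - f s| ∂(μ.map e) := by
      have h1 : ∫ z, f z.1 * g z.2 ∂m - ∫ z, h z.1 * g z.2 ∂m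
          = ∫ z, (f z.1 * g z.2 - h z.1 * g z.2) ∂m := (integral_sub hi2 hi1).symm
      rw [h1, ← Real.norm_eq_abs, ← hmfst, integral_map measurable_fst.aemeasurable
        hdiff.1.aestronglyMeasurable, ← integral_const_mul]
      refine norm_integral_le_of_norm_le
        ((hdiff.comp measurable_fst).integrable m |>.const_mul M) (ae_of_all _ fun z => ?_)
      rw [← sub_mul, norm_mul, mul_comm, Real.norm_eq_abs, Real.norm_eq_abs, abs_sub_comm]
      exact mul_le_mul_of_nonneg_right (hM _) (abs_nonneg _)
    have hfin : M * ∫ s, |h s - f s| ∂(μ.map e) ≤ ε / 2 := by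
      calc M * ∫ s, |h s - f s| ∂(μ.map e)
          ≤ (M + 1) * (ε / (2 * (M + 1))) := by
            refine mul_le_mul (by linarith) hf (integral_nonneg fun _ => abs_nonneg _)
              (by linarith)
        _ = ε / 2 := by field_simp
    calc |L (fun z => h (e z.1) * g z.2) - ∫ z, h z.1 * g z.2 ∂m|
        = |(L (fun z => h (e z.1) * g z.2) - L (fun z => f (e z.1) * g z.2))
            + (∫ z, f z.1 * g z.2 ∂m - ∫ z, h z.1 * g z.2 ∂m)| := by rw [hff]; congr 1; ring
      _ ≤ _ := abs_add_le _ _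
      _ ≤ 0 + ε := by linarith
  set r : ℝ → X := hemb.invFun with hr_def
  have hr : Measurable r := hemb.measurable_invFun
  have hre : ∀ x, r (e x) = x := hemb.leftInverse_invFun
  have hrm : Measurable fun z : ℝ × Rd d => (r z.1, z.2) :=
    (hr.comp measurable_fst).prodMk measurable_snd
  refine ⟨m.map fun z => (r z.1, z.2), ⟨Measure.isProbabilityMeasure_map hrm.aemeasurable,
    ?_, ?_⟩, fun h g hh hg => ?_⟩
  · rw [Measure.map_map measurable_fst hrm]
    change m.map (r ∘ Prod.fst) = μ
    rw [← Measure.map_map hr measurable_fst, hmfst, Measure.map_map hr he]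
    rw [show r ∘ e = id from funext hre, Measure.map_id]
  · rw [Measure.map_map measurable_snd hrm]
    exact hmsnd
  · have h1 := hprod _ g (hh.comp hr) hg
    simp only [hre] at h1
    rw [h1, integral_map hrm.aemeasurable]
    exact (((hh.comp measurable_fst).mul
      (hg.isBddMeas.comp measurable_snd)).1).aestronglyMeasurable

end Coupling

section Disintegration

open ProbabilityTheory

variable {X : Type*} [MeasurableSpace X] {d : ℕ} {p : ℝ} {μ : Measure X} {ν : Measure (Rd d)}
  {π : Measure (X × Rd d)}

theorem disint_eq_condKernel (π : Measure (X × Rd d)) [IsFiniteMeasure π] :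
    disint π = π.condKernel := dif_pos ‹_›

theorem IsCoupling.isMarkovKernel_disint (h : IsCoupling π μ ν) : IsMarkovKernel (disint π) := by
  have := h.1
  rw [disint_eq_condKernel]
  infer_instance

theorem IsCoupling.compProd_disint (h : IsCoupling π μ ν) : μ.compProd (disint π) = π := by
  have := h.1
  rw [disint_eq_condKernel, ← h.2.1]
  exact π.disintegrate π.condKernel

theorem IsCoupling.lintegral_disint (h : IsCoupling π μ ν) {f : Rd d → ℝ≥0∞}
    (hf : Measurable f) : ∫⁻ x, ∫⁻ y, f y ∂(disint π x) ∂μ = ∫⁻ y, f y ∂ν := by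
  have := h.1
  have := h.isMarkovKernel_disint
  have : IsProbabilityMeasure μ := h.2.1 ▸ Measure.isProbabilityMeasure_map
    measurable_fst.aemeasurable
  conv_rhs => rw [← h.2.2, lintegral_map hf measurable_snd, ← h.compProd_disint,
    Measure.lintegral_compProd (f := fun z => f z.2) (hf.comp measurable_snd)]

theorem IsCoupling.integral_disint (h : IsCoupling π μ ν) {F : X × Rd d → ℝ}
    (hF : IsBddMeas F) : ∫ z, F z ∂π = ∫ x, ∫ y, F (x, y) ∂(disint π x) ∂μ := by
  have := h.1
  have := h.isMarkovKernel_disint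
  have : IsProbabilityMeasure μ := h.2.1 ▸ Measure.isProbabilityMeasure_map
    measurable_fst.aemeasurable
  conv_lhs => rw [← h.compProd_disint, Measure.integral_compProd (hF.integrable _)]

theorem IsCoupling.ae_lintegral_lt_top (h : IsCoupling π μ ν) {f : Rd d → ℝ≥0∞}
    (hf : Measurable f) (hν : ∫⁻ y, f y ∂ν ≠ ⊤) :
    ∀ᵐ x ∂μ, ∫⁻ y, f y ∂(disint π x) ≠ ⊤ := by
  have := h.isMarkovKernel_disint
  rw [← h.lintegral_disint hf] at hν
  exact (ae_lt_top (hf.lintegral_kernel) hν).mono fun x hx => hx.ne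

theorem IsCoupling.ae_hasMomentP (hp : 1 ≤ p) (h : IsCoupling π μ ν) (hν : HasMomentP p ν) :
    ∀ᵐ x ∂μ, HasMomentP p (disint π x) :=
  h.ae_lintegral_lt_top (continuous_norm_rpow hp).measurable.ennreal_ofReal hν

end Disintegration

section StrongDuality

variable {X : Type*} [TopologicalSpace X] [PolishSpace X] [MeasurableSpace X] [BorelSpace X]
  {d : ℕ} {p : ℝ} {C : X → Measure (Rd d) → ℝ≥0∞} {w : Rd d → ℝ}

theorem IsBddMeas.indicator_mul {α : Type*} [MeasurableSpace α] {F : α → ℝ} (hF : IsBddMeas F)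
    {A : Set α} (hA : MeasurableSet A) : IsBddMeas fun z => A.indicator 1 z * F z :=
  IsBddMeas.mul ⟨measurable_one.indicator hA, 1, fun z => by
    by_cases hz : z ∈ A <;> simp [hz]⟩ hF

/-- Weak transport with a coercive cost: if all regular dual pairs have value at most `D`, then
some coupling has cost at most `D`. -/
theorem exists_coupling_le (hp : 1 ≤ p) (μ : Measure X) [IsProbabilityMeasure μ] (ν : Pp p d)
    (hlsc : LowerSemicontinuous fun q : X × Pp p d => C q.1 q.2.1)
    (hconv : ∀ x : X, ∀ ρ₁ ρ₂ : Pp p d, ∀ t : ℝ≥0∞, t ≤ 1 →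
      C x (t • ρ₁.1 + (1 - t) • ρ₂.1) ≤ t * C x ρ₁.1 + (1 - t) * C x ρ₂.1)
    (hw : IsWeight p w) {D : ℝ}
    (hD : ∀ φ ψ, IsDualPair (fun x (ρ : Pp p d) => weightedCost C w x ρ.1) φ ψ →
      ∫ x, φ x ∂μ - ∫ y, ψ y ∂ν.1 ≤ D) :
    ∃ π : Measure (X × Rd d), IsCoupling π μ ν.1 ∧
      ∫⁻ x, weightedCost C w x (disint π x) ∂μ ≤ ENNReal.ofReal D := by
  have := ν.2.1
  obtain ⟨L, hpos, hfst, hsnd, hLD⟩ := exists_dual_functional μ ν hD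
  obtain ⟨π, hπ, hL⟩ := exists_coupling_of_functional μ ν.1 L hpos hfst hsnd
  have := hπ.1
  have hmk := hπ.isMarkovKernel_disint
  obtain ⟨φ, ψ, hφm, hφb, hψc, hψb, hle, hge⟩ := exists_dual_family hp hlsc hconv hw
  have hφ : ∀ n, IsBddMeas (φ n) := fun n => ⟨hφm n, hφb n⟩
  have hψ : ∀ n, IsBddCont (ψ n) := fun n => ⟨hψc n, hψb n⟩
  let κ := disint π
  let v : ℕ → X → ℝ := fun n x => φ n x - ∫ y, ψ n y ∂(κ x)
  have hv : ∀ n, Measurable (v n) := fun n =>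
    (hφm n).sub ((hψc n).measurable.stronglyMeasurable.integral_kernel (κ := κ)).measurable
  have hind : ∀ n (B : Set X), MeasurableSet B →
      L (fun z => B.indicator 1 z.1 * (φ n z.1 - ψ n z.2))
        = ∫ z, B.indicator 1 z.1 * (φ n z.1 - ψ n z.2) ∂π := by
    intro n B hB
    have h1 : IsBddMeas fun x => B.indicator 1 x * φ n x := (hφ n).indicator_mul hB
    have h2 : IsBddMeas fun x => B.indicator (1 : X → ℝ) x :=
      ⟨measurable_one.indicator hB, 1, fun z => by by_cases hz : z ∈ B <;> simp [hz]⟩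
    have h3 : (fun z : X × Rd d => B.indicator 1 z.1 * (φ n z.1 - ψ n z.2))
        = (fun z => B.indicator 1 z.1 * φ n z.1 * 1) - fun z => B.indicator 1 z.1 * ψ n z.2 := by
      ext z; simp only [Pi.sub_apply]; ring
    rw [h3, map_sub, hL _ _ h1 (isBddCont_const 1), hL _ _ h2 (hψ n)]
    refine (integral_sub ?_ ?_).symm
    · exact ((h1.comp measurable_fst).mul (isBddMeas_const 1)).integrable π
    · exact ((h2.comp measurable_fst).mul ((hψ n).isBddMeas.comp measurable_snd)).integrable π
  have key : ∀ n, ∃ F : X × Rd d → ℝ, IsBddMeas F ∧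
      (∀ x (ρ : Pp p d), ENNReal.ofReal (∫ y, F (x, y) ∂ρ.1) ≤ weightedCost C w x ρ.1) ∧
      (∀ B : Set X, MeasurableSet B →
        L (fun z => B.indicator 1 z.1 * F z) = ∫ z, B.indicator 1 z.1 * F z ∂π) ∧
      (∀ x, 0 ≤ ∫ y, F (x, y) ∂(κ x)) ∧ ∀ i < n, ∀ x, v i x ≤ ∫ y, F (x, y) ∂(κ x) := by
    intro n
    induction n with
    | zero =>
      refine ⟨fun _ => 0, isBddMeas_const 0, fun x ρ => by simp, fun B hB => ?_, fun x => by simp,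
        fun i hi => absurd hi (Nat.not_lt_zero i)⟩
      simp only [mul_zero, integral_zero]
      exact map_zero L
    | succ n ih =>
      obtain ⟨F, hF, hFc, hFL, hF0, hFv⟩ := ih
      let u : X → ℝ := fun x => ∫ y, F (x, y) ∂(κ x)
      have hu : Measurable u :=
        (hF.1.stronglyMeasurable.integral_kernel_prod_right' (κ := κ)).measurable
      let A : Set X := {x | u x < v n x}
      have hA : MeasurableSet A := measurableSet_lt hu (hv n)
      let G : X × Rd d → ℝ := fun z => φ n z.1 - ψ n z.2
      have hG : IsBddMeas G :=
        ((hφ n).comp measurable_fst).sub ((hψ n).isBddMeas.comp measurable_snd)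
      have hsec : ∀ (x : X) (ρ : Measure (Rd d)), IsProbabilityMeasure ρ →
          ∫ y, G (x, y) ∂ρ = φ n x - ∫ y, ψ n y ∂ρ := by
        intro x ρ hρ
        have h1 : ∫ y, (φ n x - ψ n y) ∂ρ = φ n x - ∫ y, ψ n y ∂ρ := by
          rw [integral_sub (integrable_const _) ((hψ n).isBddMeas.integrable _)]
          simp
        exact h1
      let F' : X × Rd d → ℝ := fun z => A.indicator 1 z.1 * G z + Aᶜ.indicator 1 z.1 * F z
      have hF'A : ∀ x ∈ A, ∀ y, F' (x, y) = G (x, y) := fun x hx y => by simp [F', hx]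
      have hF'C : ∀ x ∉ A, ∀ y, F' (x, y) = F (x, y) := fun x hx y => by simp [F', hx]
      refine ⟨F', ?_, fun x ρ => ?_, fun B hB => ?_, fun x => ?_, fun i hi x => ?_⟩
      · exact (hG.indicator_mul (measurable_fst hA)).add
          (hF.indicator_mul (measurable_fst hA.compl))
      · by_cases hx : x ∈ A
        · simp only [hF'A x hx]
          rw [hsec x ρ.1 ρ.2.1]
          exact hle n x ρ
        · simp only [hF'C x hx]
          exact hFc x ρ
      · have h1 : (fun z : X × Rd d => B.indicator 1 z.1 * F' z)
            = (fun z => (B ∩ A).indicator 1 z.1 * G z)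
              + fun z => (B ∩ Aᶜ).indicator 1 z.1 * F z := by
          ext z
          by_cases h1 : z.1 ∈ A <;> by_cases h2 : z.1 ∈ B <;> simp [F', h1, h2]
        rw [h1, map_add, hind n _ (hB.inter hA), hFL _ (hB.inter hA.compl)]
        exact (integral_add ((hG.indicator_mul (measurable_fst (hB.inter hA))).integrable π)
          ((hF.indicator_mul (measurable_fst (hB.inter hA.compl))).integrable π)).symm
      · by_cases hx : x ∈ A
        · simp only [hF'A x hx]
          rw [hsec x (κ x) inferInstance]
          exact (hF0 x).trans (le_of_lt hx)
        · simp only [hF'C x hx]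
          exact hF0 x
      · by_cases hx : x ∈ A
        · simp only [hF'A x hx]
          rw [hsec x (κ x) inferInstance]
          rcases Nat.lt_succ_iff_lt_or_eq.1 hi with h | rfl
          · exact (hFv i h x).trans (le_of_lt hx)
          · exact le_rfl
        · simp only [hF'C x hx]
          rcases Nat.lt_succ_iff_lt_or_eq.1 hi with h | rfl
          · exact hFv i h x
          · exact not_lt.1 hx
  have hfin : ∀ n, ∫⁻ x, ⨆ i ∈ Finset.range n, ENNReal.ofReal (v i x) ∂μ ≤ ENNReal.ofReal D := by
    intro n
    obtain ⟨F, hF, hFc, hFL, hF0, hFv⟩ := key n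
    have h1 : L F ≤ D := hLD F hF hFc
    have h2 : L F = ∫ x, ∫ y, F (x, y) ∂(κ x) ∂μ := by
      have := hFL univ MeasurableSet.univ
      simp only [indicator_univ, Pi.one_apply, one_mul] at this
      rw [← hπ.integral_disint hF, ← this]
    have h3 : Integrable (fun x => ∫ y, F (x, y) ∂(κ x)) μ := by
      obtain ⟨M, hM⟩ := hF.2
      refine IsBddMeas.integrable
        ⟨(hF.1.stronglyMeasurable.integral_kernel_prod_right' (κ := κ)).measurable, M,
          fun x => ?_⟩ μ
      have := norm_integral_le_of_norm_le_const (μ := κ x) (f := fun y => F (x, y)) (C := M)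
        (ae_of_all _ fun y => hM (x, y))
      simpa using this
    calc ∫⁻ x, ⨆ i ∈ Finset.range n, ENNReal.ofReal (v i x) ∂μ
        ≤ ∫⁻ x, ENNReal.ofReal (∫ y, F (x, y) ∂(κ x)) ∂μ := lintegral_mono fun x =>
          iSup₂_le fun i hi => ENNReal.ofReal_le_ofReal (hFv i (Finset.mem_range.1 hi) x)
      _ = ENNReal.ofReal (L F) := by
          rw [h2, ofReal_integral_eq_lintegral_ofReal h3 (ae_of_all _ hF0)]
      _ ≤ ENNReal.ofReal D := ENNReal.ofReal_le_ofReal h1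
  refine ⟨π, hπ, ?_⟩
  calc ∫⁻ x, weightedCost C w x (disint π x) ∂μ
      ≤ ∫⁻ x, ⨆ n, ⨆ i ∈ Finset.range n, ENNReal.ofReal (v i x) ∂μ := by
        refine lintegral_mono_ae ?_
        filter_upwards [hπ.ae_hasMomentP hp ν.2.2] with x hx
        refine (hge x ⟨κ x, inferInstance, hx⟩).trans (iSup_le fun n => ?_)
        exact le_iSup_of_le (n + 1) (le_iSup₂_of_le n (Finset.self_mem_range_succ n) le_rfl)
    _ = ⨆ n, ∫⁻ x, ⨆ i ∈ Finset.range n, ENNReal.ofReal (v i x) ∂μ := by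
        refine lintegral_iSup (fun n => ?_) fun m n hmn x => ?_
        · exact .biSup _ (Finset.countable_toSet _) fun i _ => (hv i).ennreal_ofReal
        · exact biSup_mono fun i hi => Finset.range_mono hmn hi
    _ ≤ ENNReal.ofReal D := iSup_le hfin

end StrongDuality

section ApproximateDual

theorem primal_add_le_of_coupling {X : Type*} [MeasurableSpace X] {d : ℕ}
    {C : X → Measure (Rd d) → ℝ≥0∞} {w : Rd d → ℝ} {μ : Measure X} {ν : Measure (Rd d)}
    {π : Measure (X × Rd d)} (hπ : IsCoupling π μ ν) (hwm : Measurable w)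
    (hw0 : ∀ y, 0 ≤ w y) (hwν : Integrable w ν) :
    primal μ ν C + ENNReal.ofReal (∫ y, w y ∂ν)
      ≤ ∫⁻ x, weightedCost C w x (disint π x) ∂μ := by
  unfold weightedCost
  rw [lintegral_add_right _ (hwm.ennreal_ofReal.lintegral_kernel),
    hπ.lintegral_disint hwm.ennreal_ofReal,
    ofReal_integral_eq_lintegral_ofReal hwν (ae_of_all _ hw0)]
  exact add_le_add_left (iInf_le (fun π : {π : Measure (X × Rd d) // IsCoupling π μ ν} =>
    ∫⁻ x, C x (disint π.1 x) ∂μ) ⟨π, hπ⟩) _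

variable {X : Type*} [TopologicalSpace X] [PolishSpace X] [MeasurableSpace X] [BorelSpace X]
  {d : ℕ} {p : ℝ} {C : X → Measure (Rd d) → ℝ≥0∞} {w : Rd d → ℝ}

/-- Dual potentials, continuous in the second variable, that are nearly optimal for the weak
transport problem. -/
theorem exists_approximate_dual (hp : 1 ≤ p) (μ : Measure X) [IsProbabilityMeasure μ] (ν : Pp p d)
    (hlsc : LowerSemicontinuous fun q : X × Pp p d => C q.1 q.2.1)
    (hconv : ∀ x : X, ∀ ρ₁ ρ₂ : Pp p d, ∀ t : ℝ≥0∞, t ≤ 1 →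
      C x (t • ρ₁.1 + (1 - t) • ρ₂.1) ≤ t * C x ρ₁.1 + (1 - t) * C x ρ₂.1)
    (hB : CondB p μ ν.1 C) (hw : IsWeight p w) (hwν : Integrable w ν.1) :
    primal μ ν.1 C ≠ ⊤ ∧ ∀ ε : ℝ, 0 < ε → ∃ (φ : X → ℝ) (ψ : Rd d → ℝ),
      IsBddMeas φ ∧ Continuous ψ ∧ (∀ ρ : Pp p d, Integrable w ρ.1 → Integrable ψ ρ.1) ∧
      (∀ x (ρ : Pp p d), Integrable w ρ.1 → C x ρ.1 ≠ ⊤ →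
        φ x ≤ ∫ y, ψ y ∂ρ.1 + (C x ρ.1).toReal) ∧
      (primal μ ν.1 C).toReal - ε ≤ ∫ x, φ x ∂μ - ∫ y, ψ y ∂ν.1 := by
  have := ν.2.1
  obtain ⟨a, ha, b, hb, hab⟩ := hB
  let c : X → Pp p d → ℝ≥0∞ := fun x ρ => weightedCost C w x ρ.1
  let S : Set ℝ := {v | ∃ φ ψ, IsDualPair c φ ψ ∧ v = ∫ x, φ x ∂μ - ∫ y, ψ y ∂ν.1}
  have hbound : ∀ x (ρ : Pp p d) (φ : X → ℝ) (ψ : Rd d → ℝ), IsDualPair c φ ψ → Integrable w ρ.1 →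
      C x ρ.1 ≠ ⊤ → φ x - ∫ y, ψ y ∂ρ.1 ≤ (C x ρ.1).toReal + ∫ y, w y ∂ρ.1 := by
    intro x ρ φ ψ h hwρ hCt
    have h1 := h.le x ρ
    have hw0 : 0 ≤ ∫ y, w y ∂ρ.1 := integral_nonneg hw.nonneg
    simp only [c, weightedCost] at h1
    rw [← ofReal_integral_eq_lintegral_ofReal hwρ (ae_of_all _ hw.nonneg),
      ← ENNReal.ofReal_toReal hCt, ← ENNReal.ofReal_add ENNReal.toReal_nonneg hw0] at h1
    exact (ENNReal.ofReal_le_ofReal_iff (add_nonneg ENNReal.toReal_nonneg hw0)).1 h1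
  have hCν : ∀ x, C x ν.1 ≠ ⊤ ∧ (C x ν.1).toReal ≤ a x + ∫ y, b y ∂ν.1 := by
    intro x
    have h1 := hab x ν
    rw [eInt_coe_of_integrable hb, ← EReal.coe_add] at h1
    have h2 : C x ν.1 ≠ ⊤ := fun h => by
      rw [h] at h1
      exact absurd h1 (not_le.2 (EReal.coe_lt_top _))
    refine ⟨h2, ?_⟩
    rw [← EReal.coe_ennreal_toReal h2] at h1
    exact EReal.coe_le_coe_iff.1 h1
  have hSb : BddAbove S := by
    refine ⟨∫ x, a x ∂μ + ∫ y, b y ∂ν.1 + ∫ y, w y ∂ν.1, ?_⟩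
    rintro v ⟨φ, ψ, h, rfl⟩
    have h1 : ∀ x, φ x ≤ a x + (∫ y, b y ∂ν.1 + ∫ y, w y ∂ν.1 + ∫ y, ψ y ∂ν.1) := fun x => by
      have := hbound x ν φ ψ h hwν (hCν x).1
      linarith [(hCν x).2]
    have h2 := integral_mono (h.left.integrable μ) (ha.add (integrable_const _)) h1
    simp only [Pi.add_apply] at h2
    rw [integral_add ha (integrable_const _)] at h2
    simp only [integral_const, probReal_univ, smul_eq_mul, one_mul] at h2
    linarith
  have h0S : (0 : ℝ) ∈ S := ⟨0, 0, ⟨isBddMeas_const 0, isBddCont_const 0, fun x ρ => by simp⟩,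
    by simp⟩
  have hD0 : 0 ≤ sSup S := le_csSup hSb h0S
  obtain ⟨π, hπ, hπD⟩ := exists_coupling_le hp μ ν hlsc hconv hw (D := sSup S)
    fun φ ψ h => le_csSup hSb ⟨φ, ψ, h, rfl⟩
  have hP := (primal_add_le_of_coupling (C := C) hπ hw.cont.measurable hw.nonneg hwν).trans hπD
  have hPt : primal μ ν.1 C ≠ ⊤ :=
    ((le_self_add.trans hP).trans_lt ENNReal.ofReal_lt_top).ne
  refine ⟨hPt, fun ε hε => ?_⟩
  have hw0 : 0 ≤ ∫ y, w y ∂ν.1 := integral_nonneg hw.nonneg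
  rw [← ENNReal.ofReal_toReal hPt, ← ENNReal.ofReal_add ENNReal.toReal_nonneg hw0,
    ENNReal.ofReal_le_ofReal_iff hD0] at hP
  obtain ⟨v, ⟨φ, ψ, h, rfl⟩, hv⟩ := exists_lt_of_lt_csSup ⟨0, h0S⟩ (sub_lt_self (sSup S) hε)
  have hψi : ∀ ρ : Pp p d, Integrable ψ ρ.1 := fun ρ => by
    have := ρ.2.1
    exact h.right.isBddMeas.integrable _
  refine ⟨φ, fun y => ψ y + w y, h.left, h.right.1.add hw.cont,
    fun ρ hwρ => (hψi ρ).add hwρ,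
    fun x ρ hwρ hCt => ?_, ?_⟩
  · have := hbound x ρ φ ψ h hwρ hCt
    rw [integral_add (hψi ρ) hwρ]
    linarith
  · rw [integral_add (hψi ν) hwν]
    linarith

end ApproximateDual

section ConvexCombinations

variable {Ω : Type*} [MeasurableSpace Ω] {P : Measure Ω}

theorem exists_ae_tendsto_of_cauchy [IsProbabilityMeasure P] {h : ℕ → Ω → ℝ} {δ : ℕ → ℝ}
    (hi : ∀ n, Integrable (h n) P) (hδ : Tendsto δ atTop (𝓝 0))
    (hsq : ∀ m n, m ≤ n → Integrable (fun y => (h m y - h n y) ^ 2) P ∧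
      ∫ y, (h m y - h n y) ^ 2 ∂P ≤ δ m) :
    ∃ (s : ℕ → ℕ) (f : Ω → ℝ), StrictMono s ∧
      ∀ᵐ y ∂P, Tendsto (fun k => h (s k) y) atTop (𝓝 (f y)) := by
  have hL1 : ∀ m n, m ≤ n → ∫ y, ‖h m y - h n y‖ ∂P ≤ √(δ m) := by
    intro m n hmn
    obtain ⟨h1, h2⟩ := hsq m n hmn
    refine Real.le_sqrt_of_sq_le (le_trans ?_ h2)
    have hi' : Integrable (fun y => ‖h m y - h n y‖) P := ((hi m).sub (hi n)).norm
    set A := ∫ y, ‖h m y - h n y‖ ∂P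
    have h3 : 0 ≤ ∫ y, (‖h m y - h n y‖ - A) ^ 2 ∂P := integral_nonneg fun y => sq_nonneg _
    have h4 : ∀ y, (‖h m y - h n y‖ - A) ^ 2
        = (h m y - h n y) ^ 2 - (2 * A) * ‖h m y - h n y‖ + A ^ 2 := fun y => by
      rw [sub_sq, Real.norm_eq_abs, sq_abs]; ring
    simp only [h4] at h3
    have i12 : Integrable (fun y => (h m y - h n y) ^ 2 - (2 * A) * ‖h m y - h n y‖) P :=
      h1.sub (hi'.const_mul _)
    rw [integral_add i12 (integrable_const _), integral_sub h1 (hi'.const_mul _), integral_const_mul] at h3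
    simp only [integral_const, probReal_univ, smul_eq_mul, one_mul] at h3
    nlinarith
  have hcau : CauchySeq fun n => (hi n).toL1 (h n) := by
    refine cauchySeq_of_le_tendsto_0' (fun m => √(δ m)) (fun m n hmn => ?_) ?_
    · rw [dist_eq_norm, ← Integrable.toL1_sub _ _ (hi m) (hi n), L1.norm_of_fun_eq_integral_norm]
      exact hL1 m n hmn
    · have h0 := (Real.continuous_sqrt.tendsto 0).comp hδ
      rwa [Real.sqrt_zero] at h0
  obtain ⟨f, hf⟩ := cauchySeq_tendsto_of_complete hcau
  obtain ⟨s, hs, hsf⟩ := (tendstoInMeasure_of_tendsto_Lp hf).exists_seq_tendsto_ae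
  refine ⟨s, f, hs, ?_⟩
  filter_upwards [hsf, ae_all_iff.2 fun n => (hi n).coeFn_toL1] with y hy1 hy2
  exact hy1.congr fun k => hy2 (s k)

theorem ae_not_tendsto_atTop [IsProbabilityMeasure P] {g : ℕ → Ω → ℝ} {K : ℝ}
    (hg : ∀ n, Integrable (g n) P) (hg0 : ∀ n y, 0 ≤ g n y) (hK : ∀ n, ∫ y, g n y ∂P ≤ K) :
    ∀ᵐ y ∂P, ¬ Tendsto (fun n => g n y) atTop atTop := by
  have h1 : ∫⁻ y, liminf (fun n => ENNReal.ofReal (g n y)) atTop ∂P ≤ ENNReal.ofReal K := by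
    refine (lintegral_liminf_le' fun n => (hg n).1.aemeasurable.ennreal_ofReal).trans ?_
    refine liminf_le_of_le (by isBoundedDefault) fun b hb => ?_
    obtain ⟨n, hn⟩ := hb.exists
    rw [← ofReal_integral_eq_lintegral_ofReal (hg n) (ae_of_all _ (hg0 n))] at hn
    exact hn.trans (ENNReal.ofReal_le_ofReal (hK n))
  have hm : AEMeasurable (fun y => liminf (fun n => ENNReal.ofReal (g n y)) atTop) P := by
    refine ⟨_, Measurable.liminf fun n => ((hg n).1.aemeasurable.ennreal_ofReal).measurable_mk, ?_⟩
    filter_upwards [ae_all_iff.2 fun n => ((hg n).1.aemeasurable.ennreal_ofReal).ae_eq_mk] with y hy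
    simp only [hy]
  filter_upwards [ae_lt_top' hm (h1.trans_lt ENNReal.ofReal_lt_top).ne] with y hy ht
  exact hy.ne (ENNReal.tendsto_ofReal_atTop.comp ht).liminf_eq

/-- From decreasing convex sets of nonnegative functions bounded in `L¹` one can select an almost
everywhere convergent sequence with finite limit. -/
theorem exists_ae_tendsto_of_convex [IsProbabilityMeasure P] {T : ℕ → Set (Ω → ℝ)} {K : ℝ}
    (hne : ∀ n, (T n).Nonempty) (hcv : ∀ n, Convex ℝ (T n)) (hanti : Antitone T)
    (hT : ∀ g ∈ T 0, Integrable g P ∧ (∀ y, 0 ≤ g y) ∧ ∫ y, g y ∂P ≤ K) :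
    ∃ (g : ℕ → Ω → ℝ) (f : Ω → ℝ), (∀ n, g n ∈ T n) ∧
      ∀ᵐ y ∂P, Tendsto (fun n => g n y) atTop (𝓝 (f y)) := by
  let I : (Ω → ℝ) → ℝ := fun g => ∫ y, Real.exp (-g y) ∂P
  have hexp : ∀ g ∈ T 0, ∀ c : ℝ, 0 ≤ c → Integrable (fun y => Real.exp (-(c * g y))) P := by
    intro g hg c hc
    refine Integrable.of_bound (Real.continuous_exp.comp_aestronglyMeasurable
      ((hT g hg).1.1.const_mul c).neg) 1 (ae_of_all _ fun y => ?_)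
    rw [Real.norm_of_nonneg (Real.exp_pos _).le]
    exact Real.exp_le_one_iff.2 (neg_nonpos.2 (mul_nonneg hc ((hT g hg).2.1 y)))
  have hexp1 : ∀ g ∈ T 0, Integrable (fun y => Real.exp (-g y)) P := fun g hg => by
    simpa using hexp g hg 1 zero_le_one
  have hT0 : ∀ n, T n ⊆ T 0 := fun n => hanti (Nat.zero_le n)
  let J : ℕ → ℝ := fun n => sInf (I '' T n)
  have hI0 : ∀ g, 0 ≤ I g := fun g => integral_nonneg fun y => (Real.exp_pos _).le
  have hbdd : ∀ n, BddBelow (I '' T n) := fun n => ⟨0, by rintro _ ⟨g, -, rfl⟩; exact hI0 g⟩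
  have hJmono : Monotone J := fun m n hmn =>
    csInf_le_csInf (hbdd m) ((hne n).image I) (image_mono (hanti hmn))
  have hJ1 : ∀ n, J n ≤ 1 := fun n => by
    obtain ⟨g, hg⟩ := hne n
    refine (csInf_le (hbdd n) ⟨g, hg, rfl⟩).trans ?_
    have h1 := integral_mono (hexp1 g (hT0 n hg)) (integrable_const (1 : ℝ)) fun y =>
      Real.exp_le_one_iff.2 (neg_nonpos.2 ((hT g (hT0 n hg)).2.1 y))
    simpa using h1
  have hJlim := tendsto_atTop_ciSup hJmono ⟨1, by rintro _ ⟨n, rfl⟩; exact hJ1 n⟩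
  set Js := ⨆ n, J n
  have hJle : ∀ n, J n ≤ Js := fun n => le_ciSup (f := J) ⟨1, by rintro _ ⟨n, rfl⟩; exact hJ1 n⟩ n
  have hsel : ∀ n : ℕ, ∃ g ∈ T n, I g < J n + 1 / (n + 1) := fun n => by
    obtain ⟨_, ⟨g, hg, rfl⟩, h⟩ := exists_lt_of_csInf_lt ((hne n).image I)
      (lt_add_of_pos_right (J n) (by positivity : (0 : ℝ) < 1 / (n + 1)))
    exact ⟨g, hg, h⟩
  choose g hgT hgI using hsel
  let h : ℕ → Ω → ℝ := fun n y => Real.exp (-((1 / 2) * g n y))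
  have hhi : ∀ n, Integrable (h n) P := fun n => hexp _ (hT0 n (hgT n)) _ (by norm_num)
  have hcau : ∀ m n, m ≤ n → Integrable (fun y => (h m y - h n y) ^ 2) P ∧
      ∫ y, (h m y - h n y) ^ 2 ∂P ≤ 2 * (Js - J m + 1 / (m + 1)) := by
    intro m n hmn
    let k : Ω → ℝ := (1 / 2 : ℝ) • g m + (1 / 2 : ℝ) • g n
    have hk : k ∈ T m := hcv m (hgT m) (hanti hmn (hgT n)) (by norm_num) (by norm_num)
      (by norm_num)
    have hpt : ∀ y, (h m y - h n y) ^ 2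
        = Real.exp (-g m y) + Real.exp (-g n y) - 2 * Real.exp (-k y) := by
      intro y
      have e1 : Real.exp (-g m y) = h m y ^ 2 := by
        simp only [h]; rw [sq, ← Real.exp_add]; congr 1; ring
      have e2 : Real.exp (-g n y) = h n y ^ 2 := by
        simp only [h]; rw [sq, ← Real.exp_add]; congr 1; ring
      have e3 : Real.exp (-k y) = h m y * h n y := by
        simp only [h, k, Pi.add_apply, Pi.smul_apply, smul_eq_mul]
        rw [← Real.exp_add]; congr 1; ring
      rw [e1, e2, e3]; ring
    have i1 := hexp1 _ (hT0 m (hgT m))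
    have i2 := hexp1 _ (hT0 n (hgT n))
    have i3 := hexp1 _ (hT0 m hk)
    simp only [hpt]
    refine ⟨(i1.add i2).sub (i3.const_mul 2), ?_⟩
    have i12 : Integrable (fun y => Real.exp (-g m y) + Real.exp (-g n y)) P := i1.add i2
    rw [integral_sub i12 (i3.const_mul 2), integral_add i1 i2, integral_const_mul]
    have h1 : J m ≤ I k := csInf_le (hbdd m) ⟨k, hk, rfl⟩
    have h2 := hgI m
    have h3 := hgI n
    have h4 : (1 : ℝ) / (n + 1) ≤ 1 / (m + 1) := by
      have : (m : ℝ) ≤ n := by exact_mod_cast hmn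
      gcongr
    have h5 := hJle n
    have h6 := hJle m
    simp only [I] at h1 h2 h3
    linarith
  have hδ : Tendsto (fun m : ℕ => 2 * (Js - J m + 1 / ((m : ℝ) + 1))) atTop (𝓝 0) := by
    have h1 := ((hJlim.const_sub Js).add tendsto_one_div_add_atTop_nhds_zero_nat).const_mul 2
    simpa using h1
  obtain ⟨s, f, hs, hf⟩ := exists_ae_tendsto_of_cauchy hhi hδ hcau
  refine ⟨fun k => g (s k), fun y => -2 * Real.log (f y),
    fun k => hanti (hs.id_le k) (hgT _), ?_⟩
  have hnt := ae_not_tendsto_atTop (P := P) (g := fun k => g (s k)) (K := K)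
    (fun k => (hT _ (hT0 _ (hgT _))).1) (fun k => (hT _ (hT0 _ (hgT _))).2.1)
    (fun k => (hT _ (hT0 _ (hgT _))).2.2)
  filter_upwards [hf, hnt] with y hy hy2
  have hgh : ∀ k, g (s k) y = -2 * Real.log (h (s k) y) := fun k => by
    simp only [h, Real.log_exp]; ring
  by_cases h0 : f y = 0
  · refine absurd ?_ hy2
    rw [h0] at hy
    have hy' : Tendsto (fun k => h (s k) y) atTop (𝓝[>] 0) :=
      tendsto_nhdsWithin_iff.2 ⟨hy, Eventually.of_forall fun k => Real.exp_pos _⟩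
    have := (Real.tendsto_log_nhdsGT_zero.comp hy').const_mul_atBot_of_neg
      (show (-2 : ℝ) < 0 by norm_num)
    exact this.congr fun k => (hgh k).symm
  · exact (((Real.continuousAt_log h0).tendsto.comp hy).const_mul (-2)).congr
      fun k => (hgh k).symm

end ConvexCombinations

section Potentials

/-- Dual potentials, continuous in the second variable, admissible on measures integrating the
weight `w` and normalised by `φ ≤ a` and `-b ≤ ψ`. -/
structure IsPotential {X : Type*} [MeasurableSpace X] {d : ℕ} (p : ℝ)
    (C : X → Measure (Rd d) → ℝ≥0∞) (w : Rd d → ℝ) (a : X → ℝ) (b : Rd d → ℝ)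
    (φ : X → ℝ) (ψ : Rd d → ℝ) : Prop where
  left : IsBddMeas φ
  cont : Continuous ψ
  integrable : ∀ ρ : Pp p d, Integrable w ρ.1 → Integrable ψ ρ.1
  le : ∀ x (ρ : Pp p d), Integrable w ρ.1 → C x ρ.1 ≠ ⊤ →
    φ x ≤ ∫ y, ψ y ∂ρ.1 + (C x ρ.1).toReal
  left_le : ∀ x, φ x ≤ a x
  le_right : ∀ y, -b y ≤ ψ y

variable {X : Type*} [MeasurableSpace X] {d : ℕ} {p : ℝ}
  {C : X → Measure (Rd d) → ℝ≥0∞} {w : Rd d → ℝ} {a : X → ℝ} {b : Rd d → ℝ}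

theorem IsPotential.convexCombination {φ₁ φ₂ : X → ℝ} {ψ₁ ψ₂ : Rd d → ℝ}
    (h₁ : IsPotential p C w a b φ₁ ψ₁) (h₂ : IsPotential p C w a b φ₂ ψ₂) {s t : ℝ}
    (hs : 0 ≤ s) (ht : 0 ≤ t) (hst : s + t = 1) :
    IsPotential p C w a b (fun x => s * φ₁ x + t * φ₂ x) (fun y => s * ψ₁ y + t * ψ₂ y) where
  left := (h₁.left.smul s).add (h₂.left.smul t)
  cont := (h₁.cont.const_mul s).add (h₂.cont.const_mul t)
  integrable ρ hρ := ((h₁.integrable ρ hρ).const_mul s).add ((h₂.integrable ρ hρ).const_mul t)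
  le x ρ hρ hC := by
    rw [integral_add ((h₁.integrable ρ hρ).const_mul s) ((h₂.integrable ρ hρ).const_mul t),
      integral_const_mul, integral_const_mul]
    have e1 := mul_le_mul_of_nonneg_left (h₁.le x ρ hρ hC) hs
    have e2 := mul_le_mul_of_nonneg_left (h₂.le x ρ hρ hC) ht
    have e3 : (C x ρ.1).toReal = s * (C x ρ.1).toReal + t * (C x ρ.1).toReal := by
      rw [← add_mul, hst, one_mul]
    linarith
  left_le x := by
    have e1 := mul_le_mul_of_nonneg_left (h₁.left_le x) hs
    have e2 := mul_le_mul_of_nonneg_left (h₂.left_le x) ht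
    have e3 : a x = s * a x + t * a x := by rw [← add_mul, hst, one_mul]
    linarith
  le_right y := by
    have e1 := mul_le_mul_of_nonneg_left (h₁.le_right y) hs
    have e2 := mul_le_mul_of_nonneg_left (h₂.le_right y) ht
    have e3 : b y = s * b y + t * b y := by rw [← add_mul, hst, one_mul]
    linarith

/-- The Dirac mass as an element of `P_p`. -/
noncomputable def ppDirac (p : ℝ) {d : ℕ} (y : Rd d) : Pp p d :=
  ⟨Measure.dirac y, inferInstance, by
    rw [HasMomentP, lintegral_dirac]
    exact ENNReal.ofReal_ne_top⟩

theorem integrable_dirac_of_measurable {f : Rd d → ℝ} (y : Rd d) :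
    Integrable f (Measure.dirac y) :=
  integrable_dirac (by simp)

end Potentials

section Limit

theorem cost_dirac_le {X : Type*} {d : ℕ} {p : ℝ} {C : X → Measure (Rd d) → ℝ≥0∞} {a : X → ℝ}
    {b : Rd d → ℝ}
    (hab : ∀ x : X, ∀ ρ : Pp p d,
      ((C x ρ.1 : ℝ≥0∞) : EReal) ≤ (a x : EReal) + eInt ρ.1 (fun y => (b y : EReal)))
    (x : X) (y : Rd d) :
    C x (Measure.dirac y) ≠ ⊤ ∧ (C x (Measure.dirac y)).toReal ≤ a x + b y := by
  have h1 := hab x (ppDirac p y)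
  simp only [ppDirac] at h1
  rw [eInt_coe_of_integrable (integrable_dirac_of_measurable y), integral_dirac,
    ← EReal.coe_add] at h1
  have h2 : C x (Measure.dirac y) ≠ ⊤ := fun h => by
    rw [h] at h1
    exact absurd h1 (not_le.2 (EReal.coe_lt_top _))
  refine ⟨h2, ?_⟩
  rw [← EReal.coe_ennreal_toReal h2] at h1
  exact EReal.coe_le_coe_iff.1 h1

variable {X : Type*} [TopologicalSpace X] [PolishSpace X] [MeasurableSpace X] [BorelSpace X]
  {d : ℕ} {p : ℝ} {C : X → Measure (Rd d) → ℝ≥0∞} {w : Rd d → ℝ} {a : X → ℝ} {b : Rd d → ℝ}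

/-- Normalised nearly optimal dual potentials. -/
theorem exists_approximate_potential (hp : 1 ≤ p) (μ : Measure X) [IsProbabilityMeasure μ]
    (ν : Pp p d)
    (hlsc : LowerSemicontinuous fun q : X × Pp p d => C q.1 q.2.1)
    (hconv : ∀ x : X, ∀ ρ₁ ρ₂ : Pp p d, ∀ t : ℝ≥0∞, t ≤ 1 →
      C x (t • ρ₁.1 + (1 - t) • ρ₂.1) ≤ t * C x ρ₁.1 + (1 - t) * C x ρ₂.1)
    (ha : Integrable a μ) (hb : Integrable b ν.1)
    (hab : ∀ x : X, ∀ ρ : Pp p d,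
      ((C x ρ.1 : ℝ≥0∞) : EReal) ≤ (a x : EReal) + eInt ρ.1 (fun y => (b y : EReal)))
    (hw : IsWeight p w) (hwν : Integrable w ν.1) :
    primal μ ν.1 C ≠ ⊤ ∧ ∀ ε : ℝ, 0 < ε → ∃ (φ : X → ℝ) (ψ : Rd d → ℝ),
      IsPotential p C w a b φ ψ ∧
      (primal μ ν.1 C).toReal - ε ≤ ∫ x, φ x ∂μ - ∫ y, ψ y ∂ν.1 := by
  have := ν.2.1
  obtain ⟨hP, H⟩ := exists_approximate_dual hp μ ν hlsc hconv ⟨a, ha, b, hb, hab⟩ hw hwν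
  refine ⟨hP, fun ε hε => ?_⟩
  obtain ⟨φ, ψ, hφ, hψ, hψi, hle, hval⟩ := H ε hε
  have hX : Nonempty X := nonempty_of_isProbabilityMeasure μ
  have hxy : ∀ x y, φ x - a x ≤ ψ y + b y := fun x y => by
    obtain ⟨h1, h2⟩ := cost_dirac_le hab x y
    have h3 := hle x (ppDirac p y) (integrable_dirac_of_measurable y) h1
    simp only [ppDirac, integral_dirac] at h3
    linarith
  set s := ⨆ x, (φ x - a x)
  have hs1 : ∀ x, φ x - a x ≤ s := fun x =>
    le_ciSup (f := fun x => φ x - a x) ⟨ψ 0 + b 0, by rintro _ ⟨x, rfl⟩; exact hxy x 0⟩ x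
  have hs2 : ∀ y, s ≤ ψ y + b y := fun y => ciSup_le fun x => hxy x y
  have hint : ∀ ρ : Pp p d, Integrable w ρ.1 → ∫ y, (ψ y - s) ∂ρ.1 = ∫ y, ψ y ∂ρ.1 - s := by
    intro ρ hρ
    have := ρ.2.1
    rw [integral_sub (hψi ρ hρ) (integrable_const _)]
    simp
  refine ⟨fun x => φ x - s, fun y => ψ y - s, ⟨hφ.sub (isBddMeas_const s), hψ.sub continuous_const,
    fun ρ hρ => ?_, fun x ρ hρ hC => ?_, fun x => by linarith [hs1 x], fun y => by
      linarith [hs2 y]⟩, ?_⟩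
  · have := ρ.2.1
    exact (hψi ρ hρ).sub (integrable_const _)
  · rw [hint ρ hρ]
    linarith [hle x ρ hρ hC]
  · rw [hint ν hwν, integral_sub (hφ.integrable μ) (integrable_const _)]
    simp only [integral_const, probReal_univ, smul_eq_mul, one_mul]
    linarith

/-- Nearly optimal potentials can be chosen so that those in the second variable converge almost
everywhere. -/
theorem exists_convergent_potentials (hp : 1 ≤ p) (μ : Measure X) [IsProbabilityMeasure μ]
    (ν : Pp p d)
    (hlsc : LowerSemicontinuous fun q : X × Pp p d => C q.1 q.2.1)
    (hconv : ∀ x : X, ∀ ρ₁ ρ₂ : Pp p d, ∀ t : ℝ≥0∞, t ≤ 1 →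
      C x (t • ρ₁.1 + (1 - t) • ρ₂.1) ≤ t * C x ρ₁.1 + (1 - t) * C x ρ₂.1)
    (ha : Integrable a μ) (hb : Integrable b ν.1)
    (hab : ∀ x : X, ∀ ρ : Pp p d,
      ((C x ρ.1 : ℝ≥0∞) : EReal) ≤ (a x : EReal) + eInt ρ.1 (fun y => (b y : EReal)))
    (hw : IsWeight p w) (hwν : Integrable w ν.1) :
    primal μ ν.1 C ≠ ⊤ ∧ ∃ (φ : ℕ → X → ℝ) (ψ : ℕ → Rd d → ℝ) (ψ₀ : Rd d → ℝ),
      (∀ n, IsPotential p C w a b (φ n) (ψ n)) ∧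
      (∀ n : ℕ, (primal μ ν.1 C).toReal - 1 / ((n : ℝ) + 1)
        ≤ ∫ x, φ n x ∂μ - ∫ y, ψ n y ∂ν.1) ∧
      ∀ᵐ y ∂ν.1, Tendsto (fun n => ψ n y) atTop (𝓝 (ψ₀ y)) := by
  have := ν.2.1
  obtain ⟨hP, H⟩ := exists_approximate_potential hp μ ν hlsc hconv ha hb hab hw hwν
  refine ⟨hP, ?_⟩
  set V := (primal μ ν.1 C).toReal
  let T : ℕ → Set (Rd d → ℝ) := fun n => {g | ∃ (φ : X → ℝ) (ψ : Rd d → ℝ),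
    IsPotential p C w a b φ ψ ∧ V - 1 / ((n : ℝ) + 1) ≤ ∫ x, φ x ∂μ - ∫ y, ψ y ∂ν.1 ∧
    g = fun y => ψ y + b y}
  have hne : ∀ n, (T n).Nonempty := fun n => by
    obtain ⟨φ, ψ, h, hv⟩ := H (1 / ((n : ℝ) + 1)) (by positivity)
    exact ⟨_, φ, ψ, h, hv, rfl⟩
  have hcv : ∀ n, Convex ℝ (T n) := by
    rintro n _ ⟨φ₁, ψ₁, h₁, v₁, rfl⟩ _ ⟨φ₂, ψ₂, h₂, v₂, rfl⟩ s t hs ht hst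
    refine ⟨_, _, h₁.convexCombination h₂ hs ht hst, ?_, ?_⟩
    · rw [integral_add ((h₁.left.integrable μ).const_mul s) ((h₂.left.integrable μ).const_mul t),
        integral_add ((h₁.integrable ν hwν).const_mul s) ((h₂.integrable ν hwν).const_mul t)]
      simp only [integral_const_mul]
      have e1 := mul_le_mul_of_nonneg_left v₁ hs
      have e2 := mul_le_mul_of_nonneg_left v₂ ht
      have e3 : V - 1 / ((n : ℝ) + 1)
          = s * (V - 1 / ((n : ℝ) + 1)) + t * (V - 1 / ((n : ℝ) + 1)) := by
        rw [← add_mul, hst, one_mul]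
      linarith
    · funext y
      have e3 : b y = s * b y + t * b y := by rw [← add_mul, hst, one_mul]
      simp only [Pi.add_apply, Pi.smul_apply, smul_eq_mul]
      linarith
  have hanti : Antitone T := by
    rintro m n hmn g ⟨φ, ψ, h, v, rfl⟩
    refine ⟨φ, ψ, h, le_trans ?_ v, rfl⟩
    have : (m : ℝ) ≤ n := by exact_mod_cast hmn
    gcongr
  have hT : ∀ g ∈ T 0, Integrable g ν.1 ∧ (∀ y, 0 ≤ g y) ∧
      ∫ y, g y ∂ν.1 ≤ ∫ x, a x ∂μ - V + 1 + ∫ y, b y ∂ν.1 := by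
    rintro _ ⟨φ, ψ, h, v, rfl⟩
    refine ⟨(h.integrable ν hwν).add hb, fun y => by linarith [h.le_right y], ?_⟩
    rw [integral_add (h.integrable ν hwν) hb]
    have := integral_mono (h.left.integrable μ) ha h.left_le
    norm_num at v
    linarith
  obtain ⟨g, f, hg, hgf⟩ := exists_ae_tendsto_of_convex hne hcv hanti hT
  choose φ ψ h v e using hg
  refine ⟨φ, ψ, fun y => f y - b y, h, v, ?_⟩
  filter_upwards [hgf] with y hy
  refine (hy.sub_const (b y)).congr fun n => ?_
  rw [e n]
  ring

end Limit

section Exhaustion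

variable {E : Type*} [TopologicalSpace E] [PolishSpace E] [MeasurableSpace E] [BorelSpace E]
  {ν : Measure E} [IsProbabilityMeasure ν]

theorem exists_compact_uniform {ψ : ℕ → E → ℝ} {ψ₀ b : E → ℝ} (hψ : ∀ n, Continuous (ψ n))
    (hψ₀ : StronglyMeasurable ψ₀) (hb : AEMeasurable b ν)
    (hlim : ∀ᵐ y ∂ν, Tendsto (fun n => ψ n y) atTop (𝓝 (ψ₀ y))) {ε : ℝ} (hε : 0 < ε) :
    ∃ K : Set E, IsCompact K ∧ TendstoUniformlyOn ψ ψ₀ atTop K ∧ (∃ M : ℝ, ∀ y ∈ K, |b y| ≤ M) ∧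
      ν Kᶜ ≤ ENNReal.ofReal ε := by
  have hε3 : 0 < ε / 3 := by positivity
  have hε3' : 0 < ENNReal.ofReal (ε / 3) := ENNReal.ofReal_pos.2 hε3
  obtain ⟨t, htm, ht, htu⟩ := tendstoUniformlyOn_of_ae_tendsto'
    (fun n => (hψ n).stronglyMeasurable) hψ₀ hlim hε3
  have hN : Tendsto (fun n : ℕ => ν {y | (n : ℝ) < |hb.mk b y|}) atTop (𝓝 0) := by
    have h1 : (⋂ n : ℕ, {y | (n : ℝ) < |hb.mk b y|}) = ∅ := by
      refine eq_empty_of_forall_notMem fun y hy => ?_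
      obtain ⟨n, hn⟩ := exists_nat_ge |hb.mk b y|
      exact absurd (mem_iInter.1 hy n) (not_lt.2 hn)
    rw [← measure_empty (μ := ν), ← h1]
    refine tendsto_measure_iInter_atTop (fun n => (measurableSet_lt measurable_const
      hb.measurable_mk.abs).nullMeasurableSet) (fun m n hmn y hy => ?_) ⟨0, measure_ne_top _ _⟩
    have : (m : ℝ) ≤ n := by exact_mod_cast hmn
    exact this.trans_lt hy
  obtain ⟨N, hN⟩ := (hN.eventually_lt_const hε3').exists
  let Z : Set E := toMeasurable ν {y | b y ≠ hb.mk b y}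
  have hZ : ν Z = 0 := by
    rw [measure_toMeasurable]
    exact hb.ae_eq_mk
  let B : Set E := t ∪ {y | (N : ℝ) < |hb.mk b y|} ∪ Z
  have hBm : MeasurableSet B := (htm.union (measurableSet_lt measurable_const
    hb.measurable_mk.abs)).union (measurableSet_toMeasurable _ _)
  have hB : ν B ≤ ENNReal.ofReal (ε / 3) + ENNReal.ofReal (ε / 3) := by
    refine (measure_union_le _ _).trans ?_
    rw [hZ, add_zero]
    exact (measure_union_le _ _).trans (add_le_add ht hN.le)
  obtain ⟨K, hKB, hK, hKν⟩ := hBm.compl.exists_isCompact_sdiff_lt (measure_ne_top ν _) hε3'.ne'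
  refine ⟨K, hK, htu.mono fun y hy hyt => hKB hy (Or.inl (Or.inl hyt)), ⟨N, fun y hy => ?_⟩, ?_⟩
  · have h1 : b y = hb.mk b y := by
      by_contra h
      exact hKB hy (Or.inr (subset_toMeasurable _ _ h))
    rw [h1]
    by_contra! h
    exact hKB hy (Or.inl (Or.inr h))
  · have h1 : Kᶜ ⊆ B ∪ (Bᶜ \ K) := fun y hy => by
      by_cases h : y ∈ B
      · exact Or.inl h
      · exact Or.inr ⟨h, hy⟩
    calc ν Kᶜ ≤ ν B + ν (Bᶜ \ K) := (measure_mono h1).trans (measure_union_le _ _)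
      _ ≤ ENNReal.ofReal (ε / 3) + ENNReal.ofReal (ε / 3) + ENNReal.ofReal (ε / 3) :=
        add_le_add hB hKν.le
      _ = ENNReal.ofReal ε := by
        rw [← ENNReal.ofReal_add hε3.le hε3.le, ← ENNReal.ofReal_add (by positivity) hε3.le]
        congr 1; ring

/-- An almost everywhere convergent sequence of continuous functions converges uniformly on an
increasing sequence of compact sets of full measure. -/
theorem exists_compact_exhaustion {ψ : ℕ → E → ℝ} {ψ₀ b : E → ℝ} (hψ : ∀ n, Continuous (ψ n))
    (hψ₀ : StronglyMeasurable ψ₀) (hb : AEMeasurable b ν)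
    (hlim : ∀ᵐ y ∂ν, Tendsto (fun n => ψ n y) atTop (𝓝 (ψ₀ y))) :
    ∃ K : ℕ → Set E, Monotone K ∧ (∀ m, IsCompact (K m)) ∧
      (∀ m, TendstoUniformlyOn ψ ψ₀ atTop (K m)) ∧ (∀ m, ∃ M : ℝ, ∀ y ∈ K m, |b y| ≤ M) ∧
      ν (⋃ m, K m)ᶜ = 0 := by
  choose L hL hLu hLb hLν using fun n : ℕ => exists_compact_uniform hψ hψ₀ hb hlim
    (show 0 < 1 / ((n : ℝ) + 1) by positivity)
  have hind : ∀ m, IsCompact (partialSups L m) ∧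
      TendstoUniformlyOn ψ ψ₀ atTop (partialSups L m) ∧
      ∃ M : ℝ, ∀ y ∈ partialSups L m, |b y| ≤ M := by
    intro m
    induction m with
    | zero => exact ⟨by simpa using hL 0, by simpa using hLu 0, by simpa using hLb 0⟩
    | succ m ih =>
      obtain ⟨h1, h2, M, hM⟩ := ih
      obtain ⟨M', hM'⟩ := hLb (m + 1)
      rw [partialSups_add_one]
      refine ⟨h1.union (hL _), fun u hu => ?_, max M M', ?_⟩
      · filter_upwards [h2 u hu, hLu (m + 1) u hu] with n e1 e2 y hy
        exact hy.elim (e1 y) (e2 y)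
      · rintro y (hy | hy)
        · exact (hM y hy).trans (le_max_left _ _)
        · exact (hM' y hy).trans (le_max_right _ _)
  refine ⟨partialSups L, (partialSups L).monotone, fun m => (hind m).1, fun m => (hind m).2.1,
    fun m => (hind m).2.2, ?_⟩
  have hle : ∀ n : ℕ, ν (⋃ m, partialSups L m)ᶜ ≤ ENNReal.ofReal (1 / ((n : ℝ) + 1)) := fun n =>
    (measure_mono (compl_subset_compl.2 ((le_partialSups L n).trans
      (subset_iUnion (fun m => partialSups L m) n)))).trans (hLν n)
  have hlim0 : Tendsto (fun n : ℕ => ENNReal.ofReal (1 / ((n : ℝ) + 1))) atTop (𝓝 0) := by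
    have := ENNReal.tendsto_ofReal (tendsto_one_div_add_atTop_nhds_zero_nat (𝕜 := ℝ))
    rwa [ENNReal.ofReal_zero] at this
  exact le_antisymm (ge_of_tendsto' hlim0 hle) zero_le

end Exhaustion

section Supported

theorem ae_mem_of_supported {E : Type*} [MeasurableSpace E] {ρ : Measure E} {K : Set E} (h : ρ Kᶜ = 0) : ∀ᵐ y ∂ρ, y ∈ K := by
  rw [ae_iff]
  exact h

/-- A continuous function on a compact set extends to a bounded continuous function. -/
theorem exists_isBddCont_extension {E : Type*} [TopologicalSpace E] [NormalSpace E] [T2Space E]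
    {K : Set E} (hK : IsCompact K) {f : E → ℝ} (hf : ContinuousOn f K) : ∃ G : E → ℝ, IsBddCont G ∧ EqOn G f K := by
  obtain ⟨M, hM⟩ := hK.exists_bound_of_continuousOn hf
  obtain ⟨g, hg⟩ := ContinuousMap.exists_restrict_eq hK.isClosed ⟨K.domRestrict f, hf.domRestrict⟩
  refine ⟨fun y => max (-M) (min M (g y)), ⟨by fun_prop, |M|, fun y => ?_⟩, fun y hy => ?_⟩
  · rw [abs_le]
    exact ⟨(neg_le_neg (le_abs_self M)).trans (le_max_left _ _),
      max_le (neg_le_abs M) ((min_le_left _ _).trans (le_abs_self M))⟩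
  · have h1 : g y = f y := congrArg (fun h : C(K, ℝ) => h ⟨y, hy⟩) hg
    have h2 := abs_le.1 (hM y hy)
    simp only [h1]
    rw [min_eq_right h2.2, max_eq_right h2.1]

end Supported

section LimitPotential

theorem ENNReal.add_le_of_le_liminf {u v : ℕ → ℝ≥0∞} {A B c : ℝ≥0∞} {e : ℕ → ℝ≥0∞}
    (hA : A ≤ liminf u atTop) (hB : B ≤ liminf v atTop) (he : Tendsto e atTop (𝓝 c))
    (h : ∀ n, u n + v n ≤ e n) : A + B ≤ c := by
  refine (add_le_add hA hB).trans ?_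
  rw [liminf_eq_iSup_iInf_of_nat, liminf_eq_iSup_iInf_of_nat, ENNReal.iSup_add_iSup_of_monotone]
  · refine iSup_le fun n => ge_of_tendsto he ?_
    filter_upwards [eventually_ge_atTop n] with m hm
    exact (add_le_add (iInf₂_le m hm) (iInf₂_le m hm)).trans (h m)
  · exact fun m n hmn => le_iInf₂ fun i hi => iInf₂_le i (hmn.trans hi)
  · exact fun m n hmn => le_iInf₂ fun i hi => iInf₂_le i (hmn.trans hi)

theorem exists_integrable_limit {E : Type*} [MeasurableSpace E] {ν : Measure E}
    {ψ : ℕ → E → ℝ} {ψ₀ b : E → ℝ} (hψ : ∀ n, Integrable (ψ n) ν) (hb : Integrable b ν)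
    (hle : ∀ n y, -b y ≤ ψ n y)
    (hlim : ∀ᵐ y ∂ν, Tendsto (fun n => ψ n y) atTop (𝓝 (ψ₀ y))) :
    (∀ᵐ y ∂ν, -b y ≤ ψ₀ y) ∧ AEStronglyMeasurable ψ₀ ν ∧
      ∫⁻ y, ENNReal.ofReal (ψ₀ y + b y) ∂ν
        ≤ liminf (fun n => ENNReal.ofReal (∫ y, ψ n y ∂ν + ∫ y, b y ∂ν)) atTop := by
  refine ⟨?_, aestronglyMeasurable_of_tendsto_ae _ (fun n => (hψ n).1) hlim, ?_⟩
  · filter_upwards [hlim] with y hy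
    exact ge_of_tendsto' hy fun n => hle n y
  · have h1 : ∀ n, ENNReal.ofReal (∫ y, ψ n y ∂ν + ∫ y, b y ∂ν)
        = ∫⁻ y, ENNReal.ofReal (ψ n y + b y) ∂ν := fun n => by
      rw [← integral_add (hψ n) hb]
      exact ofReal_integral_eq_lintegral_ofReal ((hψ n).add hb)
        (ae_of_all _ fun y => by simp only [Pi.zero_apply]; linarith [hle n y])
    simp only [h1]
    refine le_trans (lintegral_mono_ae ?_)
      (lintegral_liminf_le' fun n => ((hψ n).add hb).1.aemeasurable.ennreal_ofReal)
    filter_upwards [hlim] with y hy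
    exact (ENNReal.tendsto_ofReal (hy.add_const (b y))).liminf_eq.ge

/-- The limit of a maximising sequence of dual potentials. The function `D` bounds the gap between
`a` and the limit superior of the first potentials. -/
structure IsLimitPotential {X : Type*} [MeasurableSpace X] {d : ℕ} (p : ℝ)
    (μ : Measure X) (ν : Measure (Rd d)) (C : X → Measure (Rd d) → ℝ≥0∞) (a : X → ℝ)
    (b : Rd d → ℝ) (K : ℕ → Set (Rd d)) (ψ₀ : Rd d → ℝ) (D : X → ℝ≥0∞) : Prop where
  mono : Monotone K
  compact : ∀ m, IsCompact (K m)
  null : ν (⋃ m, K m)ᶜ = 0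
  bdd : ∀ m, ∃ M : ℝ, ∀ y ∈ K m, |b y| ≤ M
  cont : ∀ m, ContinuousOn ψ₀ (K m)
  integrable : Integrable ψ₀ ν
  aemeasurable : AEMeasurable D μ
  finite : ∫⁻ x, D x ∂μ ≠ ⊤
  value : (primal μ ν C).toReal ≤ ∫ x, a x ∂μ - ∫ y, ψ₀ y ∂ν - (∫⁻ x, D x ∂μ).toReal
  le : ∀ m x (ρ : Pp p d), ρ.1 (K m)ᶜ = 0 → C x ρ.1 ≠ ⊤ →
    ENNReal.ofReal (a x - ∫ y, ψ₀ y ∂ρ.1 - (C x ρ.1).toReal) ≤ D x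

variable {X : Type*} [TopologicalSpace X] [PolishSpace X] [MeasurableSpace X] [BorelSpace X]
  {d : ℕ} {p : ℝ} {C : X → Measure (Rd d) → ℝ≥0∞} {w : Rd d → ℝ} {a : X → ℝ} {b : Rd d → ℝ}

theorem exists_isLimitPotential (hp : 1 ≤ p) (μ : Measure X) [IsProbabilityMeasure μ]
    (ν : Pp p d)
    (hlsc : LowerSemicontinuous fun q : X × Pp p d => C q.1 q.2.1)
    (hconv : ∀ x : X, ∀ ρ₁ ρ₂ : Pp p d, ∀ t : ℝ≥0∞, t ≤ 1 →
      C x (t • ρ₁.1 + (1 - t) • ρ₂.1) ≤ t * C x ρ₁.1 + (1 - t) * C x ρ₂.1)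
    (ha : Integrable a μ) (hb : Integrable b ν.1)
    (hab : ∀ x : X, ∀ ρ : Pp p d,
      ((C x ρ.1 : ℝ≥0∞) : EReal) ≤ (a x : EReal) + eInt ρ.1 (fun y => (b y : EReal)))
    (hw : IsWeight p w) (hwν : Integrable w ν.1) :
    primal μ ν.1 C ≠ ⊤ ∧ ∃ K ψ₀ D, IsLimitPotential p μ ν.1 C a b K ψ₀ D := by
  have := ν.2.1
  obtain ⟨hP, φ, ψ, ψ₁, h, hv, hlim₁⟩ :=
    exists_convergent_potentials hp μ ν hlsc hconv ha hb hab hw hwν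
  refine ⟨hP, ?_⟩
  have hψi : ∀ n, Integrable (ψ n) ν.1 := fun n => (h n).integrable ν hwν
  have hm₁ := (exists_integrable_limit hψi hb (fun n => (h n).le_right) hlim₁).2.1
  obtain ⟨ψ₀, hψ₀, he⟩ := hm₁
  have hlim : ∀ᵐ y ∂ν.1, Tendsto (fun n => ψ n y) atTop (𝓝 (ψ₀ y)) := by
    filter_upwards [hlim₁, he] with y h1 h2
    rwa [← h2]
  obtain ⟨K, hKm, hKc, hKu, hKb, hKn⟩ :=
    exists_compact_exhaustion (fun n => (h n).cont) hψ₀ hb.1.aemeasurable hlim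
  obtain ⟨hge, -, hB⟩ := exists_integrable_limit hψi hb (fun n => (h n).le_right) hlim
  let D : X → ℝ≥0∞ := fun x => liminf (fun n => ENNReal.ofReal (a x - φ n x)) atTop
  have hφi : ∀ n, Integrable (φ n) μ := fun n => (h n).left.integrable μ
  have hDm : AEMeasurable D μ := by
    obtain ⟨a', ha', haa⟩ := ha.1.aemeasurable
    refine ⟨fun x => liminf (fun n => ENNReal.ofReal (a' x - φ n x)) atTop,
      Measurable.liminf fun n => (ha'.sub (h n).left.1).ennreal_ofReal, ?_⟩
    filter_upwards [haa] with x hx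
    simp only [D, hx]
  have hA : ∫⁻ x, D x ∂μ
      ≤ liminf (fun n => ENNReal.ofReal (∫ x, a x ∂μ - ∫ x, φ n x ∂μ)) atTop := by
    have h1 : ∀ n, ENNReal.ofReal (∫ x, a x ∂μ - ∫ x, φ n x ∂μ)
        = ∫⁻ x, ENNReal.ofReal (a x - φ n x) ∂μ := fun n => by
      rw [← integral_sub ha (hφi n)]
      exact ofReal_integral_eq_lintegral_ofReal (ha.sub (hφi n))
        (ae_of_all _ fun x => by
          simp only [Pi.zero_apply]; linarith [(h n).left_le x])
    simp only [h1]
    exact lintegral_liminf_le' fun n => (ha.sub (hφi n)).1.aemeasurable.ennreal_ofReal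
  set V := (primal μ ν.1 C).toReal
  have hAB : ∫⁻ x, D x ∂μ + ∫⁻ y, ENNReal.ofReal (ψ₀ y + b y) ∂ν.1
      ≤ ENNReal.ofReal (∫ x, a x ∂μ + ∫ y, b y ∂ν.1 - V) := by
    refine ENNReal.add_le_of_le_liminf hA hB
      (e := fun n : ℕ => ENNReal.ofReal (∫ x, a x ∂μ + ∫ y, b y ∂ν.1 - V + 1 / ((n : ℝ) + 1)))
      ?_ fun n => ?_
    · refine ENNReal.tendsto_ofReal ?_
      have := (tendsto_one_div_add_atTop_nhds_zero_nat (𝕜 := ℝ)).const_add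
        (∫ x, a x ∂μ + ∫ y, b y ∂ν.1 - V)
      rwa [add_zero] at this
    · have h1 := integral_mono (hφi n) ha (h n).left_le
      have h2 : ∫ y, -b y ∂ν.1 ≤ ∫ y, ψ n y ∂ν.1 :=
        integral_mono hb.neg (hψi n) (h n).le_right
      rw [integral_neg] at h2
      rw [← ENNReal.ofReal_add (by linarith) (by linarith)]
      exact ENNReal.ofReal_le_ofReal (by linarith [hv n])
  have hDf : ∫⁻ x, D x ∂μ ≠ ⊤ := ((le_self_add.trans hAB).trans_lt ENNReal.ofReal_lt_top).ne
  have hge0 : 0 ≤ᵐ[ν.1] fun y => ψ₀ y + b y := by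
    filter_upwards [hge] with y hy
    simp only [Pi.zero_apply]
    linarith
  have hψb : Integrable (fun y => ψ₀ y + b y) ν.1 := by
    refine (lintegral_ofReal_ne_top_iff_integrable
      (hψ₀.aestronglyMeasurable.add hb.1) hge0).1 ?_
    exact ((le_add_self.trans hAB).trans_lt ENNReal.ofReal_lt_top).ne
  have hψ₀i : Integrable ψ₀ ν.1 := by
    have := hψb.sub hb
    refine this.congr (ae_of_all _ fun y => ?_)
    simp
  refine ⟨K, ψ₀, D, hKm, hKc, hKn, hKb, fun m => (hKu m).continuousOn
    (Frequently.of_forall fun n => (h n).cont.continuousOn), hψ₀i, hDm, hDf, ?_, ?_⟩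
  · rw [← ofReal_integral_eq_lintegral_ofReal hψb hge0, integral_add hψ₀i hb,
      ← ENNReal.ofReal_toReal hDf] at hAB
    have h0 : 0 ≤ ∫ y, ψ₀ y ∂ν.1 + ∫ y, b y ∂ν.1 := by
      rw [← integral_add hψ₀i hb]
      exact integral_nonneg_of_ae hge0
    rw [← ENNReal.ofReal_add ENNReal.toReal_nonneg h0] at hAB
    have hV : 0 ≤ ∫ x, a x ∂μ + ∫ y, b y ∂ν.1 - V := by
      have hlimv : Tendsto (fun n : ℕ => ∫ x, a x ∂μ + ∫ y, b y ∂ν.1 - V + 1 / ((n : ℝ) + 1)) atTop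
          (𝓝 (∫ x, a x ∂μ + ∫ y, b y ∂ν.1 - V)) := by
        have := (tendsto_one_div_add_atTop_nhds_zero_nat (𝕜 := ℝ)).const_add
          (∫ x, a x ∂μ + ∫ y, b y ∂ν.1 - V)
        rwa [add_zero] at this
      refine ge_of_tendsto' hlimv fun n => ?_
      have h1 := integral_mono (hφi n) ha (h n).left_le
      have h2 : ∫ y, -b y ∂ν.1 ≤ ∫ y, ψ n y ∂ν.1 :=
        integral_mono hb.neg (hψi n) (h n).le_right
      rw [integral_neg] at h2
      linarith [hv n]
    have := (ENNReal.ofReal_le_ofReal_iff hV).1 hAB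
    linarith
  · intro m x ρ hρ hCt
    have := ρ.2.1
    have hae := ae_mem_of_supported hρ
    have hwρ : Integrable w ρ.1 := by
      obtain ⟨M, hM⟩ := (hKc m).exists_bound_of_continuousOn hw.cont.continuousOn
      exact Integrable.of_bound hw.cont.aestronglyMeasurable M (hae.mono fun y hy => hM y hy)
    have hψρ : ∀ n, Integrable (ψ n) ρ.1 := fun n => (h n).integrable ρ hwρ
    have hcont : ContinuousOn ψ₀ (K m) := (hKu m).continuousOn
      (Frequently.of_forall fun n => (h n).cont.continuousOn)
    have hψ₀ρ : Integrable ψ₀ ρ.1 := by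
      obtain ⟨M, hM⟩ := (hKc m).exists_bound_of_continuousOn hcont
      exact Integrable.of_bound hψ₀.aestronglyMeasurable M (hae.mono fun y hy => hM y hy)
    have hJ : Tendsto (fun n => ∫ y, ψ n y ∂ρ.1) atTop (𝓝 (∫ y, ψ₀ y ∂ρ.1)) := by
      rw [Metric.tendsto_atTop']
      intro ε hε
      obtain ⟨N, hN⟩ := eventually_atTop.1 (Metric.tendstoUniformlyOn_iff.1 (hKu m) (ε / 2)
        (by positivity))
      refine ⟨N, fun n hn => ?_⟩
      rw [dist_comm, dist_eq_norm, ← integral_sub hψ₀ρ (hψρ n)]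
      have h1 := norm_integral_le_of_norm_le_const (μ := ρ.1) (C := ε / 2)
        (f := fun y => ψ₀ y - ψ n y) (hae.mono fun y hy => by
          rw [← dist_eq_norm]; exact (hN n hn.le y hy).le)
      rw [probReal_univ, mul_one] at h1
      linarith
    have h1 : Tendsto (fun n => ENNReal.ofReal (a x - ∫ y, ψ n y ∂ρ.1 - (C x ρ.1).toReal)) atTop
        (𝓝 (ENNReal.ofReal (a x - ∫ y, ψ₀ y ∂ρ.1 - (C x ρ.1).toReal))) :=
      ENNReal.tendsto_ofReal ((hJ.const_sub _).sub_const _)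
    rw [← h1.liminf_eq]
    refine liminf_le_liminf (Eventually.of_forall fun n => ENNReal.ofReal_le_ofReal ?_)
    linarith [(h n).le x ρ hwρ hCt]

end LimitPotential

section SupportedMeasures

variable {d : ℕ} {p : ℝ} {K : Set (Rd d)} {f : Rd d → ℝ}

/-- The elements of `P_p` carried by `K`. -/
def supportedOn (p : ℝ) {d : ℕ} (K : Set (Rd d)) : Set (Pp p d) := {ρ | ρ.1 Kᶜ = 0}

theorem ppMix_mem_supportedOn {ρ₁ ρ₂ : Pp p d} (h₁ : ρ₁ ∈ supportedOn p K)
    (h₂ : ρ₂ ∈ supportedOn p K) {s t : ℝ} (hs : 0 ≤ s) (ht : 0 ≤ t) (hst : s + t = 1) :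
    ppMix ρ₁ ρ₂ s t hs ht hst ∈ supportedOn p K := by
  have e₁ : ρ₁.1 Kᶜ = 0 := h₁
  have e₂ : ρ₂.1 Kᶜ = 0 := h₂
  change (ENNReal.ofReal s • ρ₁.1 + ENNReal.ofReal t • ρ₂.1) Kᶜ = 0
  simp [e₁, e₂]

theorem supportedOn_mono {K' : Set (Rd d)} (h : K ⊆ K') : supportedOn p K ⊆ supportedOn p K' :=
  fun _ hρ => measure_mono_null (compl_subset_compl.2 h) hρ

theorem ppDirac_mem_supportedOn (hK : IsCompact K) {z : Rd d} (hz : z ∈ K) :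
    ppDirac p z ∈ supportedOn p K := by
  change Measure.dirac z Kᶜ = 0
  rw [Measure.dirac_apply' _ hK.measurableSet.compl]
  simp [hz]

theorem integrable_of_supportedOn (hK : IsCompact K) (hf : ContinuousOn f K) {ρ : Pp p d}
    (hρ : ρ ∈ supportedOn p K) : Integrable f ρ.1 := by
  have := ρ.2.1
  obtain ⟨G, hG, hGf⟩ := exists_isBddCont_extension hK hf
  exact (hG.isBddMeas.integrable ρ.1).congr ((ae_mem_of_supported hρ).mono fun y hy => hGf hy)

theorem exists_continuous_eq_integral (p : ℝ) (hK : IsCompact K) (hf : ContinuousOn f K) :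
    ∃ H : Pp p d → ℝ, Continuous H ∧ ∀ ρ ∈ supportedOn p K, ∫ y, f y ∂ρ.1 = H ρ := by
  obtain ⟨G, ⟨hG, M, hM⟩, hGf⟩ := exists_isBddCont_extension hK hf
  exact ⟨fun ρ => ∫ y, G y ∂ρ.1, continuous_integral_pp (growthP_of_bounded hG hM), fun ρ hρ =>
    integral_congr_ae ((ae_mem_of_supported hρ).mono fun y hy => (hGf hy).symm)⟩

theorem exists_integral_le_of_fintype {ι Ω : Type*} [Fintype ι] [MeasurableSpace Ω]
    {P : Measure Ω} [IsProbabilityMeasure P] (hS : IsCompact (supportedOn p K))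
    (hK : IsCompact K) {g : ι → Rd d → ℝ} (hg : ∀ i, ContinuousOn (g i) K) {h : ι → Ω → ℝ}
    (hh : ∀ i, Integrable (h i) P)
    (hex : ∀ᵐ ω ∂P, ∃ ρ ∈ supportedOn p K, ∀ i, h i ω ≤ ∫ y, g i y ∂ρ.1) :
    ∃ ρ ∈ supportedOn p K, ∀ i, ∫ ω, h i ω ∂P ≤ ∫ y, g i y ∂ρ.1 := by
  let F : Pp p d → ι → ℝ := fun ρ i => ∫ y, g i y ∂ρ.1
  have hFc : ContinuousOn F (supportedOn p K) := by
    refine continuousOn_pi.2 fun i => ?_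
    obtain ⟨H, hH, hHe⟩ := exists_continuous_eq_integral p hK (hg i)
    exact hH.continuousOn.congr hHe
  have hcomp : IsCompact (F '' supportedOn p K) := hS.image_of_continuousOn hFc
  have hclosed : IsClosed (lowerClosure (F '' supportedOn p K) : Set (ι → ℝ)) :=
    hcomp.isClosed.lowerClosure_pi hcomp.isBounded.bddAbove
  have hconvex : Convex ℝ (lowerClosure (F '' supportedOn p K) : Set (ι → ℝ)) := by
    rintro u ⟨_, ⟨ρ₁, hρ₁, rfl⟩, h₁⟩ v ⟨_, ⟨ρ₂, hρ₂, rfl⟩, h₂⟩ s t hs ht hst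
    refine ⟨_, ⟨ppMix ρ₁ ρ₂ s t hs ht hst, ppMix_mem_supportedOn hρ₁ hρ₂ hs ht hst, rfl⟩,
      fun i => ?_⟩
    simp only [F]
    rw [integral_ppMix ρ₁ ρ₂ hs ht hst (integrable_of_supportedOn hK (hg i) hρ₁)
      (integrable_of_supportedOn hK (hg i) hρ₂)]
    exact add_le_add (mul_le_mul_of_nonneg_left (h₁ i) hs) (mul_le_mul_of_nonneg_left (h₂ i) ht)
  have hmem : ∀ᵐ ω ∂P, (fun i => h i ω) ∈ (lowerClosure (F '' supportedOn p K) : Set (ι → ℝ)) := by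
    filter_upwards [hex] with ω hω
    obtain ⟨ρ, hρ, hle⟩ := hω
    exact ⟨_, ⟨ρ, hρ, rfl⟩, hle⟩
  obtain ⟨_, ⟨ρ, hρ, rfl⟩, hle⟩ := hconvex.integral_mem hclosed hmem (Integrable.of_eval hh)
  refine ⟨ρ, hρ, fun i => ?_⟩
  have := hle i
  rwa [eval_integral hh] at this

/-- A selection principle: pointwise domination by measures on a compact set integrates to
domination by a single such measure. -/
theorem exists_integral_le {ι Ω : Type*} [MeasurableSpace Ω]
    {P : Measure Ω} [IsProbabilityMeasure P] (hS : IsCompact (supportedOn p K))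
    (hK : IsCompact K) {g : ι → Rd d → ℝ} (hg : ∀ i, ContinuousOn (g i) K) {h : ι → Ω → ℝ}
    (hh : ∀ i, Integrable (h i) P)
    (hex : ∀ᵐ ω ∂P, ∃ ρ ∈ supportedOn p K, ∀ i, h i ω ≤ ∫ y, g i y ∂ρ.1) :
    ∃ ρ ∈ supportedOn p K, ∀ i, ∫ ω, h i ω ∂P ≤ ∫ y, g i y ∂ρ.1 := by
  choose H hH hHe using fun i => exists_continuous_eq_integral p hK (hg i)
  obtain ⟨ρ, hρ, hle⟩ := hS.inter_iInter_nonempty (fun i => {ρ | ∫ ω, h i ω ∂P ≤ H i ρ})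
    (fun i => isClosed_le continuous_const (hH i)) fun u => by
      obtain ⟨ρ, hρ, hle⟩ := exists_integral_le_of_fintype (ι := u) hS hK (fun i => hg i)
        (fun i => hh i) (hex.mono fun ω ⟨ρ, hρ, hle⟩ => ⟨ρ, hρ, fun i => hle i⟩)
      refine ⟨ρ, hρ, mem_iInter₂.2 fun i hi => ?_⟩
      rw [mem_ofPred_eq, ← hHe i ρ hρ]
      exact hle ⟨i, hi⟩
  refine ⟨ρ, hρ, fun i => ?_⟩
  rw [hHe i ρ hρ]
  exact mem_iInter.1 hle i

theorem continuous_of_convexOn (hf : ConvexOn ℝ univ f) : Continuous f :=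
  continuousOn_univ.1 (hf.continuousOn isOpen_univ)

theorem le_integral_of_le_barycenter (hK : IsCompact K) (hf : ConvexOn ℝ univ f)
    (hfm : CoordMono f) {z : Rd d} {ρ : Pp p d} (hρ : ρ ∈ supportedOn p K)
    (hz : ∀ i, z i ≤ ∫ y, y i ∂ρ.1) : f z ≤ ∫ y, f y ∂ρ.1 := by
  have := ρ.2.1
  have hcf := continuous_of_convexOn hf
  have hi : ∀ i, Integrable (fun y : Rd d => y i) ρ.1 := fun i =>
    integrable_of_supportedOn hK (by fun_prop) hρ
  have hid : Integrable (fun y : Rd d => y) ρ.1 := Integrable.of_eval_piLp hi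
  calc f z ≤ f (∫ y, y ∂ρ.1) := hfm _ _ fun i => by
        rw [eval_integral_piLp hi]; exact hz i
    _ ≤ ∫ y, f y ∂ρ.1 := hf.map_integral_le hcf.continuousOn isClosed_univ (by simp) hid
        (integrable_of_supportedOn hK hcf.continuousOn hρ)

end SupportedMeasures

section Envelope

variable {d : ℕ} {p : ℝ} {K : Set (Rd d)} {f : Rd d → ℝ}

noncomputable section

/-- The increasing convex envelope of `f` over probability measures carried by `K`. -/
def envelope (p : ℝ) {d : ℕ} (K : Set (Rd d)) (f : Rd d → ℝ) (z : Rd d) : EReal :=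
  ⨅ ρ ∈ supportedOn p K, ⨅ (_ : ∀ i, z i ≤ ∫ y, y i ∂ρ.1), ((∫ y, f y ∂ρ.1 : ℝ) : EReal)

/-- The increasing convex envelope of `f` along an exhaustion `K`. -/
def limEnvelope (p : ℝ) {d : ℕ} (K : ℕ → Set (Rd d)) (f : Rd d → ℝ) (z : Rd d) : EReal :=
  ⨅ m, envelope p (K m) f z

end

theorem envelope_le {ρ : Pp p d} (hρ : ρ ∈ supportedOn p K) {z : Rd d}
    (hz : ∀ i, z i ≤ ∫ y, y i ∂ρ.1) : envelope p K f z ≤ ((∫ y, f y ∂ρ.1 : ℝ) : EReal) :=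
  iInf₂_le_of_le ρ hρ (iInf_le _ hz)

theorem envelope_lt_iff {z : Rd d} {c : EReal} : envelope p K f z < c ↔
    ∃ ρ ∈ supportedOn p K, (∀ i, z i ≤ ∫ y, y i ∂ρ.1) ∧ ((∫ y, f y ∂ρ.1 : ℝ) : EReal) < c := by
  simp only [envelope, iInf_lt_iff, exists_prop]

theorem envelope_mono : ECoordMono (envelope p K f) := fun _ _ h =>
  le_iInf₂ fun _ hρ => le_iInf fun hz => envelope_le hρ fun i => (h i).trans (hz i)

theorem envelope_anti {K' : Set (Rd d)} (h : K ⊆ K') (z : Rd d) :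
    envelope p K' f z ≤ envelope p K f z :=
  le_iInf₂ fun _ hρ => le_iInf fun hz => envelope_le (supportedOn_mono h hρ) hz

theorem envelope_le_self (hK : IsCompact K) {z : Rd d} (hz : z ∈ K) :
    envelope p K f z ≤ (f z : EReal) := by
  have h := envelope_le (f := f) (ppDirac_mem_supportedOn (p := p) hK hz) (z := z) fun i => by
    simp [ppDirac]
  refine h.trans_eq ?_
  simp [ppDirac]

theorem lowerSemicontinuous_ite_top {Z : Type*} [TopologicalSpace Z] {A : Set Z}
    (hA : IsClosed A) {g : Z → EReal} (hg : LowerSemicontinuous g) [DecidablePred (· ∈ A)] :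
    LowerSemicontinuous fun z => if z ∈ A then g z else ⊤ := by
  intro z c hc
  by_cases hz : z ∈ A
  · simp only [hz, if_true] at hc
    filter_upwards [hg z c hc] with z' hz'
    split_ifs
    · exact hz'
    · exact hz'.trans_le le_top
  · simp only [hz, if_false] at hc
    filter_upwards [hA.isOpen_compl.mem_nhds hz] with z' hz'
    rwa [if_neg hz']

theorem lowerSemicontinuous_envelope (hS : IsCompact (supportedOn p K)) (hK : IsCompact K)
    (hf : ContinuousOn f K) : LowerSemicontinuous (envelope p K f) := by
  classical
  choose H hH hHe using fun i => exists_continuous_eq_integral p hK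
    (f := fun y : Rd d => y i) (by fun_prop)
  obtain ⟨G, hG, hGe⟩ := exists_continuous_eq_integral p hK hf
  let A : Set (Rd d × Pp p d) := {q | ∀ i, q.1 i ≤ H i q.2}
  have hA : IsClosed A := by
    simp only [A, ofPred_forall]
    exact isClosed_iInter fun i => isClosed_le (by fun_prop) ((hH i).comp continuous_snd)
  have hl := lowerSemicontinuous_iInf_compact (lowerSemicontinuous_ite_top hA
    (continuous_coe_real_ereal.comp (hG.comp continuous_snd)).lowerSemicontinuous) hS
  convert hl using 2 with z
  refine iInf_congr fun ρ => iInf_congr fun hρ => ?_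
  simp only [A, mem_ofPred_eq, iInf_eq_if, hGe ρ hρ, hHe _ ρ hρ, Function.comp]

theorem exists_eq_envelope (hS : IsCompact (supportedOn p K)) (hK : IsCompact K)
    (hf : ContinuousOn f K) {z : Rd d} (hz : envelope p K f z ≠ ⊤) :
    ∃ ρ ∈ supportedOn p K, (∀ i, z i ≤ ∫ y, y i ∂ρ.1) ∧
      envelope p K f z = ((∫ y, f y ∂ρ.1 : ℝ) : EReal) := by
  choose H hH hHe using fun i => exists_continuous_eq_integral p hK
    (f := fun y : Rd d => y i) (by fun_prop)
  obtain ⟨G, hG, hGe⟩ := exists_continuous_eq_integral p hK hf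
  have hA : IsClosed {ρ : Pp p d | ∀ i, z i ≤ H i ρ} := by
    simp only [ofPred_forall]
    exact isClosed_iInter fun i => isClosed_le continuous_const (hH i)
  obtain ⟨ρ₀, h₀, hz₀, -⟩ := envelope_lt_iff.1 hz.lt_top
  obtain ⟨ρ, ⟨hρ, hρz⟩, hmin⟩ := (hS.inter_right hA).exists_isMinOn
    ⟨ρ₀, h₀, fun i => hHe i ρ₀ h₀ ▸ hz₀ i⟩ hG.continuousOn
  have hb : ∀ i, z i ≤ ∫ y, y i ∂ρ.1 := fun i => (hHe i ρ hρ).symm ▸ hρz i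
  refine ⟨ρ, hρ, hb, (envelope_le hρ hb).antisymm ?_⟩
  refine le_iInf₂ fun ρ' hρ' => le_iInf fun hz' => ?_
  rw [hGe ρ hρ, hGe ρ' hρ']
  exact_mod_cast hmin ⟨hρ', fun i => hHe i ρ' hρ' ▸ hz' i⟩

theorem limEnvelope_mono (K : ℕ → Set (Rd d)) : ECoordMono (limEnvelope p K f) :=
  fun _ _ h => iInf_mono fun _ => envelope_mono _ _ h

theorem convex_limEnvelope {K : ℕ → Set (Rd d)} (hm : Monotone K) (hK : ∀ m, IsCompact (K m))
    (hf : ∀ m, ContinuousOn f (K m)) (hbot : ∀ z, limEnvelope p K f z ≠ ⊥) :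
    EConvex (limEnvelope p K f) := by
  intro y z t h0 h1
  rcases h0.eq_or_lt with rfl | h0
  · simp
  rcases h1.eq_or_lt with rfl | h1
  · simp
  have h1' : 0 < 1 - t := by linarith
  have hne : ∀ {s : ℝ}, 0 < s → ∀ x, (s : EReal) * limEnvelope p K f x ≠ ⊥ := fun hs x => by
    rw [Ne, EReal.mul_eq_bot]
    simp [hbot x, hs.not_gt]
  rcases eq_or_ne (limEnvelope p K f y) ⊤ with hy | hy
  · rw [hy, EReal.coe_mul_top_of_pos h0, EReal.top_add_of_ne_bot]
    · exact le_top
    · exact hne h1' z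
  rcases eq_or_ne (limEnvelope p K f z) ⊤ with hz | hz
  · rw [hz, EReal.coe_mul_top_of_pos h1', EReal.add_top_of_ne_bot]
    · exact le_top
    · exact hne h0 y
  obtain ⟨u, hu⟩ : ∃ u : ℝ, limEnvelope p K f y = u := ⟨_, (EReal.coe_toReal hy (hbot y)).symm⟩
  obtain ⟨v, hv⟩ : ∃ v : ℝ, limEnvelope p K f z = v := ⟨_, (EReal.coe_toReal hz (hbot z)).symm⟩
  rw [hu, hv, ← EReal.coe_mul, ← EReal.coe_mul, ← EReal.coe_add]
  refine EReal.le_of_forall_lt_iff_le.1 fun r hr => ?_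
  obtain ⟨ε, hε, hεr⟩ : ∃ ε > 0, t * u + (1 - t) * v + ε = r :=
    ⟨r - (t * u + (1 - t) * v), by have := EReal.coe_lt_coe_iff.1 hr; linarith, by ring⟩
  have hlt : ∀ {x : Rd d} {u : ℝ}, limEnvelope p K f x = u → ∃ m, ∃ ρ ∈ supportedOn p (K m),
      (∀ i, x i ≤ ∫ y, y i ∂ρ.1) ∧ ∫ y, f y ∂ρ.1 < u + ε := by
    intro x u hu
    have : limEnvelope p K f x < ((u + ε : ℝ) : EReal) := by
      rw [hu]; exact_mod_cast lt_add_of_pos_right u hε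
    obtain ⟨m, hm⟩ := iInf_lt_iff.1 this
    obtain ⟨ρ, hρ, hx, hl⟩ := envelope_lt_iff.1 hm
    exact ⟨m, ρ, hρ, hx, by exact_mod_cast hl⟩
  obtain ⟨m₁, ρ₁, hρ₁, hb₁, hl₁⟩ := hlt hu
  obtain ⟨m₂, ρ₂, hρ₂, hb₂, hl₂⟩ := hlt hv
  have hs₁ := supportedOn_mono (hm (le_max_left m₁ m₂)) hρ₁
  have hs₂ := supportedOn_mono (hm (le_max_right m₁ m₂)) hρ₂
  have hst : t + (1 - t) = 1 := by ring
  refine (iInf_le _ (max m₁ m₂)).trans ((envelope_le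
    (ppMix_mem_supportedOn hs₁ hs₂ h0.le h1'.le hst) fun i => ?_).trans ?_)
  · rw [integral_ppMix ρ₁ ρ₂ h0.le h1'.le hst
      (integrable_of_supportedOn (hK _) (by fun_prop) hs₁)
      (integrable_of_supportedOn (hK _) (by fun_prop) hs₂)]
    simp only [PiLp.add_apply, PiLp.smul_apply, smul_eq_mul]
    exact add_le_add (mul_le_mul_of_nonneg_left (hb₁ i) h0.le)
      (mul_le_mul_of_nonneg_left (hb₂ i) h1'.le)
  · rw [integral_ppMix ρ₁ ρ₂ h0.le h1'.le hst (integrable_of_supportedOn (hK _) (hf _) hs₁)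
      (integrable_of_supportedOn (hK _) (hf _) hs₂)]
    have e1 := mul_lt_mul_of_pos_left hl₁ h0
    have e2 := mul_lt_mul_of_pos_left hl₂ h1'
    exact_mod_cast (by nlinarith :
      t * ∫ y, f y ∂ρ₁.1 + (1 - t) * ∫ y, f y ∂ρ₂.1 ≤ r)

end Envelope

section Domination

variable {d : ℕ} {p : ℝ} {K : Set (Rd d)} {f : Rd d → ℝ}

theorem icxOrder_of_integrable {ρ₁ ρ₂ : Measure (Rd d)}
    (h : ∀ f : Rd d → ℝ, ConvexOn ℝ univ f → CoordMono f →
      Integrable f ρ₁ ∧ Integrable f ρ₂ ∧ ∫ y, f y ∂ρ₁ ≤ ∫ y, f y ∂ρ₂) : IcxOrder ρ₁ ρ₂ := by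
  intro f hf hfm
  obtain ⟨h₁, h₂, hle⟩ := h f hf hfm
  rw [eInt_coe_of_integrable h₁, eInt_coe_of_integrable h₂]
  exact_mod_cast hle

theorem icxOrder_dirac (hK : IsCompact K) {ρ : Pp p d} (hρ : ρ ∈ supportedOn p K) {z : Rd d}
    (hz : ∀ i, z i ≤ ∫ y, y i ∂ρ.1) : IcxOrder (ppDirac p z).1 ρ.1 :=
  icxOrder_of_integrable fun f hf hfm => by
    have hc := continuous_of_convexOn hf
    refine ⟨integrable_dirac_of_measurable z,
      integrable_of_supportedOn hK hc.continuousOn hρ, ?_⟩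
    change ∫ y, f y ∂Measure.dirac z ≤ _
    rw [integral_dirac]
    exact le_integral_of_le_barycenter hK hf hfm hρ hz

theorem exists_bound_envelope (hS : IsCompact (supportedOn p K)) (hK : IsCompact K)
    (hf : ContinuousOn f K) : ∃ M : ℝ, ∀ z, ((-M : ℝ) : EReal) ≤ envelope p K f z := by
  obtain ⟨M, hM⟩ := hK.exists_bound_of_continuousOn hf
  refine ⟨M, fun z => ?_⟩
  by_cases hz : envelope p K f z = ⊤
  · rw [hz]; exact le_top
  obtain ⟨ρ, hρ, -, he⟩ := exists_eq_envelope hS hK hf hz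
  have := ρ.2.1
  rw [he]
  have h1 := norm_integral_le_of_norm_le_const (μ := ρ.1)
    ((ae_mem_of_supported hρ).mono fun y hy => hM y hy)
  rw [probReal_univ, mul_one] at h1
  exact_mod_cast (abs_le.1 h1).1

theorem integrable_of_norm_le {P : Measure (Rd d)} [IsProbabilityMeasure P] {R : ℝ}
    (hR : ∀ᵐ z ∂P, ‖z‖ ≤ R) {g : Rd d → ℝ} (hg : Continuous g) : Integrable g P := by
  obtain ⟨M, hM⟩ := (isCompact_closedBall (0 : Rd d) R).exists_bound_of_continuousOn
    hg.continuousOn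
  exact Integrable.of_bound hg.aestronglyMeasurable M (hR.mono fun z hz => hM z (by simpa using hz))

theorem integrable_toReal_envelope (hS : IsCompact (supportedOn p K)) (hK : IsCompact K)
    (hf : ContinuousOn f K) {P : Measure (Rd d)} [IsProbabilityMeasure P] {R : ℝ}
    (hP : ∀ᵐ z ∂P, envelope p K f z ≤ R) :
    Integrable (fun z => (envelope p K f z).toReal) P := by
  obtain ⟨M, hM⟩ := exists_bound_envelope hS hK hf
  refine Integrable.of_bound (C := max M R)
    (lowerSemicontinuous_envelope hS hK hf).measurable.ereal_toReal.aestronglyMeasurable ?_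
  filter_upwards [hP] with z hz
  obtain ⟨u, hu⟩ : ∃ u : ℝ, envelope p K f z = u :=
    ⟨_, (EReal.coe_toReal (ne_top_of_le_ne_top (EReal.coe_ne_top R) hz)
      (ne_bot_of_le_ne_bot (EReal.coe_ne_bot _) (hM z))).symm⟩
  have h1 := hM z
  rw [hu] at h1 hz ⊢
  rw [EReal.coe_le_coe_iff] at h1 hz
  rw [EReal.toReal_coe, Real.norm_eq_abs, abs_le]
  constructor
  · linarith [le_max_left M R]
  · exact hz.trans (le_max_right M R)

/-- A boundedly supported probability with bounded envelope is dominated in the increasing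
convex order by a probability on `K` whose `f`-integral does not exceed that of the envelope. -/
theorem exists_icxOrder_integral_le (hS : IsCompact (supportedOn p K)) (hK : IsCompact K)
    (hf : ContinuousOn f K) {P : Measure (Rd d)} [IsProbabilityMeasure P] {R : ℝ}
    (hR : ∀ᵐ z ∂P, ‖z‖ ≤ R) (hP : ∀ᵐ z ∂P, envelope p K f z ≤ R) :
    ∃ ρ ∈ supportedOn p K, IcxOrder P ρ.1 ∧
      ∫ y, f y ∂ρ.1 ≤ ∫ z, (envelope p K f z).toReal ∂P := by
  let ι := Option {f : Rd d → ℝ // ConvexOn ℝ univ f ∧ CoordMono f}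
  let g : ι → Rd d → ℝ := fun i => i.elim (fun y => -f y) fun F => F.1
  let h : ι → Rd d → ℝ := fun i => i.elim (fun z => -(envelope p K f z).toReal) fun F => F.1
  have hFc : ∀ F : {f : Rd d → ℝ // ConvexOn ℝ univ f ∧ CoordMono f}, Continuous F.1 :=
    fun F => continuous_of_convexOn F.2.1
  have hg : ∀ i, ContinuousOn (g i) K := by
    rintro (_ | F)
    · exact hf.neg
    · exact (hFc F).continuousOn
  have hh : ∀ i, Integrable (h i) P := by
    rintro (_ | F)
    · exact (integrable_toReal_envelope hS hK hf hP).neg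
    · exact integrable_of_norm_le hR (hFc F)
  have hex : ∀ᵐ z ∂P, ∃ ρ ∈ supportedOn p K, ∀ i, h i z ≤ ∫ y, g i y ∂ρ.1 := by
    filter_upwards [hP] with z hz
    obtain ⟨ρ, hρ, hb, he⟩ := exists_eq_envelope hS hK hf
      (ne_top_of_le_ne_top (EReal.coe_ne_top R) hz)
    refine ⟨ρ, hρ, ?_⟩
    rintro (_ | F)
    · simp only [h, g, Option.elim]
      rw [he, integral_neg, EReal.toReal_coe]
    · exact le_integral_of_le_barycenter hK F.2.1 F.2.2 hρ hb
  obtain ⟨ρ, hρ, hle⟩ := exists_integral_le hS hK hg hh hex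
  refine ⟨ρ, hρ, icxOrder_of_integrable fun F hF hFm => ?_, ?_⟩
  · have hc := continuous_of_convexOn hF
    exact ⟨integrable_of_norm_le hR hc, integrable_of_supportedOn hK hc.continuousOn hρ,
      hle (some ⟨F, hF, hFm⟩)⟩
  · have := hle none
    simp only [h, g, Option.elim] at this
    rw [integral_neg, integral_neg] at this
    linarith

end Domination

section EnvelopePotential

theorem memL1_of_le_of_le {α : Type*} [MeasurableSpace α] {ρ : Measure α} {ψ : α → EReal}
    (hm : Measurable ψ) (hb : ∀ y, ψ y ≠ ⊥) {g f : α → ℝ} (hg : Integrable g ρ)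
    (hf : Integrable f ρ) (h₁ : ∀ᵐ y ∂ρ, (g y : EReal) ≤ ψ y) (h₂ : ∀ᵐ y ∂ρ, ψ y ≤ (f y : EReal)) :
    MemL1 ρ ψ ∧ eInt ρ ψ ≤ ((∫ y, f y ∂ρ : ℝ) : EReal) := by
  have key : ∀ᵐ y ∂ρ, ψ y ≠ ⊤ ∧ g y ≤ (ψ y).toReal ∧ (ψ y).toReal ≤ f y := by
    filter_upwards [h₁, h₂] with y hy₁ hy₂
    have ht := ne_top_of_le_ne_top (EReal.coe_ne_top _) hy₂
    refine ⟨ht, ?_⟩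
    rw [← EReal.coe_toReal ht (hb y)] at hy₁ hy₂
    exact ⟨EReal.coe_le_coe_iff.1 hy₁, EReal.coe_le_coe_iff.1 hy₂⟩
  have hi : Integrable (fun y => (ψ y).toReal) ρ := by
    refine (hg.abs.add hf.abs).mono' hm.ereal_toReal.aestronglyMeasurable ?_
    filter_upwards [key] with y hy
    obtain ⟨-, hy₁, hy₂⟩ := hy
    simp only [Pi.add_apply, Real.norm_eq_abs, abs_le]
    constructor
    · linarith [neg_abs_le (g y), abs_nonneg (f y)]
    · linarith [le_abs_self (f y), abs_nonneg (g y)]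
  have hL := memL1_of_integrable hm hb (key.mono fun y hy => hy.1) hi
  refine ⟨hL, ?_⟩
  rw [hL.eInt_eq]
  exact_mod_cast integral_mono_ae hi hf (key.mono fun y hy => hy.2.2)

/-- The first potential attached to `f` along an exhaustion `K`. -/
noncomputable def limConj (p : ℝ) {X : Type*} {d : ℕ} (C : X → Measure (Rd d) → ℝ≥0∞)
    (K : ℕ → Set (Rd d)) (f : Rd d → ℝ) (x : X) : EReal :=
  ⨅ m, ⨅ ρ ∈ supportedOn p (K m),
    ((∫ y, f y ∂ρ.1 : ℝ) : EReal) + ((C x ρ.1 : ℝ≥0∞) : EReal)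

theorem limConj_le {p : ℝ} {X : Type*} {d : ℕ} {C : X → Measure (Rd d) → ℝ≥0∞}
    {K : ℕ → Set (Rd d)} {f : Rd d → ℝ} {m : ℕ} {ρ : Pp p d} (hρ : ρ ∈ supportedOn p (K m))
    (x : X) : limConj p C K f x ≤
      ((∫ y, f y ∂ρ.1 : ℝ) : EReal) + ((C x ρ.1 : ℝ≥0∞) : EReal) :=
  iInf_le_of_le m (iInf₂_le ρ hρ)

variable {d : ℕ} {p : ℝ} {K : ℕ → Set (Rd d)} {f : Rd d → ℝ}

theorem measurable_limConj {X : Type*} [TopologicalSpace X] [MeasurableSpace X] [BorelSpace X]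
    {C : X → Measure (Rd d) → ℝ≥0∞}
    (hlsc : LowerSemicontinuous fun q : X × Pp p d => C q.1 q.2.1)
    (hS : ∀ m, IsCompact (supportedOn p (K m))) (hK : ∀ m, IsCompact (K m))
    (hf : ∀ m, ContinuousOn f (K m)) : Measurable (limConj p C K f) := by
  refine Measurable.iInf fun m => LowerSemicontinuous.measurable ?_
  obtain ⟨G, hG, hGe⟩ := exists_continuous_eq_integral p (hK m) (hf m)
  have h1 : LowerSemicontinuous fun q : X × Pp p d =>
      ((G q.2 : ℝ) : EReal) + ((C q.1 q.2.1 : ℝ≥0∞) : EReal) := by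
    refine (continuous_coe_real_ereal.comp (hG.comp continuous_snd)).lowerSemicontinuous.add'
      (continuous_coe_ennreal_ereal.comp_lowerSemicontinuous hlsc
        EReal.coe_ennreal_strictMono.monotone) fun q => ?_
    exact EReal.continuousAt_add (by simp) (by simp)
  convert lowerSemicontinuous_iInf_compact h1 (hS m) using 2 with x
  exact iInf_congr fun ρ => iInf_congr fun hρ => by rw [hGe ρ hρ]

theorem tendsto_envelope (hK : Monotone K) (z : Rd d) :
    Tendsto (fun m => envelope p (K m) f z) atTop (𝓝 (limEnvelope p K f z)) :=
  tendsto_atTop_iInf fun _ _ h => envelope_anti (hK h) z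

theorem limConj_le_of_bounded {X : Type*} {C : X → Measure (Rd d) → ℝ≥0∞} (hm : Monotone K)
    (hmono : ∀ x : X, ∀ ρ₁ ρ₂ : Pp p d, IcxOrder ρ₁.1 ρ₂.1 → C x ρ₂.1 ≤ C x ρ₁.1)
    (hS : ∀ m, IsCompact (supportedOn p (K m))) (hK : ∀ m, IsCompact (K m))
    (hf : ∀ m, ContinuousOn f (K m)) (hbot : ∀ z, limEnvelope p K f z ≠ ⊥) (x : X)
    {P : Pp p d} {R : ℝ} {k : ℕ} (hR : ∀ᵐ z ∂P.1, ‖z‖ ≤ R)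
    (hP : ∀ᵐ z ∂P.1, envelope p (K k) f z ≤ R)
    (hi : Integrable (fun z => (limEnvelope p K f z).toReal) P.1) :
    limConj p C K f x
      ≤ ((∫ z, (limEnvelope p K f z).toReal ∂P.1 : ℝ) : EReal) + ((C x P.1 : ℝ≥0∞) : EReal) := by
  have := P.2.1
  have hPm : ∀ m, k ≤ m → ∀ᵐ z ∂P.1, envelope p (K m) f z ≤ R := fun m hkm =>
    hP.mono fun z hz => (envelope_anti (hm hkm) z).trans hz
  have hle : ∀ m, k ≤ m → limConj p C K f x
      ≤ ((∫ z, (envelope p (K m) f z).toReal ∂P.1 : ℝ) : EReal) + ((C x P.1 : ℝ≥0∞) : EReal) := by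
    intro m hkm
    obtain ⟨ρ, hρ, hicx, hle⟩ := exists_icxOrder_integral_le (hS m) (hK m) (hf m) hR (hPm m hkm)
    exact (limConj_le hρ x).trans (add_le_add (EReal.coe_le_coe_iff.2 hle)
      (EReal.coe_ennreal_le_coe_ennreal_iff.2 (hmono x P ρ hicx)))
  have hlim : Tendsto (fun m => ∫ z, (envelope p (K m) f z).toReal ∂P.1) atTop
      (𝓝 (∫ z, (limEnvelope p K f z).toReal ∂P.1)) := by
    refine tendsto_integral_filter_of_dominated_convergence
      (fun z => |(limEnvelope p K f z).toReal| + |R|)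
      (Eventually.of_forall fun m => (lowerSemicontinuous_envelope (hS m) (hK m)
        (hf m)).measurable.ereal_toReal.aestronglyMeasurable)
      ?_ (hi.abs.add (integrable_const _)) ?_
    · filter_upwards [eventually_ge_atTop k] with m hkm
      filter_upwards [hPm m hkm] with z hz
      have ht := ne_top_of_le_ne_top (EReal.coe_ne_top R) hz
      have hb := ne_bot_of_le_ne_bot (hbot z) (iInf_le _ m)
      have h1 : (limEnvelope p K f z).toReal ≤ (envelope p (K m) f z).toReal :=
        EReal.toReal_le_toReal (iInf_le _ m) (hbot z) ht
      have h2 : (envelope p (K m) f z).toReal ≤ R :=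
        EReal.toReal_le_toReal hz hb (EReal.coe_ne_top R)
      rw [Real.norm_eq_abs, abs_le]
      constructor
      · linarith [neg_abs_le (limEnvelope p K f z).toReal, abs_nonneg R]
      · linarith [le_abs_self R, abs_nonneg (limEnvelope p K f z).toReal]
    · filter_upwards [hP] with z hz
      exact (EReal.tendsto_toReal (ne_top_of_le_ne_top (EReal.coe_ne_top R)
        ((iInf_le _ k).trans hz)) (hbot z)).comp (tendsto_envelope hm z)
  have hlim' : Tendsto (fun m => ((∫ z, (envelope p (K m) f z).toReal ∂P.1 : ℝ) : EReal)
      + ((C x P.1 : ℝ≥0∞) : EReal)) atTop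
      (𝓝 (((∫ z, (limEnvelope p K f z).toReal ∂P.1 : ℝ) : EReal)
        + ((C x P.1 : ℝ≥0∞) : EReal))) :=
    (EReal.continuousAt_add (p := (_, _)) (by simp) (by simp)).tendsto.comp
      (((continuous_coe_real_ereal.tendsto _).comp hlim).prodMk_nhds tendsto_const_nhds)
  exact ge_of_tendsto hlim' ((eventually_ge_atTop k).mono hle)

end EnvelopePotential

section Exhaustion

variable {d : ℕ} {p : ℝ} {K : ℕ → Set (Rd d)} {f : Rd d → ℝ}

theorem EReal.le_add_of_tendsto_of_limsup_le {u : EReal} {J : ℕ → ℝ} {j : ℝ} {c : ℕ → ℝ≥0∞}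
    {c₀ : ℝ≥0∞} (hJ : Tendsto J atTop (𝓝 j)) (hc : limsup c atTop ≤ c₀)
    (h : ∀ᶠ k in atTop, u ≤ (J k : EReal) + (c k : EReal)) : u ≤ (j : EReal) + (c₀ : EReal) := by
  rcases eq_or_ne c₀ ⊤ with rfl | hc₀
  · simp
  lift c₀ to NNReal using hc₀
  rw [show (((c₀ : NNReal) : ℝ≥0∞) : EReal) = ((c₀ : ℝ) : EReal) from rfl, ← EReal.coe_add]
  refine EReal.le_of_forall_lt_iff_le.1 fun r hr => ?_
  obtain ⟨ε, hε, hεr⟩ : ∃ ε : NNReal, 0 < ε ∧ j + c₀ + 2 * ε = r := by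
    have := EReal.coe_lt_coe_iff.1 hr
    refine ⟨((r - (j + c₀)) / 2).toNNReal, Real.toNNReal_pos.2 (by linarith), ?_⟩
    rw [Real.coe_toNNReal _ (by linarith)]
    ring
  have h1 : ∀ᶠ k in atTop, J k < j + ε := hJ.eventually_lt_const (by
    have : (0 : ℝ) < ε := by exact_mod_cast hε
    linarith)
  have h2 : ∀ᶠ k in atTop, c k < ((c₀ + ε : NNReal) : ℝ≥0∞) :=
    eventually_lt_of_limsup_lt (hc.trans_lt (by exact_mod_cast lt_add_of_pos_right c₀ hε))
  obtain ⟨k, hk, hk1, hk2⟩ := (h.and (h1.and h2)).exists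
  refine hk.trans ((add_le_add (EReal.coe_le_coe_iff.2 hk1.le)
    (EReal.coe_ennreal_le_coe_ennreal_iff.2 hk2.le)).trans_eq ?_)
  rw [show ((((c₀ + ε : NNReal) : NNReal) : ℝ≥0∞) : EReal) = (((c₀ : ℝ) + ε : ℝ) : EReal) from by
    rw [← NNReal.coe_add]; rfl, ← EReal.coe_add, EReal.coe_eq_coe_iff]
  linarith

/-- The normalised restriction of `ρ` to a set of positive measure. -/
noncomputable def ppRestrict (ρ : Pp p d) (Y : Set (Rd d)) (hY : ρ.1 Y ≠ 0) : Pp p d :=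
  ⟨(ρ.1 Y)⁻¹ • ρ.1.restrict Y, by
    have := ρ.2.1
    refine ⟨⟨?_⟩, ?_⟩
    · simp [ENNReal.inv_mul_cancel hY (measure_ne_top _ _)]
    · rw [HasMomentP, lintegral_smul_measure]
      exact ENNReal.mul_ne_top (ENNReal.inv_ne_top.2 hY)
        (ne_top_of_le_ne_top ρ.2.2 (setLIntegral_le_lintegral _ _))⟩

/-- Sublevel sets of the approximate envelopes, exhausting `ℝ^d`. -/
def sublevelExhaustion (p : ℝ) {d : ℕ} (K : ℕ → Set (Rd d)) (f : Rd d → ℝ) (k : ℕ) :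
    Set (Rd d) :=
  {z | ‖z‖ ≤ k ∧ envelope p (K k) f z ≤ ((k : ℝ) : EReal)} ∪ {z | limEnvelope p K f z = ⊤}

theorem monotone_sublevelExhaustion (hm : Monotone K) : Monotone (sublevelExhaustion p K f) := by
  intro k l hkl z hz
  have hkl' : (k : ℝ) ≤ l := by exact_mod_cast hkl
  exact hz.imp (fun h => ⟨h.1.trans hkl', (envelope_anti (hm hkl) z).trans
    (h.2.trans (EReal.coe_le_coe_iff.2 hkl'))⟩) id

theorem iUnion_sublevelExhaustion (hm : Monotone K) : ⋃ k, sublevelExhaustion p K f k = univ := by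
  refine eq_univ_of_forall fun z => ?_
  by_cases hz : limEnvelope p K f z = ⊤
  · exact mem_iUnion.2 ⟨0, Or.inr hz⟩
  obtain ⟨m, hmz⟩ := iInf_lt_iff.1 (Ne.lt_top hz)
  obtain ⟨r, hr, -⟩ := EReal.lt_iff_exists_real_btwn.1 hmz
  obtain ⟨n, hn⟩ := exists_nat_ge (max r ‖z‖)
  refine mem_iUnion.2 ⟨max m n, Or.inl ⟨?_, ?_⟩⟩
  · exact (le_max_right r ‖z‖).trans (hn.trans (by exact_mod_cast le_max_right m n))
  · refine (envelope_anti (hm (le_max_left m n)) z).trans (hr.le.trans (EReal.coe_le_coe_iff.2 ?_))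
    exact (le_max_left r ‖z‖).trans (hn.trans (by exact_mod_cast le_max_right m n))

theorem measurable_limEnvelope (hS : ∀ m, IsCompact (supportedOn p (K m)))
    (hK : ∀ m, IsCompact (K m)) (hf : ∀ m, ContinuousOn f (K m)) :
    Measurable (limEnvelope p K f) :=
  Measurable.iInf fun m => (lowerSemicontinuous_envelope (hS m) (hK m) (hf m)).measurable

theorem measurableSet_sublevelExhaustion (hS : ∀ m, IsCompact (supportedOn p (K m)))
    (hK : ∀ m, IsCompact (K m)) (hf : ∀ m, ContinuousOn f (K m)) (k : ℕ) :
    MeasurableSet (sublevelExhaustion p K f k) := by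
  exact MeasurableSet.union
    (MeasurableSet.inter (measurableSet_le measurable_norm measurable_const)
      (measurableSet_le (lowerSemicontinuous_envelope (hS k) (hK k) (hf k)).measurable
        measurable_const))
    (measurable_limEnvelope hS hK hf (measurableSet_singleton ⊤))

theorem limConj_le_eInt_add {X : Type*} [MeasurableSpace X]
    {C : X → Measure (Rd d) → ℝ≥0∞} (hm : Monotone K)
    (hmono : ∀ x : X, ∀ ρ₁ ρ₂ : Pp p d, IcxOrder ρ₁.1 ρ₂.1 → C x ρ₂.1 ≤ C x ρ₁.1)
    (hC : CondC p C)
    (hS : ∀ m, IsCompact (supportedOn p (K m))) (hK : ∀ m, IsCompact (K m))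
    (hf : ∀ m, ContinuousOn f (K m)) (hbot : ∀ z, limEnvelope p K f z ≠ ⊥) (x : X)
    {ρ : Pp p d} (hρ : MemL1 ρ.1 (limEnvelope p K f)) :
    limConj p C K f x
      ≤ eInt ρ.1 (limEnvelope p K f) + ((C x ρ.1 : ℝ≥0∞) : EReal) := by
  have := ρ.2.1
  let Y := sublevelExhaustion p K f
  have hYm : Monotone Y := monotone_sublevelExhaustion hm
  have hYu : ⋃ k, Y k = univ := iUnion_sublevelExhaustion hm
  have hYs : ∀ k, MeasurableSet (Y k) := measurableSet_sublevelExhaustion hS hK hf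
  have hi := hρ.integrable
  have hmass : Tendsto (fun k => ρ.1 (Y k)) atTop (𝓝 1) := by
    have := tendsto_measure_iUnion_atTop (μ := ρ.1) hYm
    rwa [hYu, measure_univ] at this
  have hint : Tendsto (fun k => ∫ z, (limEnvelope p K f z).toReal
      ∂((ρ.1 (Y k))⁻¹ • ρ.1.restrict (Y k))) atTop
      (𝓝 (∫ z, (limEnvelope p K f z).toReal ∂ρ.1)) := by
    have h1 := tendsto_setIntegral_of_monotone hYs hYm (hi.integrableOn (s := ⋃ k, Y k))
    rw [hYu, setIntegral_univ] at h1
    have h2 : Tendsto (fun k => ((ρ.1 (Y k))⁻¹).toReal) atTop (𝓝 1) := by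
      have := (ENNReal.tendsto_toReal (by simp)).comp (hmass.inv)
      simpa [Function.comp_def] using this
    simp only [integral_smul_measure, smul_eq_mul]
    simpa using h2.mul h1
  rw [hρ.eInt_eq]
  refine EReal.le_add_of_tendsto_of_limsup_le hint (hC x ρ Y hYs hYm hYu) ?_
  filter_upwards [hmass.eventually_ne one_ne_zero] with k hk
  have hae : ∀ᵐ z ∂((ρ.1 (Y k))⁻¹ • ρ.1.restrict (Y k)),
      ‖z‖ ≤ k ∧ envelope p (K k) f z ≤ ((k : ℝ) : EReal) := by
    refine Measure.ae_smul_measure ?_ _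
    filter_upwards [ae_restrict_mem (hYs k), ae_restrict_of_ae hρ.ae_ne_top] with z hz hz'
    exact hz.resolve_right hz'
  exact limConj_le_of_bounded (P := ppRestrict ρ (Y k) hk) hm hmono hS hK hf hbot x
    (hae.mono fun z hz => hz.1) (hae.mono fun z hz => hz.2)
    ((hi.integrableOn (s := Y k)).smul_measure (ENNReal.inv_ne_top.2 hk))

end Exhaustion

section Attainment

theorem MemL1.eInt_of_neg {α : Type*} [MeasurableSpace α] {μ : Measure α} {φ : α → EReal}
    (h : MemL1 μ fun x => -φ x) : Integrable (fun x => (φ x).toReal) μ ∧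
      eInt μ φ = ((∫ x, (φ x).toReal ∂μ : ℝ) : EReal) := by
  have hi : Integrable (fun x => (φ x).toReal) μ := by
    have := h.integrable.neg
    refine this.congr (ae_of_all _ fun x => ?_)
    simp
  refine ⟨hi, eInt_eq_integral (ae_of_all _ fun x hx => h.2.1 x (by simp [hx])) ?_ hi⟩
  filter_upwards [h.ae_ne_top] with x hx hx'
  simp [hx'] at hx

variable {X : Type*} [MeasurableSpace X]
  {d : ℕ} {p : ℝ} {μ : Measure X} {ν : Measure (Rd d)} {C : X → Measure (Rd d) → ℝ≥0∞}
  {a : X → ℝ} {b : Rd d → ℝ} {K : ℕ → Set (Rd d)} {ψ₀ : Rd d → ℝ} {D : X → ℝ≥0∞}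

theorem IsLimitPotential.le_limEnvelope (h : IsLimitPotential p μ ν C a b K ψ₀ D)
    (hmono : ∀ x : X, ∀ ρ₁ ρ₂ : Pp p d, IcxOrder ρ₁.1 ρ₂.1 → C x ρ₂.1 ≤ C x ρ₁.1)
    (hab : ∀ x : X, ∀ ρ : Pp p d,
      ((C x ρ.1 : ℝ≥0∞) : EReal) ≤ (a x : EReal) + eInt ρ.1 (fun y => (b y : EReal)))
    {x : X} (hx : D x ≠ ⊤) (z : Rd d) :
    ((-(D x).toReal - b z : ℝ) : EReal) ≤ limEnvelope p K ψ₀ z := by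
  refine le_iInf fun m => le_iInf₂ fun ρ hρ => le_iInf fun hz => EReal.coe_le_coe_iff.2 ?_
  obtain ⟨h1, h2⟩ := cost_dirac_le hab x z
  have h3 := hmono x (ppDirac p z) ρ (icxOrder_dirac (h.compact m) hρ hz)
  have h4 := ENNReal.toReal_mono h1 h3
  have h5 := (ENNReal.ofReal_le_iff_le_toReal hx).1
    (h.le m x ρ hρ (ne_top_of_le_ne_top h1 h3))
  change (C x ρ.1).toReal ≤ (C x (Measure.dirac z)).toReal at h4
  linarith

theorem IsLimitPotential.le_limConj (h : IsLimitPotential p μ ν C a b K ψ₀ D)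
    {x : X} (hx : D x ≠ ⊤) : ((a x - (D x).toReal : ℝ) : EReal) ≤ limConj p C K ψ₀ x := by
  refine le_iInf fun m => le_iInf₂ fun ρ hρ => ?_
  by_cases hc : C x ρ.1 = ⊤
  · simp [hc]
  have h5 := (ENNReal.ofReal_le_iff_le_toReal hx).1 (h.le m x ρ hρ hc)
  rw [← EReal.coe_ennreal_toReal hc, ← EReal.coe_add, EReal.coe_le_coe_iff]
  linarith

theorem IsLimitPotential.exists_limConj_le [IsProbabilityMeasure ν]
    (h : IsLimitPotential p μ ν C a b K ψ₀ D)
    (hab : ∀ x : X, ∀ ρ : Pp p d,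
      ((C x ρ.1 : ℝ≥0∞) : EReal) ≤ (a x : EReal) + eInt ρ.1 (fun y => (b y : EReal))) :
    ∃ c : ℝ, ∀ x, limConj p C K ψ₀ x ≤ ((a x + c : ℝ) : EReal) := by
  obtain ⟨y, hy⟩ : (⋃ m, K m).Nonempty := by
    by_contra hne
    have := h.null
    rw [not_nonempty_iff_eq_empty.1 hne, compl_empty, measure_univ] at this
    exact one_ne_zero this
  obtain ⟨m, hm⟩ := mem_iUnion.1 hy
  refine ⟨b y + ψ₀ y, fun x => (limConj_le (ppDirac_mem_supportedOn (h.compact m) hm) x).trans ?_⟩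
  obtain ⟨h1, h2⟩ := cost_dirac_le hab x y
  simp only [ppDirac, integral_dirac]
  rw [← EReal.coe_ennreal_toReal h1, ← EReal.coe_add, EReal.coe_le_coe_iff]
  linarith

theorem IsLimitPotential.conjL1_limEnvelope (h : IsLimitPotential p μ ν C a b K ψ₀ D)
    (hmono : ∀ x : X, ∀ ρ₁ ρ₂ : Pp p d, IcxOrder ρ₁.1 ρ₂.1 → C x ρ₂.1 ≤ C x ρ₁.1)
    (hC : CondC p C)
    (hab : ∀ x : X, ∀ ρ : Pp p d,
      ((C x ρ.1 : ℝ≥0∞) : EReal) ≤ (a x : EReal) + eInt ρ.1 (fun y => (b y : EReal)))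
    (hS : ∀ m, IsCompact (supportedOn p (K m))) {x₀ : X} (hx₀ : D x₀ ≠ ⊤) :
    conjL1 p C (limEnvelope p K ψ₀) = limConj p C K ψ₀ := by
  have hge := h.le_limEnvelope hmono hab hx₀
  have hbot : ∀ z, limEnvelope p K ψ₀ z ≠ ⊥ := fun z =>
    ne_bot_of_le_ne_bot (EReal.coe_ne_bot _) (hge z)
  funext x
  refine le_antisymm ?_ (le_iInf fun ρ =>
    limConj_le_eInt_add h.mono hmono hC hS h.compact h.cont hbot x ρ.2)
  refine le_iInf fun m => le_iInf₂ fun ρ hρ => ?_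
  have := ρ.2.1
  obtain ⟨M, hM⟩ := h.bdd m
  obtain ⟨hL, hle⟩ := memL1_of_le_of_le (ρ := ρ.1) (g := fun _ => -(D x₀).toReal - M)
    (measurable_limEnvelope hS h.compact h.cont) hbot (integrable_const _)
    (integrable_of_supportedOn (h.compact m) (h.cont m) hρ)
    ((ae_mem_of_supported hρ).mono fun y hy => (EReal.coe_le_coe_iff.2 (by
      linarith [le_abs_self (b y), hM y hy])).trans (hge y))
    ((ae_mem_of_supported hρ).mono fun y hy =>
      (iInf_le _ m).trans (envelope_le_self (h.compact m) hy))
  exact (iInf_le _ ⟨ρ, hL⟩).trans (add_le_add_left hle _)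

theorem IsLimitPotential.exists_attaining [TopologicalSpace X] [BorelSpace X] [IsProbabilityMeasure μ] [IsProbabilityMeasure ν]
    (h : IsLimitPotential p μ ν C a b K ψ₀ D)
    (hlsc : LowerSemicontinuous fun q : X × Pp p d => C q.1 q.2.1)
    (hmono : ∀ x : X, ∀ ρ₁ ρ₂ : Pp p d, IcxOrder ρ₁.1 ρ₂.1 → C x ρ₂.1 ≤ C x ρ₁.1)
    (hC : CondC p C) (ha : Integrable a μ) (hb : Integrable b ν)
    (hab : ∀ x : X, ∀ ρ : Pp p d,
      ((C x ρ.1 : ℝ≥0∞) : EReal) ≤ (a x : EReal) + eInt ρ.1 (fun y => (b y : EReal)))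
    (hS : ∀ m, IsCompact (supportedOn p (K m))) :
    ∃ ψ : Rd d → EReal, EConvex ψ ∧ ECoordMono ψ ∧ InPhi p μ ν C (conjL1 p C ψ) ψ ∧
      (((primal μ ν C).toReal : ℝ) : EReal) ≤ eInt μ (conjL1 p C ψ) - eInt ν ψ := by
  have hDt : ∀ᵐ x ∂μ, D x < ⊤ := ae_lt_top' h.aemeasurable h.finite
  obtain ⟨x₀, hx₀⟩ := hDt.exists
  have hge := h.le_limEnvelope hmono hab hx₀.ne
  have hbot : ∀ z, limEnvelope p K ψ₀ z ≠ ⊥ := fun z =>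
    ne_bot_of_le_ne_bot (EReal.coe_ne_bot _) (hge z)
  have hconj := h.conjL1_limEnvelope hmono hC hab hS hx₀.ne
  obtain ⟨hν, hνle⟩ := memL1_of_le_of_le (ρ := ν) (measurable_limEnvelope hS h.compact h.cont)
    hbot ((integrable_const _).sub hb) h.integrable (ae_of_all _ hge) (by
      have hK : ∀ᵐ y ∂ν, y ∈ ⋃ m, K m := h.null
      filter_upwards [hK] with y hy
      obtain ⟨m, hm⟩ := mem_iUnion.1 hy
      exact (iInf_le _ m).trans (envelope_le_self (h.compact m) hm))
  obtain ⟨c, hc⟩ := h.exists_limConj_le hab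
  have hDi : Integrable (fun x => (D x).toReal) μ :=
    integrable_toReal_of_lintegral_ne_top h.aemeasurable h.finite
  have haD : Integrable (fun x => a x - (D x).toReal) μ := ha.sub hDi
  obtain ⟨hμ, hμle⟩ := memL1_of_le_of_le (ρ := μ) (ψ := fun x => -limConj p C K ψ₀ x)
    (g := fun x => -(a x + c)) (f := fun x => -(a x - (D x).toReal))
    (measurable_limConj hlsc hS h.compact h.cont).neg
    (fun x hx => by
      have h1 := ne_top_of_le_ne_top (EReal.coe_ne_top _) (hc x)
      simp only [EReal.neg_eq_bot_iff] at hx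
      exact h1 hx)
    (ha.add (integrable_const c)).neg haD.neg
    (ae_of_all _ fun x => by
      rw [EReal.coe_neg, EReal.neg_le_neg_iff]; exact hc x)
    (hDt.mono fun x hx => by
      rw [EReal.coe_neg, EReal.neg_le_neg_iff]; exact h.le_limConj hx.ne)
  obtain ⟨hφi, hφe⟩ := hμ.eInt_of_neg
  refine ⟨limEnvelope p K ψ₀, convex_limEnvelope h.mono h.compact h.cont hbot,
    limEnvelope_mono K, ⟨?_, hν, fun x ρ hρ => ?_⟩, ?_⟩
  · rwa [hconj]
  · rw [EReal.sub_le_iff_le_add (Or.inl ?_) (Or.inl ?_), add_comm]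
    · exact iInf_le (fun ρ : {ρ : Pp p d // MemL1 ρ.1 (limEnvelope p K ψ₀)} =>
        eInt ρ.1.1 (limEnvelope p K ψ₀) + ((C x ρ.1.1 : ℝ≥0∞) : EReal)) ⟨ρ, hρ⟩
    · rw [hρ.eInt_eq]; exact EReal.coe_ne_bot _
    · rw [hρ.eInt_eq]; exact EReal.coe_ne_top _
  · rw [hμ.eInt_eq, EReal.coe_le_coe_iff, integral_neg] at hμle
    simp only [EReal.toReal_neg_eq, integral_neg] at hμle
    rw [hν.eInt_eq, EReal.coe_le_coe_iff] at hνle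
    rw [hconj, hφe, hν.eInt_eq, ← EReal.coe_sub, EReal.coe_le_coe_iff]
    rw [integral_sub ha hDi, integral_toReal h.aemeasurable hDt] at hμle
    linarith [h.value]

end Attainment

section WeakDuality

variable {X : Type*} [MeasurableSpace X] {d : ℕ} {p : ℝ} {μ : Measure X} {ν : Measure (Rd d)}
  {C : X → Measure (Rd d) → ℝ≥0∞}

theorem ofReal_integral_le_lintegral {f : X → ℝ} (hf : Integrable f μ) :
    ENNReal.ofReal (∫ x, f x ∂μ) ≤ ∫⁻ x, ENNReal.ofReal (f x) ∂μ := by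
  rw [integral_eq_lintegral_pos_part_sub_lintegral_neg_part hf]
  exact (ENNReal.ofReal_le_ofReal (sub_le_self _ ENNReal.toReal_nonneg)).trans
    ENNReal.ofReal_toReal_le

theorem InPhi.sub_le_primal (hp : 1 ≤ p) (hνp : HasMomentP p ν) {φ : X → EReal}
    {ψ : Rd d → EReal} (h : InPhi p μ ν C φ ψ) :
    eInt μ φ - eInt ν ψ ≤ ((primal μ ν C : ℝ≥0∞) : EReal) := by
  obtain ⟨hφ, hψ, hle⟩ := h
  obtain ⟨hφi, hφe⟩ := hφ.eInt_of_neg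
  rw [hφe, hψ.eInt_eq, ← EReal.coe_sub]
  have hkey : ENNReal.ofReal (∫ x, (φ x).toReal ∂μ - ∫ y, (ψ y).toReal ∂ν) ≤ primal μ ν C := by
    refine le_iInf fun ⟨π, hπ⟩ => ?_
    have := hπ.1
    have := hπ.isMarkovKernel_disint
    have : IsProbabilityMeasure μ := hπ.2.1 ▸ Measure.isProbabilityMeasure_map
      measurable_fst.aemeasurable
    have hψπ : Integrable (fun z : X × Rd d => (ψ z.2).toReal) (μ.compProd (disint π)) := by
      rw [hπ.compProd_disint]
      have hi := hψ.integrable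
      rw [← hπ.2.2] at hi
      exact hi.comp_measurable measurable_snd
    have hJ : Integrable (fun x => ∫ y, (ψ y).toReal ∂(disint π x)) μ :=
      Integrable.integral_compProd (κ := ProbabilityTheory.Kernel.const Unit μ) (a := ()) hψπ
    have hJe : ∫ x, ∫ y, (ψ y).toReal ∂(disint π x) ∂μ = ∫ y, (ψ y).toReal ∂ν := by
      rw [← Measure.integral_compProd hψπ, hπ.compProd_disint]
      conv_rhs => rw [← hπ.2.2, integral_map measurable_snd.aemeasurable
        hψ.1.ereal_toReal.aestronglyMeasurable]
    rw [← hJe, ← integral_sub hφi hJ]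
    refine (ofReal_integral_le_lintegral (hφi.sub hJ)).trans (lintegral_mono_ae ?_)
    filter_upwards [hπ.ae_hasMomentP hp hνp, hφ.ae_ne_top, hπ.ae_lintegral_lt_top
      ((measurable_erealToENN.comp hψ.1).add (measurable_erealToENN.comp hψ.1.neg)) hψ.2.2]
      with x hx hx' hx''
    have hL : MemL1 (disint π x) ψ := ⟨hψ.1, hψ.2.1, hx''⟩
    have h1 := hle x ⟨disint π x, inferInstance, hx⟩ hL
    simp only [hL.eInt_eq] at h1
    by_cases hc : C x (disint π x) = ⊤
    · simp [hc]
    rw [← EReal.coe_toReal (x := φ x) (fun e => hφ.2.1 x (by simp [e])) fun e => by simp [e] at hx',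
      ← EReal.coe_ennreal_toReal hc, ← EReal.coe_sub, EReal.coe_le_coe_iff] at h1
    exact (ENNReal.ofReal_le_iff_le_toReal hc).2 h1
  refine le_trans ?_ (EReal.coe_ennreal_le_coe_ennreal_iff.2 hkey)
  rw [EReal.coe_ennreal_ofReal]
  exact EReal.coe_le_coe_iff.2 (le_max_left _ _)

end WeakDuality

/-- **Dual attainment with increasing convex potentials** (Theorem 8): under conditions (B)
and (C), the dual problem restricted to coordinatewise increasing convex potentials has the
same value as the primal weak transport problem and is attained by a `ν`-integrable
increasing convex function `ψ : ℝ^d → (-∞,∞]`. -/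
theorem dual_attainment_increasing_convex
    {X : Type*} [TopologicalSpace X] [PolishSpace X] [MeasurableSpace X] [BorelSpace X]
    {d : ℕ} {p : ℝ} (hp : 1 ≤ p)
    (μ : Measure X) (hμ : IsProbabilityMeasure μ)
    (ν : Measure (Rd d)) (hν : IsProbabilityMeasure ν) (hνp : HasMomentP p ν)
    (C : X → Measure (Rd d) → ℝ≥0∞)
    (hlsc : LowerSemicontinuous fun q : X × Pp p d => C q.1 q.2.1)
    (hconv : ∀ x : X, ∀ ρ₁ ρ₂ : Pp p d, ∀ t : ℝ≥0∞, t ≤ 1 →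
      C x (t • ρ₁.1 + (1 - t) • ρ₂.1) ≤ t * C x ρ₁.1 + (1 - t) * C x ρ₂.1)
    (hmono : ∀ x : X, ∀ ρ₁ ρ₂ : Pp p d, IcxOrder ρ₁.1 ρ₂.1 → C x ρ₂.1 ≤ C x ρ₁.1)
    (hB : CondB p μ ν C) (hC : CondC p C) :
    (((primal μ ν C : ℝ≥0∞)) : EReal)
        = (⨆ ψ : {ψ : Rd d → EReal //
              (EConvex ψ ∧ ECoordMono ψ) ∧ InPhi p μ ν C (conjL1 p C ψ) ψ},
            eInt μ (conjL1 p C ψ.1) - eInt ν ψ.1)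
      ∧ ∃ ψ : Rd d → EReal, EConvex ψ ∧ ECoordMono ψ ∧ InPhi p μ ν C (conjL1 p C ψ) ψ ∧
          eInt μ (conjL1 p C ψ) - eInt ν ψ = ((primal μ ν C : ℝ≥0∞) : EReal) := by
  obtain ⟨a, ha, b, hb, hab⟩ := hB
  obtain ⟨w, hwc, hw0, hwν, hwg⟩ := exists_weight hp hνp
  have hw : IsWeight p w := ⟨hwc, hw0, hwg⟩
  obtain ⟨hfin, K, ψ₀, D, h⟩ :=
    exists_isLimitPotential hp μ ⟨ν, hν, hνp⟩ hlsc hconv ha hb hab hw hwν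
  obtain ⟨ψ, hψc, hψm, hψ, hle⟩ := h.exists_attaining hlsc hmono hC ha hb hab
    fun m => isCompact_supported hp hw (h.compact m)
  rw [EReal.coe_ennreal_toReal hfin] at hle
  have heq := (hψ.sub_le_primal hp hνp).antisymm hle
  exact ⟨(heq.symm.le.trans (le_iSup (fun ψ : {ψ : Rd d → EReal //
    (EConvex ψ ∧ ECoordMono ψ) ∧ InPhi p μ ν C (conjL1 p C ψ) ψ} =>
      eInt μ (conjL1 p C ψ.1) - eInt ν ψ.1) ⟨ψ, ⟨hψc, hψm⟩, hψ⟩)).antisymm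
      (iSup_le fun ψ => ψ.2.2.sub_le_primal hp hνp), ψ, hψc, hψm, hψ, heq⟩
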